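/- Let M be an o-minimal structure and let (X,τ) be a definable topological space in M. If (X,τ) is definably compact then it is curve-compact. Moreover, if τ is Hausdorff or M has definable choice, then (X,τ) is definably compact if and only if it is curve-compact. -/

import Mathlib

open FirstOrder Set

/-- `M` is an o-minimal `L`-structure: a densely linearly ordered structure without endpoints,
whose order is `∅`-definable, and in which every definable (with parameters) subset of `M`
is a finite union of points and open intervals with endpoints in `M ∪ {±∞}`. -/
def IsOMinimal (L : FirstOrder.Language) (M : Type*) [L.Structure M] [LinearOrder M] : Prop :=
  Nonempty M ∧ DenselyOrdered M ∧ NoMinOrder M ∧ NoMaxOrder M ∧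
  Set.Definable (∅ : Set M) L {v : Fin 2 → M | v 0 < v 1} ∧
  ∀ s : Set M, Set.Definable₁ (Set.univ : Set M) L s →
    ∃ F : Finset (Set M), s = ⋃₀ (F : Set (Set M)) ∧
      ∀ t ∈ F, (∃ a : M, t = {a}) ∨ (∃ a b : M, t = Set.Ioo a b) ∨
        (∃ a : M, t = Set.Ioi a) ∨ (∃ a : M, t = Set.Iio a) ∨ t = Set.univ

/-- The fiber over `u` of a set `D ⊆ M^{m+n}`, i.e. the set `φ(u, M^n)`. -/
def famFiber {M : Type*} {m n : ℕ} (D : Set (Fin m ⊕ Fin n → M)) (u : Fin m → M) :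
    Set (Fin n → M) :=
  {v | Sum.elim u v ∈ D}

/-- An `A`-definable family of subsets of `M^n`: the family of fibers `φ(u, M^n)` for `u`
ranging over an `A`-definable index set `Ω`, where `φ` is `A`-definable. -/
def IsDefFamily (L : FirstOrder.Language) {M : Type*} [L.Structure M] (A : Set M) (n : ℕ)
    (S : Set (Set (Fin n → M))) : Prop :=
  ∃ (m : ℕ) (Ω : Set (Fin m → M)) (D : Set (Fin m ⊕ Fin n → M)),
    Set.Definable A L Ω ∧ Set.Definable A L D ∧ S = famFiber D '' Ω

/-- A family of sets is downward directed: it does not contain `∅` and any two members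
contain a common member. -/
def DirectedFam {α : Type*} (S : Set (Set α)) : Prop :=
  ∅ ∉ S ∧ ∀ X ∈ S, ∀ Y ∈ S, ∃ Z ∈ S, Z ⊆ X ∩ Y

/-- `S` is finer than `F`: every member of `F` contains a member of `S`. -/
def FinerThan {α : Type*} (S F : Set (Set α)) : Prop :=
  ∀ X ∈ F, ∃ Y ∈ S, Y ⊆ X

/-- A (complete) `n`-type over `M`: an ultrafilter on the Boolean algebra of definable
subsets of `M^n`. -/
def IsTypeOn (L : FirstOrder.Language) {M : Type*} [L.Structure M] (n : ℕ)
    (p : Set (Set (Fin n → M))) : Prop :=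
  (∀ X ∈ p, Set.Definable (Set.univ : Set M) L X) ∧
  ∅ ∉ p ∧
  (∀ X ∈ p, ∀ Y ∈ p, X ∩ Y ∈ p) ∧
  (∀ X ∈ p, ∀ Y : Set (Fin n → M), Set.Definable (Set.univ : Set M) L Y → X ⊆ Y → Y ∈ p) ∧
  (∀ X : Set (Fin n → M), Set.Definable (Set.univ : Set M) L X → X ∈ p ∨ Xᶜ ∈ p)

/-- A type `p` is `A`-definable if for every `∅`-definable `D ⊆ M^{m+n}` the set of
parameters `u` with `φ(u, M^n) ∈ p` is `A`-definable. -/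
def IsDefTypeOver (L : FirstOrder.Language) {M : Type*} [L.Structure M] (A : Set M) (n : ℕ)
    (p : Set (Set (Fin n → M))) : Prop :=
  ∀ (m : ℕ) (D : Set (Fin m ⊕ Fin n → M)), Set.Definable (∅ : Set M) L D →
    Set.Definable A L {u : Fin m → M | famFiber D u ∈ p}

/-- A family `F` is complete for a family `X` if each member of `X` either contains a member
of `F` or is disjoint from one. -/
def CompleteFor {α : Type*} (F X : Set (Set α)) : Prop :=
  ∀ Y ∈ X, ∃ Z ∈ F, Z ⊆ Y ∨ Z ∩ Y = ∅

/-- A family of subsets of `M^n` is complete if it decides every definable set. -/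
def IsCompleteFam (L : FirstOrder.Language) {M : Type*} [L.Structure M] (n : ℕ)
    (S : Set (Set (Fin n → M))) : Prop :=
  ∀ X : Set (Fin n → M), Set.Definable (Set.univ : Set M) L X → ∃ Z ∈ S, Z ⊆ X ∨ Z ∩ X = ∅

/-- `B` is a basis for the type `p`: a downward directed subfamily generating `p`. -/
def IsBasisOfType {α : Type*} (B p : Set (Set α)) : Prop :=
  B ⊆ p ∧ DirectedFam B ∧ ∀ Y ∈ p, ∃ Z ∈ B, Z ⊆ Y

/-- `p` has an `A`-definable basis. -/
def HasDefBasis (L : FirstOrder.Language) {M : Type*} [L.Structure M] (A : Set M) (n : ℕ)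
    (p : Set (Set (Fin n → M))) : Prop :=
  ∃ B, IsDefFamily L A n B ∧ IsBasisOfType B p

/-- `S` has a finite tame transversal: it is covered by finitely many subfamilies, each of
which extends to a definable type. -/
def HasFTT (L : FirstOrder.Language) {M : Type*} [L.Structure M] (n : ℕ)
    (S : Set (Set (Fin n → M))) : Prop :=
  ∃ (N : ℕ) (p : Fin N → Set (Set (Fin n → M))),
    (∀ i, IsTypeOn L n (p i) ∧ IsDefTypeOver L (Set.univ : Set M) n (p i)) ∧
    ∀ X ∈ S, ∃ i, X ∈ p i

/-- The `(m,n)`-property: among any `m` members of the family, some `n` have nonempty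
intersection. -/
def HasMNProperty {α : Type*} (S : Set (Set α)) (m n : ℕ) : Prop :=
  ∀ F : Finset (Set α), ↑F ⊆ S → F.card = m →
    ∃ G ⊆ F, G.card = n ∧ (⋂₀ (G : Set (Set α))).Nonempty

/-- `C` is a `τ`-closed subset of `X`. -/
def TauClosed {M : Type*} {k : ℕ} (X : Set (Fin k → M)) [TopologicalSpace ↥X]
    (C : Set (Fin k → M)) : Prop :=
  C ⊆ X ∧ IsClosed (Subtype.val ⁻¹' C : Set ↥X)

/-- `(X,τ)` is a definable topological space with an `A`-definable basis:
`X` is `A`-definable and the topology on `X` has a basis given by an `A`-definable family. -/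
def IsDefTopSpaceOver (L : FirstOrder.Language) {M : Type*} [L.Structure M] (A : Set M) {k : ℕ}
    (X : Set (Fin k → M)) [TopologicalSpace ↥X] : Prop :=
  Set.Definable A L X ∧
  ∃ B : Set (Set (Fin k → M)), IsDefFamily L A k B ∧ (∀ U ∈ B, U ⊆ X) ∧
    TopologicalSpace.IsTopologicalBasis ((fun U => (Subtype.val ⁻¹' U : Set ↥X)) '' B)

/-- `(X,τ)` is a definable topological space. -/
def IsDefTopSpace (L : FirstOrder.Language) {M : Type*} [L.Structure M] {k : ℕ}
    (X : Set (Fin k → M)) [TopologicalSpace ↥X] : Prop :=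
  IsDefTopSpaceOver L (Set.univ : Set M) X

/-- `(X,τ)` is definably compact: every definable downward directed family of nonempty
`τ`-closed subsets of `X` has nonempty intersection. -/
def DefinablyCompact (L : FirstOrder.Language) {M : Type*} [L.Structure M] {k : ℕ}
    (X : Set (Fin k → M)) [TopologicalSpace ↥X] : Prop :=
  ∀ C : Set (Set (Fin k → M)), IsDefFamily L (Set.univ : Set M) k C → DirectedFam C →
    (∀ Y ∈ C, Y.Nonempty ∧ TauClosed X Y) → (⋂₀ C).Nonempty

/-- `x` is a limit of the type `p` in `(X,τ)`: `x` belongs to every `τ`-closed member of `p`. -/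
def IsLimitOf {M : Type*} {k : ℕ} (X : Set (Fin k → M)) [TopologicalSpace ↥X]
    (p : Set (Set (Fin k → M))) (x : Fin k → M) : Prop :=
  x ∈ X ∧ ∀ C ∈ p, TauClosed X C → x ∈ C

/-- `(X,τ)` is type-compact: every definable type containing `X` has a limit in `X`. -/
def TypeCompact (L : FirstOrder.Language) {M : Type*} [L.Structure M] {k : ℕ}
    (X : Set (Fin k → M)) [TopologicalSpace ↥X] : Prop :=
  ∀ p : Set (Set (Fin k → M)), IsTypeOn L k p → IsDefTypeOver L (Set.univ : Set M) k p →
    X ∈ p → ∃ x, IsLimitOf X p x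

/-- `I` is an open interval of `M` with endpoints in `M ∪ {±∞}`. -/
def IsOpenIntervalSet {M : Type*} [LinearOrder M] (I : Set M) : Prop :=
  (∃ a b : M, I = Set.Ioo a b) ∨ (∃ a : M, I = Set.Ioi a) ∨ (∃ b : M, I = Set.Iio b) ∨
  I = Set.univ

/-- A definable curve in `X`: a definable map from a nonempty open interval into `X`. -/
def IsDefCurve (L : FirstOrder.Language) {M : Type*} [L.Structure M] [LinearOrder M] {k : ℕ}
    (X : Set (Fin k → M)) (I : Set M) (γ : M → (Fin k → M)) : Prop :=
  IsOpenIntervalSet I ∧ I.Nonempty ∧ (∀ s ∈ I, γ s ∈ X) ∧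
  Set.Definable (Set.univ : Set M) L
    {w : Fin 1 ⊕ Fin k → M | w (Sum.inl 0) ∈ I ∧ ∀ j, γ (w (Sum.inl 0)) j = w (Sum.inr j)}

/-- The curve `γ` `τ`-converges in `X` at the left endpoint of its domain `I`. -/
def CurveConvergesLeft {M : Type*} [LinearOrder M] {k : ℕ} (X : Set (Fin k → M))
    [TopologicalSpace ↥X] (I : Set M) (γ : M → (Fin k → M)) : Prop :=
  ∃ x ∈ X, ∀ A : Set (Fin k → M), A ⊆ X → IsOpen (Subtype.val ⁻¹' A : Set ↥X) → x ∈ A →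
    ∃ t ∈ I, ∀ s ∈ I, s ≤ t → γ s ∈ A

/-- The curve `γ` `τ`-converges in `X` at the right endpoint of its domain `I`. -/
def CurveConvergesRight {M : Type*} [LinearOrder M] {k : ℕ} (X : Set (Fin k → M))
    [TopologicalSpace ↥X] (I : Set M) (γ : M → (Fin k → M)) : Prop :=
  ∃ x ∈ X, ∀ A : Set (Fin k → M), A ⊆ X → IsOpen (Subtype.val ⁻¹' A : Set ↥X) → x ∈ A →
    ∃ t ∈ I, ∀ s ∈ I, t ≤ s → γ s ∈ A

/-- `(X,τ)` is curve-compact: every definable curve in `X` converges at both endpoints. -/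
def CurveCompact (L : FirstOrder.Language) {M : Type*} [L.Structure M] [LinearOrder M] {k : ℕ}
    (X : Set (Fin k → M)) [TopologicalSpace ↥X] : Prop :=
  ∀ (I : Set M) (γ : M → (Fin k → M)), IsDefCurve L X I γ →
    CurveConvergesLeft X I γ ∧ CurveConvergesRight X I γ

/-- `M` has definable choice: every definable family of nonempty sets admits a definable
choice function. -/
def HasDefinableChoice (L : FirstOrder.Language) (M : Type*) [L.Structure M] : Prop :=
  ∀ (m k : ℕ) (Ω : Set (Fin m → M)) (D : Set (Fin m ⊕ Fin k → M)),
    Set.Definable (Set.univ : Set M) L Ω → Set.Definable (Set.univ : Set M) L D →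
    (∀ u ∈ Ω, (famFiber D u).Nonempty) →
    ∃ s : (Fin m → M) → (Fin k → M),
      (∀ u ∈ Ω, Sum.elim u (s u) ∈ D) ∧
      Set.Definable (Set.univ : Set M) L
        {w : Fin m ⊕ Fin k → M | (w ∘ Sum.inl) ∈ Ω ∧ s (w ∘ Sum.inl) = w ∘ Sum.inr}


namespace OM
universe u

/-- An abstract system of definable sets. -/
class DS (M : Type u) where
  D : ∀ {ι : Type}, Set (ι → M) → Prop
  compl : ∀ {ι : Type} {s : Set (ι → M)}, D s → D sᶜ
  inter : ∀ {ι : Type} {s t : Set (ι → M)}, D s → D t → D (s ∩ t)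
  iInter : ∀ {ι κ : Type} [Finite κ] {s : κ → Set (ι → M)}, (∀ i, D (s i)) → D (⋂ i, s i)
  reidx : ∀ {ι κ : Type} (f : ι → κ) {s : Set (ι → M)}, D s → D {v : κ → M | v ∘ f ∈ s}
  proj : ∀ {ι κ : Type} [Finite ι] [Finite κ] {s : Set (ι ⊕ κ → M)}, D s →
    D {v : ι → M | ∃ w : κ → M, Sum.elim v w ∈ s}
  eq : ∀ {ι : Type} (i j : ι), D {v : ι → M | v i = v j}
  const : ∀ {ι : Type} (i : ι) (a : M), D {v : ι → M | v i = a}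

/-- Types which are (identified with) finite powers of `M`. -/
class DTy (T : Type u) (M : outParam (Type u)) where
  ι : Type
  fin : Finite ι
  e : T ≃ (ι → M)

attribute [instance] DTy.fin

instance baseDTy {M : Type u} [DS M] : DTy M M where
  ι := Unit
  fin := inferInstance
  e := ⟨fun x _ => x, fun v => v (), fun _ => rfl, fun _ => rfl⟩

instance prodDTy {M : Type u} {T S : Type u} [DTy T M] [DTy S M] : DTy (T × S) M where
  ι := DTy.ι T ⊕ DTy.ι S
  fin := inferInstance
  e := ⟨fun p => Sum.elim (DTy.e p.1) (DTy.e p.2),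
    fun v => (DTy.e.symm (v ∘ Sum.inl), DTy.e.symm (v ∘ Sum.inr)),
    fun p => by simp,
    fun v => by simp⟩

section
variable {M : Type u} [DS M] {T S U V : Type u} [DTy T M] [DTy S M] [DTy U M] [DTy V M]

/-- definable subset -/
class DSet (A : Set T) : Prop where
  out : DS.D {v : DTy.ι T → M | DTy.e.symm v ∈ A}

/-- definable predicate -/
class Df (P : T → Prop) : Prop where
  out : DSet {x | P x}

theorem DSet.coord {A : Set S} (hA : DSet A) (f : T → S) (ρ : DTy.ι S → DTy.ι T)
    (h : ∀ x, DTy.e (f x) = DTy.e x ∘ ρ) : DSet {x | f x ∈ A} := by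
  constructor
  have := DS.reidx ρ hA.out
  convert this using 1
  ext v
  have h' := h (DTy.e.symm v)
  simp only [Equiv.apply_symm_apply] at h'
  simp only [mem_ofPred_eq, ← h', Equiv.symm_apply_apply]

theorem DSet.pfst {A : Set T} (hA : DSet A) : DSet {p : T × S | p.1 ∈ A} :=
  hA.coord Prod.fst Sum.inl fun _ => rfl
theorem DSet.psnd {A : Set S} (hA : DSet A) : DSet {p : T × S | p.2 ∈ A} :=
  hA.coord Prod.snd Sum.inr fun _ => rfl

theorem DSet.not {A : Set T} (hA : DSet A) : DSet {x | x ∉ A} := ⟨DS.compl hA.out⟩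
theorem DSet.and {A B : Set T} (hA : DSet A) (hB : DSet B) : DSet {x | x ∈ A ∧ x ∈ B} :=
  ⟨DS.inter hA.out hB.out⟩
theorem DSet.iAll {κ : Type} [Finite κ] {A : κ → Set T} (hA : ∀ i, DSet (A i)) :
    DSet {x | ∀ i, x ∈ A i} := by
  constructor
  have := DS.iInter fun i => (hA i).out
  convert this using 1
  ext v; simp

theorem DSet.ex {A : Set (T × S)} (hA : DSet A) : DSet {x | ∃ y, (x, y) ∈ A} := by
  constructor
  have := DS.proj hA.out
  convert this using 1
  ext v
  constructor
  · rintro ⟨y, hy⟩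
    refine ⟨DTy.e y, ?_⟩
    change (DTy.e.symm (Sum.elim v (DTy.e y) ∘ Sum.inl), DTy.e.symm (Sum.elim v (DTy.e y) ∘ Sum.inr)) ∈ A
    simpa using hy
  · rintro ⟨w, hw⟩
    change (DTy.e.symm (Sum.elim v w ∘ Sum.inl), DTy.e.symm (Sum.elim v w ∘ Sum.inr)) ∈ A at hw
    exact ⟨DTy.e.symm w, by simpa using hw⟩

theorem DSet.eqq : DSet {p : T × T | p.1 = p.2} := by
  constructor
  have := DS.iInter (κ := DTy.ι T) (M := M) (fun i => DS.eq (ι := DTy.ι T ⊕ DTy.ι T) (Sum.inl i) (Sum.inr i))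
  have h2 : {v : DTy.ι T ⊕ DTy.ι T → M | DTy.e.symm (v ∘ Sum.inl) = DTy.e.symm (v ∘ Sum.inr)} =
      ⋂ i : DTy.ι T, {v : DTy.ι T ⊕ DTy.ι T → M | v (Sum.inl i) = v (Sum.inr i)} := by
    ext v
    simp [funext_iff]
  rw [← h2] at this
  exact this

theorem DSet.eqc (a : T) : DSet {p : T | p = a} := by
  constructor
  have := DS.iInter (κ := DTy.ι T) (M := M) (fun i => DS.const (ι := DTy.ι T) i (DTy.e a i))
  convert this using 1
  ext v
  simp only [mem_ofPred_eq, mem_iInter, ← funext_iff, Equiv.symm_apply_eq]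

/-- definable function -/
class DFn (f : T → S) : Prop where
  out : DSet {p : T × S | f p.1 = p.2}

theorem DSet.pre {A : Set S} (hA : DSet A) {f : T → S} (hf : DFn f) : DSet {x | f x ∈ A} := by
  have := (hf.out.and (hA.psnd (T := T))).ex
  convert this using 1
  ext x; simp

theorem DFn.ofCoord {f : T → S} (ρ : DTy.ι S → DTy.ι T)
    (h : ∀ x, DTy.e (f x) = DTy.e x ∘ ρ) : DFn f := by
  constructor
  exact (DSet.eqq (T := S)).coord (fun p : T × S => (f p.1, p.2))
    (Sum.elim (fun i => Sum.inl (ρ i)) Sum.inr) (by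
      rintro ⟨x, y⟩
      funext i
      rcases i with i | i
      · exact congrFun (h x) i
      · rfl)

theorem DFn.comp {g : S → U} {f : T → S} (hg : DFn g) (hf : DFn f) : DFn (fun x => g (f x)) := by
  constructor
  have h1 : DSet {q : (T × U) × S | (q.1.1, q.2) ∈ {p : T × S | f p.1 = p.2}} :=
    hf.out.coord (fun q : (T × U) × S => (q.1.1, q.2))
      (Sum.elim (fun i => Sum.inl (Sum.inl i)) Sum.inr) (by
        rintro ⟨⟨x, y⟩, z⟩; funext i; rcases i with i | i <;> rfl)
  have h2 : DSet {q : (T × U) × S | (q.2, q.1.2) ∈ {p : S × U | g p.1 = p.2}} :=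
    hg.out.coord (fun q : (T × U) × S => (q.2, q.1.2))
      (Sum.elim Sum.inr (fun i => Sum.inl (Sum.inr i))) (by
        rintro ⟨⟨x, y⟩, z⟩; funext i; rcases i with i | i <;> rfl)
  have := (h1.and h2).ex
  convert this using 1
  ext x; simp

instance (priority := 1200) DFn.id' : DFn (fun x : T => x) := DFn.ofCoord (fun i => i) fun _ => rfl
instance DFn.fst' {f : T → S × U} [DFn f] : DFn (fun x => (f x).1) :=
  DFn.comp (DFn.ofCoord Sum.inl fun _ => rfl) ‹DFn f›
instance DFn.snd' {f : T → S × U} [DFn f] : DFn (fun x => (f x).2) :=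
  DFn.comp (DFn.ofCoord Sum.inr fun _ => rfl) ‹DFn f›
instance (priority := 1100) DFn.fst0 : DFn (Prod.fst : T × S → T) := DFn.ofCoord Sum.inl fun _ => rfl
instance (priority := 1100) DFn.snd0 : DFn (Prod.snd : T × S → S) := DFn.ofCoord Sum.inr fun _ => rfl
instance (priority := 500) DFn.pair {f : T → S} {g : T → U} [hf : DFn f] [hg : DFn g] : DFn (fun x => (f x, g x)) := by
  constructor
  have h1 : DSet {q : T × (S × U) | (q.1, q.2.1) ∈ {p : T × S | f p.1 = p.2}} :=
    hf.out.coord (fun q : T × (S × U) => (q.1, q.2.1))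
      (Sum.elim (fun i => Sum.inl i) (fun i => Sum.inr (Sum.inl i))) (by
        rintro ⟨x, y, z⟩; funext i; rcases i with i | i <;> rfl)
  have h2 : DSet {q : T × (S × U) | (q.1, q.2.2) ∈ {p : T × U | g p.1 = p.2}} :=
    hg.out.coord (fun q : T × (S × U) => (q.1, q.2.2))
      (Sum.elim (fun i => Sum.inl i) (fun i => Sum.inr (Sum.inr i))) (by
        rintro ⟨x, y, z⟩; funext i; rcases i with i | i <;> rfl)
  have := h1.and h2
  convert this using 1
  ext ⟨x, y, z⟩; simp [Prod.ext_iff]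
instance DFn.const' (a : S) : DFn (fun _ : T => a) := by
  constructor
  have := (DSet.eqc a).psnd (T := T)
  convert this using 1
  ext ⟨x, y⟩; simp [eq_comm]

instance DSet.ofDf {P : T → Prop} [h : Df P] : DSet {x | P x} := h.out
instance DSet.univ' : DSet (Set.univ : Set T) := by
  have := (DSet.eqq (T := T)).coord (fun x : T => (x, x)) (Sum.elim (fun i => i) (fun i => i))
    (by intro x; funext i; rcases i with i | i <;> rfl)
  convert this using 1
  ext; simp
instance Df.mem {A : Set S} {f : T → S} [hA : DSet A] [hf : DFn f] : Df (fun x => f x ∈ A) :=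
  ⟨hA.pre hf⟩
instance Df.not {P : T → Prop} [hP : Df P] : Df (fun x => ¬ P x) := ⟨hP.out.not⟩
instance Df.and {P Q : T → Prop} [hP : Df P] [hQ : Df Q] : Df (fun x => P x ∧ Q x) :=
  ⟨hP.out.and hQ.out⟩
instance Df.or {P Q : T → Prop} [hP : Df P] [hQ : Df Q] : Df (fun x => P x ∨ Q x) := by
  constructor
  have := (hP.out.not.and hQ.out.not).not
  convert this using 1
  ext; simp; tauto
instance (priority := 900) Df.imp {P Q : T → Prop} [hP : Df P] [hQ : Df Q] : Df (fun x => P x → Q x) := by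
  constructor
  have := (hP.out.and hQ.out.not).not
  convert this using 1
  ext; simp
instance Df.iff {P Q : T → Prop} [hP : Df P] [hQ : Df Q] : Df (fun x => P x ↔ Q x) := by
  have : Df (fun x => (P x → Q x) ∧ (Q x → P x)) := inferInstance
  convert this using 2
  exact iff_iff_implies_and_implies
instance Df.ex {P : T → S → Prop} [hP : Df (fun p : T × S => P p.1 p.2)] :
    Df (fun x => ∃ y, P x y) := ⟨hP.out.ex⟩
instance Df.all {P : T → S → Prop} [hP : Df (fun p : T × S => P p.1 p.2)] :
    Df (fun x => ∀ y, P x y) := by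
  constructor
  have := hP.out.not.ex.not
  convert this using 1
  ext; simp
instance Df.eq' {f g : T → S} [hf : DFn f] [hg : DFn g] : Df (fun x => f x = g x) :=
  ⟨(DSet.eqq (T := S)).pre (f := fun x => (f x, g x)) inferInstance⟩
instance Df.tf (p : Prop) : Df (fun _ : T => p) := by
  constructor
  by_cases hp : p
  · simpa [hp] using (DSet.univ' (T := T))
  · simpa [hp] using (DSet.univ' (T := T)).not
instance DSet.inter' {A B : Set T} [hA : DSet A] [hB : DSet B] : DSet (A ∩ B) := hA.and hB
instance DSet.compl' {A : Set T} [hA : DSet A] : DSet (Aᶜ) := hA.not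
instance DSet.diff' {A B : Set T} [hA : DSet A] [hB : DSet B] : DSet (A \ B) := hA.and hB.not
instance DSet.singleton' (a : T) : DSet ({a} : Set T) := DSet.eqc a

instance Df.mem0 {A : Set T} [hA : DSet A] : Df (Membership.mem A) := ⟨hA⟩
instance Df.eq0 (a : T) : Df (Eq a) := by
  have : Df (fun x => x = a) := ⟨DSet.eqc a⟩
  convert this using 2
  exact eq_comm
instance DFn.mk0 (a : S) : DFn (Prod.mk a : T → S × T) := by
  have : DFn (fun x : T => (a, (fun x => x) x)) := inferInstance
  exact this

theorem DFn.iff {f : T → S} : DFn f ↔ Df (fun p : T × S => f p.1 = p.2) :=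
  ⟨fun h => ⟨h.out⟩, fun h => ⟨h.out⟩⟩
theorem Df.comp {P : S → Prop} (hP : Df P) {f : T → S} (hf : DFn f) : Df (fun x => P (f x)) :=
  ⟨hP.out.pre hf⟩
theorem Df.congr {P Q : T → Prop} (hP : Df P) (h : ∀ x, P x ↔ Q x) : Df Q := by
  have : P = Q := funext fun x => propext (h x)
  exact this ▸ hP
theorem Df.dset {A : Set T} (h : Df (fun x => x ∈ A)) : DSet A := h.out

end

/-- o-minimality in abstract form -/
class OMin (M : Type u) [DS M] [LinearOrder M] : Prop where
  ne : Nonempty M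
  dense : DenselyOrdered M
  nomin : NoMinOrder M
  nomax : NoMaxOrder M
  lt : DSet {p : M × M | p.1 < p.2}
  bd : ∀ A : Set M, DSet A → ∃ B : Finset M, ∀ x y, (∀ b ∈ B, (b < x ↔ b < y) ∧ (b ≤ x ↔ b ≤ y)) →
    (x ∈ A ↔ y ∈ A)

attribute [instance] OMin.ne OMin.dense OMin.nomin OMin.nomax

section
variable {M : Type u} [DS M] [LinearOrder M] [OMin M] {T S U V : Type u} [DTy T M] [DTy S M] [DTy U M]
instance Df.lt {f g : T → M} [hf : DFn f] [hg : DFn g] : Df (fun x => f x < g x) :=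
  ⟨(OMin.lt (M := M)).pre (f := fun x => (f x, g x)) inferInstance⟩
instance Df.le {f g : T → M} [hf : DFn f] [hg : DFn g] : Df (fun x => f x ≤ g x) := by
  have : Df (fun x => ¬ g x < f x) := inferInstance
  exact this.congr fun x => not_lt

instance Df.lt0 (a : M) : Df (LT.lt a) := Df.lt (f := fun _ => a) (g := fun x => x)
instance Df.le0 (a : M) : Df (LE.le a) := Df.le (f := fun _ => a) (g := fun x => x)

end
end OM

namespace OM
universe u

/-- the reversed order -/
abbrev swapLO (M : Type u) [LinearOrder M] : LinearOrder M :=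
  inferInstanceAs (LinearOrder (OrderDual M))

/-- a lower set without maximum -/
structure Hend {M : Type u} [LinearOrder M] (H : Set M) : Prop where
  low : ∀ x y, y ∈ H → x < y → x ∈ H
  ne : H.Nonempty
  nomax : ∀ x ∈ H, ∃ y ∈ H, x < y

/-- local constancy -/
def LC {M : Type u} [LinearOrder M] (B : Set M) (d : M) : Prop :=
  ∃ a, a < d ∧ ∃ b, d < b ∧ ∀ y, a < y → y < b → (y ∈ B ↔ d ∈ B)

theorem Hend.fin {M : Type u} [LinearOrder M] {H : Set M} (h : Hend H) (B : Finset M) : ∃ x ∈ H, ∀ b ∈ B, b ∈ H → b < x := by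
  classical
  induction B using Finset.induction_on with
  | empty => obtain ⟨x, hx⟩ := h.ne; exact ⟨x, hx, by simp⟩
  | insert a s _ ih =>
    obtain ⟨x, hx, h1⟩ := ih
    by_cases ha : a ∈ H
    · obtain ⟨y, hy, hxy⟩ := h.nomax (max a x) (by rcases max_choice a x with e | e <;> rw [e] <;> assumption)
      refine ⟨y, hy, ?_⟩
      intro b hb hbH
      rcases Finset.mem_insert.1 hb with rfl | hb
      · exact lt_of_le_of_lt (le_max_left _ _) hxy
      · exact (h1 b hb hbH).trans (lt_of_le_of_lt (le_max_right _ _) hxy)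
    · refine ⟨x, hx, ?_⟩
      intro b hb hbH
      rcases Finset.mem_insert.1 hb with rfl | hb
      · exact absurd hbH ha
      · exact h1 b hb hbH

section basics
variable {M : Type u} [DS M] [LinearOrder M] [OMin M]

theorem swapOMin (M : Type u) [DS M] [LinearOrder M] [OMin M] :
    @OMin M _ (swapLO M) := by
  refine @OMin.mk M _ (swapLO M) OMin.ne ?_ ?_ ?_ ?_ ?_
  · exact @DenselyOrdered.mk M (swapLO M).toLT fun a b h => by
      obtain ⟨c, h1, h2⟩ := exists_between (α := M) (a₁ := b) (a₂ := a) h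
      exact ⟨c, h2, h1⟩
  · exact @NoMinOrder.mk M (swapLO M).toLT fun a => by
      obtain ⟨c, h1⟩ := exists_gt a
      exact ⟨c, h1⟩
  · exact @NoMaxOrder.mk M (swapLO M).toLT fun a => by
      obtain ⟨c, h1⟩ := exists_lt a
      exact ⟨c, h1⟩
  · have : DSet {p : M × M | p.2 < p.1} := inferInstance
    exact this
  · intro A hA
    obtain ⟨B, hB⟩ := OMin.bd A hA
    refine ⟨B, fun x y h => hB x y fun b hb => ?_⟩
    have h1 : (x < b ↔ y < b) ∧ (x ≤ b ↔ y ≤ b) := h b hb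
    rw [← not_le, ← not_le (a := y), ← not_lt (a := x), ← not_lt (a := y)]
    exact ⟨not_congr h1.2, not_congr h1.1⟩

theorem cut {H : Set M} [DSet H] (low : ∀ x y, y ∈ H → x < y → x ∈ H) (h1 : H.Nonempty)
    (h2 : ∃ z, z ∉ H) : ∃ a, (∀ x, x ∈ H ↔ x < a) ∨ (∀ x, x ∈ H ↔ x ≤ a) := by
  by_contra hcon
  push Not at hcon
  have hA : Hend H := by
    refine ⟨low, h1, fun x hx => ?_⟩
    by_contra hh
    push Not at hh
    obtain ⟨y, hy⟩ := (hcon x).2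
    rcases hy with hy | hy
    · exact absurd (hh y hy.1) (not_le.2 hy.2)
    · rcases hy.2.eq_or_lt with rfl | h
      · exact hy.1 hx
      · exact hy.1 (low _ _ hx h)
  have hB : @Hend M (swapLO M) Hᶜ := by
    refine @Hend.mk M (swapLO M) _ ?_ h2 ?_
    · intro x y hy hxy hx
      exact hy (low y x hx hxy)
    · intro x hx
      by_contra hh
      push Not at hh
      have hh : ∀ y, y ∉ H → x ≤ y := fun y hy => not_lt.1 (hh y hy)
      obtain ⟨y, hy⟩ := (hcon x).1
      rcases hy with hy | hy
      · rcases hy.2.eq_or_lt with rfl | h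
        · exact hx hy.1
        · exact hx (low _ _ hy.1 h)
      · exact absurd (hh y hy.1) (not_le.2 hy.2)
  obtain ⟨B, hB'⟩ := OMin.bd H ‹_›
  obtain ⟨x, hx, hx'⟩ := hA.fin B
  obtain ⟨y, hy, hy'⟩ := @Hend.fin M (swapLO M) Hᶜ hB B
  have hy' : ∀ b ∈ B, b ∉ H → y < b := hy'
  have hxy : x < y := by
    rcases lt_trichotomy x y with h | rfl | h
    · exact h
    · exact absurd hx hy
    · exact absurd (low _ _ hx h) hy
  refine hy ((hB' x y fun b hb => ?_).1 hx)
  by_cases hb' : b ∈ H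
  · have := hx' b hb hb'
    simp [this, this.trans hxy, this.le, (this.trans hxy).le]
  · have := hy' b hb hb'
    simp [not_lt.2 this.le, not_lt.2 (hxy.trans this).le, not_le.2 this, not_le.2 (hxy.trans this)]

theorem exists_nbhd (B : Finset M) (d : M) (hd : d ∉ B) :
    ∃ a, a < d ∧ ∃ b, d < b ∧ ∀ y, a < y → y < b → y ∉ B := by
  have h1 : Hend {x | x < d} := ⟨fun x y hy h => h.trans hy, exists_lt d, fun x hx => by
    obtain ⟨y, h⟩ := exists_between (show x < d from hx); exact ⟨y, h.2, h.1⟩⟩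
  have h2 : @Hend M (swapLO M) {x | d < x} := 
    @Hend.mk M (swapLO M) _ (fun x y (hy : d < y) (h : y < x) => hy.trans h) (exists_gt d) fun x hx => by
      obtain ⟨y, h⟩ := exists_between (show d < x from hx); exact ⟨y, h.1, h.2⟩
  obtain ⟨a, ha, ha'⟩ := h1.fin B
  obtain ⟨b, hb, hb'⟩ := @Hend.fin M (swapLO M) _ h2 B
  refine ⟨a, ha, b, hb, fun y h1 h2 h3 => ?_⟩
  rcases lt_trichotomy y d with h | rfl | h
  · exact lt_asymm h1 (ha' y h3 h)
  · exact hd h3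
  · exact lt_asymm h2 (hb' y h3 h)

theorem LC_of (A : Set M) [DSet A] : ∃ B : Finset M, ∀ d, d ∉ B → LC A d := by
  obtain ⟨B, hB⟩ := OMin.bd A ‹_›
  refine ⟨B, fun d hd => ?_⟩
  obtain ⟨a, ha, b, hb, h⟩ := exists_nbhd B d hd
  refine ⟨a, ha, b, hb, fun y h1 h2 => hB _ _ fun c hc => ?_⟩
  have key : ∀ z, a < z → z < b → (c < z ↔ c ≤ a) ∧ (c ≤ z ↔ c ≤ a) := by
    intro z h3 h4
    have : c < z ↔ c ≤ a := by
      constructor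
      · intro h5; by_contra h6; exact h c (not_le.1 h6) (h5.trans h4) hc
      · intro h5; exact h5.trans_lt h3
    refine ⟨this, ?_⟩
    rw [← this]
    exact ⟨fun h5 => h5.lt_of_ne (by rintro rfl; exact h _ h3 h4 hc), le_of_lt⟩
  have k1 := key y h1 h2
  have k2 := key d ha hb
  exact ⟨k1.1.trans k2.1.symm, k1.2.trans k2.2.symm⟩

theorem bdry_finite (A : Set M) [DSet A] : {d | ¬ LC A d}.Finite := by
  obtain ⟨B, hB⟩ := LC_of A
  refine B.finite_toSet.subset fun d hd => ?_
  by_contra h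
  exact hd (hB d h)

theorem inf_interval {A : Set M} [DSet A] (h : A.Infinite) : ∃ a b, a < b ∧ Ioo a b ⊆ A := by
  obtain ⟨d, hd, hd'⟩ := (h.sdiff (bdry_finite A)).nonempty
  have : LC A d := by by_contra h; exact hd' h
  obtain ⟨a, ha, b, hb, h⟩ := this
  exact ⟨a, b, ha.trans hb, fun y hy => (h y hy.1 hy.2).2 hd⟩

instance DSet.Ioo' (a b : M) : DSet (Ioo a b) := by
  have : DSet {x | a < x ∧ x < b} := inferInstance
  exact this
instance DSet.Ioi' (a : M) : DSet (Ioi a) := by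
  have : DSet {x | a < x} := inferInstance
  exact this
instance DSet.Iio' (a : M) : DSet (Iio a) := by
  have : DSet {x | x < a} := inferInstance
  exact this

/-- if a definable set misses only finitely many points of an interval it contains one. -/
theorem sub_of_fin {a b : M} (hab : a < b) {F : Set M} (hF : F.Finite) :
    ∃ c d, c < d ∧ Ioo c d ⊆ Ioo a b \ F := by
  have : (Ioo a b \ F).Infinite := (Set.Ioo_infinite hab).sdiff hF
  obtain ⟨d, hd⟩ := this.nonempty
  obtain ⟨p, hp, q, hq, h⟩ := exists_nbhd hF.toFinset d (by simpa using hd.2)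
  refine ⟨max p a, min q b, ?_, ?_⟩
  · exact (max_lt hp hd.1.1).trans (lt_min hq hd.1.2)
  · intro y hy
    have h1 := max_lt_iff.1 hy.1
    have h2 := lt_min_iff.1 hy.2
    exact ⟨⟨h1.2, h2.2⟩, by simpa using h y h1.1 h2.1⟩

/-- dichotomy on an interval -/
theorem sub_or {a b : M} (hab : a < b) (A : Set M) [DSet A] :
    ∃ c d, c < d ∧ Ioo c d ⊆ Ioo a b ∧ (Ioo c d ⊆ A ∨ Ioo c d ⊆ Aᶜ) := by
  by_cases h : (Ioo a b ∩ A).Infinite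
  · obtain ⟨c, d, h1, h2⟩ := inf_interval h
    exact ⟨c, d, h1, h2.trans inter_subset_left, Or.inl (h2.trans inter_subset_right)⟩
  · obtain ⟨c, d, h1, h2⟩ := sub_of_fin hab (not_infinite.1 h)
    exact ⟨c, d, h1, h2.trans sdiff_subset, Or.inr fun y hy hyA => (h2 hy).2 ⟨(h2 hy).1, hyA⟩⟩

theorem conn {B : Set M} [DSet B] {y z : M} (hyz : y ≤ z)
    (h : ∀ d, y ≤ d → d ≤ z → LC B d) : y ∈ B ↔ z ∈ B := by
  let H : Set M := {w | w < y ∨ ∀ v, y ≤ v → v ≤ w → (v ∈ B ↔ y ∈ B)}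
  have : DSet H := by
    have : DSet {w : M | w < y ∨ ∀ v, y ≤ v → v ≤ w → (v ∈ B ↔ y ∈ B)} := inferInstance
    exact this
  have hyH : y ∈ H := Or.inr fun v h1 h2 => by rw [le_antisymm h2 h1]
  by_contra hc
  have hzH : z ∉ H := by
    rintro (h1 | h1)
    · exact absurd h1 (not_lt.2 hyz)
    · exact hc (h1 z hyz le_rfl).symm
  have low : ∀ p q, q ∈ H → p < q → p ∈ H := by
    rintro p q (h1 | h1) hpq
    · exact Or.inl (hpq.trans h1)
    · exact Or.inr fun v h2 h3 => h1 v h2 (h3.trans hpq.le)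
  obtain ⟨a, ha⟩ := cut low ⟨y, hyH⟩ ⟨z, hzH⟩
  have hya : y ≤ a := by
    rcases ha with ha | ha
    · exact ((ha y).1 hyH).le
    · exact (ha y).1 hyH
  have haz : a ≤ z := by
    rcases ha with ha | ha
    · exact not_lt.1 fun h => hzH ((ha z).2 h)
    · exact (not_le.1 fun h => hzH ((ha z).2 h)).le
  obtain ⟨p, hp, q, hq, hpq⟩ := h a hya haz
  have key : ∀ v, y ≤ v → v < a → (v ∈ B ↔ y ∈ B) := by
    intro v h1 h2
    have : v ∈ H := by
      rcases ha with ha | ha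
      · exact (ha v).2 h2
      · exact (ha v).2 h2.le
    rcases this with h3 | h3
    · exact absurd h3 (not_lt.2 h1)
    · exact h3 v h1 le_rfl
  have key2 : a ∈ B ↔ y ∈ B := by
    rcases hya.eq_or_lt with rfl | h1
    · rfl
    · obtain ⟨v, hv1, hv2⟩ := exists_between (max_lt hp h1)
      have := max_lt_iff.1 hv1
      rw [← hpq v this.1 (hv2.trans hq)]
      exact key v this.2.le hv2
  obtain ⟨w, hw1, hw2⟩ := exists_between hq
  have hw : w ∈ H := by
    refine Or.inr fun v h1 h2 => ?_
    rcases lt_or_ge v a with h3 | h3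
    · exact key v h1 h3
    · rw [hpq v (hp.trans_le h3) (h2.trans_lt hw2)]; exact key2
  rcases ha with ha | ha
  · exact lt_asymm ((ha w).1 hw) hw1
  · exact absurd ((ha w).1 hw) (not_le.2 hw1)

/-- the least element -/
theorem exists_least_of {C : Set M} [DSet C] (hne : C.Nonempty) (hb : ∃ z, ∀ c ∈ C, z < c)
    (hcl : ∀ a, (∀ c ∈ C, a ≤ c) → (∀ e, a < e → ∃ c ∈ C, c < e) → a ∈ C) :
    ∃ a ∈ C, ∀ c ∈ C, a ≤ c := by
  let H : Set M := {w | ∀ c ∈ C, w < c}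
  have : DSet H := by
    have : DSet {w : M | ∀ c, c ∈ C → w < c} := inferInstance
    exact this
  obtain ⟨c, hc⟩ := hne
  obtain ⟨a, ha⟩ := cut (H := H) (fun x y hy h c hc => h.trans (hy c hc)) hb ⟨c, fun h => lt_irrefl _ (h c hc)⟩
  have h1 : ∀ c ∈ C, a ≤ c := by
    intro c hc
    rcases ha with ha | ha
    · by_contra h
      exact lt_irrefl _ ((ha c).2 (not_le.1 h) c hc)
    · exact ((ha a).2 le_rfl c hc).le
  refine ⟨a, hcl a h1 fun e he => ?_, h1⟩
  by_contra hh
  push Not at hh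
  obtain ⟨w, hw, hw'⟩ := exists_between he
  have hwH : w ∈ H := fun c hc => hw'.trans_le (hh c hc)
  rcases ha with ha | ha
  · exact lt_asymm hw ((ha w).1 hwH)
  · exact absurd ((ha w).1 hwH) (not_le.2 hw)

end basics
end OM

namespace OM
universe u
set_option synthInstance.maxSize 5000
set_option synthInstance.maxHeartbeats 400000
set_option maxHeartbeats 1000000
set_option linter.unusedSectionVars false

/-- the filter of end segments of a lower set -/
def tailF {M : Type u} [LinearOrder M] (H : Set M) : Filter M where
  sets := {A | H.Nonempty → ∃ c ∈ H, ∀ y ∈ H, c < y → y ∈ A}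
  univ_sets := fun ⟨c, hc⟩ => ⟨c, hc, fun _ _ _ => trivial⟩
  sets_of_superset := fun {A B} hA hAB hne => by
    obtain ⟨c, hc, h⟩ := hA hne
    exact ⟨c, hc, fun y hy hcy => hAB (h y hy hcy)⟩
  inter_sets := fun {A B} hA hB hne => by
    obtain ⟨c, hc, h⟩ := hA hne
    obtain ⟨d, hd, h'⟩ := hB hne
    refine ⟨max c d, ?_, fun y hy hcy => ?_⟩
    · rcases max_choice c d with e | e <;> rw [e] <;> assumption
    · have := max_lt_iff.1 hcy
      exact ⟨h y hy this.1, h' y hy this.2⟩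

theorem mem_tailF {M : Type u} [LinearOrder M] {H : Set M} (hne : H.Nonempty) {A : Set M} :
    A ∈ tailF H ↔ ∃ c ∈ H, ∀ y ∈ H, c < y → y ∈ A :=
  ⟨fun h => h hne, fun h _ => h⟩

/-- left-type filters -/
def IsL {M : Type u} [DS M] [LinearOrder M] (F : Filter M) : Prop :=
  ∃ H : Set M, DSet H ∧ Hend H ∧ F = tailF H

/-- filters of definable one-types -/
def IsOT {M : Type u} [DS M] [LinearOrder M] (F : Filter M) : Prop :=
  (∃ a, F = pure a) ∨ IsL F ∨ @IsL M _ (swapLO M) F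

section
variable {M : Type u} [DS M] [LinearOrder M] [OMin M]

theorem IsL.neBot {F : Filter M} (h : IsL F) : F.NeBot := by
  obtain ⟨H, hH, hH', rfl⟩ := h
  constructor
  intro h
  have : ∅ ∈ tailF H := by rw [h]; trivial
  obtain ⟨c, hc, h⟩ := (mem_tailF hH'.ne).1 this
  obtain ⟨y, hy, hcy⟩ := hH'.nomax c hc
  exact h y hy hcy

theorem IsOT.neBot {F : Filter M} (h : IsOT F) : F.NeBot := by
  rcases h with ⟨a, rfl⟩ | h | h
  · infer_instance
  · exact h.neBot
  · exact @IsL.neBot M _ (swapLO M) (swapOMin M) F h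

theorem IsL.dec {F : Filter M} (h : IsL F) (A : Set M) [DSet A] : A ∈ F ∨ Aᶜ ∈ F := by
  obtain ⟨H, hH, hH', rfl⟩ := h
  obtain ⟨B, hB⟩ := OMin.bd A ‹_›
  obtain ⟨c, hc, hcB⟩ := hH'.fin B
  have key : ∀ y ∈ H, c < y → (y ∈ A ↔ c ∈ A) := by
    intro y hy hcy
    refine hB _ _ fun b hb => ?_
    by_cases hbH : b ∈ H
    · have := hcB b hb hbH
      simp [this, this.trans hcy, this.le, (this.trans hcy).le]
    · have h1 : y < b := by
        rcases lt_trichotomy y b with h | rfl | h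
        · exact h
        · exact absurd hy hbH
        · exact absurd (hH'.low _ _ hy h) hbH
      simp [not_lt.2 h1.le, not_lt.2 (hcy.trans h1).le, not_le.2 h1, not_le.2 (hcy.trans h1)]
  by_cases hcA : c ∈ A
  · exact Or.inl ((mem_tailF hH'.ne).2 ⟨c, hc, fun y hy h => (key y hy h).2 hcA⟩)
  · exact Or.inr ((mem_tailF hH'.ne).2 ⟨c, hc, fun y hy h => fun h' => hcA ((key y hy h).1 h')⟩)

theorem IsOT.dec {F : Filter M} (h : IsOT F) (A : Set M) [DSet A] : A ∈ F ∨ Aᶜ ∈ F := by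
  rcases h with ⟨a, rfl⟩ | h | h
  · simp only [Filter.mem_pure]; exact em _
  · exact h.dec A
  · exact @IsL.dec M _ (swapLO M) (swapOMin M) F h A _

theorem IsL.dk {F : Filter M} (h : IsL F) {S : Type u} [DTy S M] (W : Set (S × M)) [DSet W] :
    DSet {s | {y | (s, y) ∈ W} ∈ F} := by
  obtain ⟨H, hH, hH', rfl⟩ := h
  have : DSet {s : S | ∃ c, c ∈ H ∧ ∀ y, y ∈ H → c < y → (s, y) ∈ W} := inferInstance
  convert this using 1
  ext s
  exact mem_tailF hH'.ne

theorem IsOT.dk {F : Filter M} (h : IsOT F) {S : Type u} [DTy S M] (W : Set (S × M)) [DSet W] :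
    DSet {s | {y | (s, y) ∈ W} ∈ F} := by
  rcases h with ⟨a, rfl⟩ | h | h
  · have : DSet {s : S | (s, a) ∈ W} := inferInstance
    exact this
  · exact h.dk W
  · exact @IsL.dk M _ (swapLO M) (swapOMin M) F h S _ W _

theorem IsL.unif {F : Filter M} (h : IsL F) (J : Set M) [DSet J] (hJ : J.Infinite)
    (W : Set (M × M)) [DSet W] (hW : ∀ s ∈ J, {y | (s, y) ∈ W} ∈ F) :
    ∃ V ∈ F, DSet V ∧ {s | s ∈ J ∧ ∀ y ∈ V, (s, y) ∈ W}.Infinite := by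
  obtain ⟨H, hH, hH', rfl⟩ := h
  obtain ⟨c0, hc0⟩ := hH'.ne
  by_contra hcon
  push Not at hcon
  have fin : ∀ c ∈ H, {s | s ∈ J ∧ ∀ y ∈ {y | y ∈ H ∧ c < y}, (s, y) ∈ W}.Finite := by
    intro c hc
    by_contra hinf
    exact hinf (hcon {y | y ∈ H ∧ c < y} ((mem_tailF hH'.ne).2 ⟨c, hc, fun y hy h => ⟨hy, h⟩⟩)
      inferInstance)
  let C : M → Set M := fun s => {c | c ∈ H ∧ c0 ≤ c ∧ ∀ y, y ∈ H → c < y → (s, y) ∈ W}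
  let Θ : Set M := {c | ∃ s, s ∈ J ∧ c ∈ C s ∧ ∀ c' ∈ C s, c ≤ c'}
  have dΘ : DSet Θ := by
    have : DSet {c : M | ∃ s : M, s ∈ J ∧ (c ∈ H ∧ c0 ≤ c ∧ ∀ y, y ∈ H → c < y → (s, y) ∈ W) ∧
      ∀ c' : M, (c' ∈ H ∧ c0 ≤ c' ∧ ∀ y, y ∈ H → c' < y → (s, y) ∈ W) → c ≤ c'} := inferInstance
    exact this
  have ex : ∀ s ∈ J, ∃ c ∈ Θ, c ∈ C s ∧ ∀ c' ∈ C s, c ≤ c' := by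
    intro s hs
    have dC : DSet (C s) := by
      have : DSet {c : M | c ∈ H ∧ c0 ≤ c ∧ ∀ y, y ∈ H → c < y → (s, y) ∈ W} := inferInstance
      exact this
    have := exists_least_of (C := C s) ?_ ?_ ?_
    · obtain ⟨a, ha, ha'⟩ := this
      exact ⟨a, ⟨s, hs, ha, ha'⟩, ha, ha'⟩
    · obtain ⟨c, hc, h⟩ := (mem_tailF hH'.ne).1 (hW s hs)
      refine ⟨max c0 c, ?_, le_max_left _ _, fun y hy h' => h y hy ((le_max_right _ _).trans_lt h')⟩
      rcases max_choice c0 c with e | e <;> rw [e] <;> assumption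
    · obtain ⟨z, hz⟩ := exists_lt c0
      exact ⟨z, fun c hc => hz.trans_le hc.2.1⟩
    · intro a ha ha'
      refine ⟨?_, ?_, fun y hy hay => ?_⟩
      · obtain ⟨e, he⟩ := exists_gt a
        obtain ⟨c, hc, -⟩ := ha' e he
        rcases (ha c hc).eq_or_lt with rfl | h
        · exact hc.1
        · exact hH'.low _ _ hc.1 h
      · by_contra h
        obtain ⟨c, hc, h'⟩ := ha' c0 (not_le.1 h)
        exact absurd hc.2.1 (not_le.2 h')
      · obtain ⟨c, hc, h'⟩ := ha' y hay
        exact hc.2.2 y hy h'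
  have hΘ : Θ.Infinite := by
    intro hf
    refine hJ ((hf.biUnion (t := fun c => {s | s ∈ J ∧ ∀ y ∈ {y | y ∈ H ∧ c < y}, (s, y) ∈ W}) ?_).subset ?_)
    · rintro c ⟨s, hs, hc, -⟩
      exact fin c hc.1
    · intro s hs
      obtain ⟨c, hc, hc', -⟩ := ex s hs
      exact mem_biUnion hc ⟨hs, fun y hy => hc'.2.2 y hy.1 hy.2⟩
  obtain ⟨c1, c2, h12, hsub⟩ := inf_interval hΘ
  obtain ⟨d, hd1, hd2⟩ := exists_between h12
  have hdH : d ∈ H := by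
    obtain ⟨s, -, h, -⟩ := hsub ⟨hd1, hd2⟩
    exact h.1
  have hsub' : ∀ c ∈ Ioo c1 d, c ∈ Θ := fun c hc => hsub ⟨hc.1, hc.2.trans hd2⟩
  choose! g hg using hsub'
  refine Set.Ioo_infinite hd1 (Set.Finite.of_finite_image ((fin d hdH).subset ?_) (f := g) ?_)
  · rintro _ ⟨c, hc, rfl⟩
    have := hg c hc
    exact ⟨this.1, fun y hy => this.2.1.2.2 y hy.1 (hc.2.trans hy.2)⟩
  · intro c hc c' hc' e
    have h1 := hg c hc
    have h2 := hg c' hc'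
    have e : g c = g c' := e
    rw [← e] at h2
    exact le_antisymm (h1.2.2 _ h2.2.1) (h2.2.2 _ h1.2.1)

theorem IsOT.unif {F : Filter M} (h : IsOT F) (J : Set M) [DSet J] (hJ : J.Infinite)
    (W : Set (M × M)) [DSet W] (hW : ∀ s ∈ J, {y | (s, y) ∈ W} ∈ F) :
    ∃ V ∈ F, DSet V ∧ {s | s ∈ J ∧ ∀ y ∈ V, (s, y) ∈ W}.Infinite := by
  rcases h with ⟨a, rfl⟩ | h | h
  · refine ⟨{a}, by simp, inferInstance, ?_⟩
    convert hJ using 1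
    ext s
    constructor
    · exact fun h => h.1
    · intro h
      refine ⟨h, ?_⟩
      rintro y rfl
      exact hW s h
  · exact h.unif J hJ W hW
  · exact @IsL.unif M _ (swapLO M) (swapOMin M) F h J _ hJ W _ hW

theorem IsOT.avoid {F : Filter M} (h : IsOT F) (P : Set (M × M)) [DSet P]
    (hP : ∀ y, {s | (y, s) ∈ P}.Finite) {a b : M} (hab : a < b) :
    ∃ c d, c < d ∧ Ioo c d ⊆ Ioo a b ∧ ∀ᶠ y in F, ∀ s ∈ Ioo c d, (y, s) ∉ P := by
  have := h.neBot
  let W : Set (M × M) := {p | (p.2, p.1) ∈ P}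
  have dW : DSet W := by
    have : DSet {p : M × M | (p.2, p.1) ∈ P} := inferInstance
    exact this
  have dQ := h.dk W
  have hfin : (Ioo a b ∩ {s | {y | (s, y) ∈ W} ∈ F}).Finite := by
    by_contra hinf
    obtain ⟨V, hV, dV, h2⟩ := h.unif _ hinf W fun s hs => hs.2
    obtain ⟨y, hy⟩ := Filter.nonempty_of_mem hV
    exact h2 ((hP y).subset fun s hs => hs.2 y hy)
  obtain ⟨c, d, hcd, hsub⟩ := sub_of_fin hab hfin
  have dW' : DSet (Wᶜ) := inferInstance
  obtain ⟨V, hV, dV, h2⟩ := h.unif (Ioo c d) (Set.Ioo_infinite hcd) (Wᶜ) fun s hs => by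
    have hs' := hsub hs
    rcases h.dec {y | (s, y) ∈ W} with h1 | h1
    · exact absurd ⟨hs'.1, h1⟩ hs'.2
    · exact h1
  have : DSet {s | s ∈ Ioo c d ∧ ∀ y, y ∈ V → (s, y) ∈ Wᶜ} := inferInstance
  obtain ⟨c', d', hcd', hsub'⟩ := inf_interval h2
  refine ⟨c', d', hcd', fun s hs => (hsub (hsub' hs).1).1, ?_⟩
  exact Filter.mem_of_superset hV fun y hy s hs => (hsub' hs).2 y hy

/-- definability of a kernel -/
def DK {T S : Type u} [DTy T M] [DTy S M] (K : T → Filter S) : Prop :=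
  ∀ {U : Type u} [DTy U M] (R : Set ((U × T) × S)), DSet R →
    DSet {p : U × T | ∀ᶠ y in K p.2, (p, y) ∈ R}

theorem select {T U : Type u} [DTy T M] [DTy U M] (E : Set ((T × U) × M)) [DSet E]
    (hne : ∀ x u, ∃ y, ((x, u), y) ∈ E)
    (hdir : ∀ x u v, ∃ w, ∀ y, ((x, w), y) ∈ E → ((x, u), y) ∈ E ∧ ((x, v), y) ∈ E) :
    ∃ K : T → Filter M, (∀ x, IsOT (K x)) ∧ DK K ∧ ∀ x u, {y | ((x, u), y) ∈ E} ∈ K x := by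
  classical
  let Lw : T → Set M := fun x => {y | ∃ u, ∀ e, ((x, u), e) ∈ E → y < e}
  let C1 : T → M → Prop := fun x a => (∀ y, y ∈ Lw x ↔ y < a) ∧ ∀ u, ((x, u), a) ∈ E
  let C2 : T → Prop := fun x => (∀ y, y ∉ Lw x) ∨ (∃ a, a ∈ Lw x ∧ ∀ y ∈ Lw x, y ≤ a)
  let K : T → Filter M := fun x => if h : ∃ a, C1 x a then pure h.choose else
    if C2 x then @tailF M (swapLO M) (Lw x)ᶜ else tailF (Lw x)
  have low : ∀ x p q, q ∈ Lw x → p < q → p ∈ Lw x := by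
    rintro x p q ⟨u, h⟩ hpq
    exact ⟨u, fun e he => hpq.trans (h e he)⟩
  have dL : DSet {p : T × M | p.2 ∈ Lw p.1} := by
    have : DSet {p : T × M | ∃ u : U, ∀ e, ((p.1, u), e) ∈ E → p.2 < e} := inferInstance
    exact this
  have dLx : ∀ x, DSet (Lw x) := by
    intro x
    have : DSet {y : M | (x, y) ∈ {p : T × M | p.2 ∈ Lw p.1}} := inferInstance
    exact this
  have h2ne : ∀ x, C2 x → @Hend M (swapLO M) (Lw x)ᶜ := by
    intro x hx
    refine @Hend.mk M (swapLO M) _ ?_ ?_ ?_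
    · intro p q hq hpq hp
      exact hq (low x q p hp hpq)
    · rcases hx with hx | ⟨a, ha, hx⟩
      · exact ⟨(OMin.ne (M := M)).some, hx _⟩
      · obtain ⟨c, hc⟩ := exists_gt a
        exact ⟨c, fun h => absurd (hx c h) (not_le.2 hc)⟩
    · intro p hp
      rcases hx with hx | ⟨a, ha, hx⟩
      · obtain ⟨q, hq⟩ := exists_lt p
        exact ⟨q, hx q, hq⟩
      · have : a < p := by
          by_contra h
          rcases (not_lt.1 h).eq_or_lt with rfl | h
          · exact hp ha
          · exact hp (low x _ _ ha h)
        obtain ⟨q, h1, h2⟩ := exists_between this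
        exact ⟨q, fun h => absurd (hx q h) (not_le.2 h1), h2⟩
  have h3ne : ∀ x, ¬ C2 x → Hend (Lw x) := by
    intro x hx
    simp only [C2] at hx
    push Not at hx
    exact ⟨low x, hx.1, fun a ha => hx.2 a ha⟩
  have hOT : ∀ x, IsOT (K x) := by
    intro x
    by_cases h1 : ∃ a, C1 x a
    · exact Or.inl ⟨h1.choose, by simp only [K, h1, dif_pos]⟩
    by_cases h2 : C2 x
    · refine Or.inr (Or.inr ⟨(Lw x)ᶜ, inferInstance, h2ne x h2, ?_⟩)
      simp only [K, dif_neg h1, if_pos h2]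
    · refine Or.inr (Or.inl ⟨Lw x, inferInstance, h3ne x h2, ?_⟩)
      simp only [K, dif_neg h1, if_neg h2]
  refine ⟨K, hOT, ?_, ?_⟩
  · intro V _ R hR
    have d1 : DSet {p : T × M | C1 p.1 p.2} := by
      have : DSet {p : T × M | (∀ y, (p.1, y) ∈ {p : T × M | p.2 ∈ Lw p.1} ↔ y < p.2) ∧
        ∀ u, ((p.1, u), p.2) ∈ E} := inferInstance
      exact this
    have d2 : DSet {x : T | C2 x} := by
      have : DSet {x : T | (∀ y, (x, y) ∉ {p : T × M | p.2 ∈ Lw p.1}) ∨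
        (∃ a, (x, a) ∈ {p : T × M | p.2 ∈ Lw p.1} ∧
          ∀ y, (x, y) ∈ {p : T × M | p.2 ∈ Lw p.1} → y ≤ a)} := inferInstance
      exact this
    have : DSet {p : V × T | (∃ a, (p.2, a) ∈ {p : T × M | C1 p.1 p.2} ∧ (p, a) ∈ R) ∨
      ((¬ ∃ a, (p.2, a) ∈ {p : T × M | C1 p.1 p.2}) ∧
        ((p.2 ∈ {x : T | C2 x} ∧ ∃ c, (p.2, c) ∉ {p : T × M | p.2 ∈ Lw p.1} ∧
          ∀ y, (p.2, y) ∉ {p : T × M | p.2 ∈ Lw p.1} → y < c → (p, y) ∈ R) ∨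
         (p.2 ∉ {x : T | C2 x} ∧ ∃ c, (p.2, c) ∈ {p : T × M | p.2 ∈ Lw p.1} ∧
          ∀ y, (p.2, y) ∈ {p : T × M | p.2 ∈ Lw p.1} → c < y → (p, y) ∈ R)))} := inferInstance
    convert this using 1
    ext ⟨v, x⟩
    change {y | ((v, x), y) ∈ R} ∈ K x ↔ (∃ a, C1 x a ∧ ((v, x), a) ∈ R) ∨ ((¬ ∃ a, C1 x a) ∧
      ((C2 x ∧ ∃ c, c ∉ Lw x ∧ ∀ y, y ∉ Lw x → y < c → ((v, x), y) ∈ R) ∨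
      (¬ C2 x ∧ ∃ c, c ∈ Lw x ∧ ∀ y, y ∈ Lw x → c < y → ((v, x), y) ∈ R)))
    by_cases h1 : ∃ a, C1 x a
    · have hK : K x = pure h1.choose := by simp only [K, h1, dif_pos]
      rw [hK]
      have huniq : ∀ a, C1 x a → a = h1.choose := by
        intro a ha
        have hb := h1.choose_spec
        refine eq_of_forall_lt_iff fun c => ?_
        rw [← ha.1 c, ← hb.1 c]
      simp only [h1, not_true_eq_false, false_and, or_false, Filter.mem_pure]
      constructor
      · intro h; exact ⟨_, h1.choose_spec, h⟩
      · rintro ⟨a, ha, h⟩; rw [huniq a ha] at h; exact h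
    · have h1' : ¬ ∃ a, C1 x a ∧ ((v, x), a) ∈ R := fun ⟨a, h, _⟩ => h1 ⟨a, h⟩
      by_cases h2 : C2 x
      · have hK : K x = @tailF M (swapLO M) (Lw x)ᶜ := by simp only [K, dif_neg h1, if_pos h2]
        rw [hK]
        simp only [h1, h1', h2, not_true_eq_false, false_and, or_false, false_or, not_false_eq_true, true_and]
        exact @mem_tailF M (swapLO M) _ (@Hend.ne M (swapLO M) _ (h2ne x h2)) _
      · have hK : K x = tailF (Lw x) := by simp only [K, dif_neg h1, if_neg h2]
        rw [hK]
        simp only [h1, h1', h2, false_and, false_or, not_false_eq_true, true_and]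
        exact mem_tailF (h3ne x h2).ne
  · intro x u
    by_cases h1 : ∃ a, C1 x a
    · have hK : K x = pure h1.choose := by simp only [K, h1, dif_pos]
      rw [hK]
      exact h1.choose_spec.2 u
    have dE : DSet {y | ((x, u), y) ∈ E} := by
      have : DSet {y : M | ((x, u), y) ∈ E} := inferInstance
      exact this
    by_cases h2 : C2 x
    · rcases (hOT x).dec {y | ((x, u), y) ∈ E} with h | h
      · exact h
      exfalso
      have hK : K x = @tailF M (swapLO M) (Lw x)ᶜ := by simp only [K, dif_neg h1, if_pos h2]
      rw [hK] at h
      obtain ⟨c, hc, h⟩ := (@mem_tailF M (swapLO M) _ (@Hend.ne M (swapLO M) _ (h2ne x h2)) _).1 h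
      have h : ∀ y, y ∉ Lw x → y < c → ((x, u), y) ∉ E := h
      obtain ⟨c', hc', hlt⟩ := @Hend.nomax M (swapLO M) _ (h2ne x h2) c hc
      have hlt : c' < c := hlt
      have hv : ∃ v, ∀ y, ((x, v), y) ∈ E → y ∉ Lw x := by
        rcases h2 with h2 | ⟨a, ha, h2⟩
        · exact ⟨u, fun y _ => h2 y⟩
        · obtain ⟨v, hv⟩ := ha
          exact ⟨v, fun y hy hy' => absurd (hv y hy) (not_lt.2 (h2 y hy'))⟩
      obtain ⟨v, hv⟩ := hv
      obtain ⟨w, hw⟩ := hdir x u v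
      have : ∃ e, ((x, w), e) ∈ E ∧ e ≤ c' := by
        by_contra hh
        push Not at hh
        exact hc' ⟨w, hh⟩
      obtain ⟨e, he, hec⟩ := this
      exact h e (hv e (hw e he).2) (hec.trans_lt hlt) (hw e he).1
    · rcases (hOT x).dec {y | ((x, u), y) ∈ E} with h | h
      · exact h
      exfalso
      have hK : K x = tailF (Lw x) := by simp only [K, dif_neg h1, if_neg h2]
      rw [hK] at h
      obtain ⟨c, ⟨v, hv⟩, h⟩ := (mem_tailF (h3ne x h2).ne).1 h
      have h : ∀ y, y ∈ Lw x → c < y → ((x, u), y) ∉ E := h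
      obtain ⟨w, hw⟩ := hdir x u v
      have hw' : ∀ y, ((x, w), y) ∈ E → y ∉ Lw x := fun y hy hy' =>
        h y hy' (hv y (hw y hy).2) (hw y hy).1
      obtain ⟨e, he⟩ := hne x w
      obtain ⟨a, ha⟩ := cut (low x) (h3ne x h2).ne ⟨e, hw' e he⟩
      rcases ha with ha | ha
      · apply h1
        refine ⟨a, ha, fun u' => ?_⟩
        by_contra hu'
        obtain ⟨w', hw''⟩ := hdir x w u'
        have : a ∈ Lw x := by
          refine ⟨w', fun y hy => ?_⟩
          have h3 := hw' y (hw'' y hy).1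
          rw [ha, not_lt] at h3
          refine h3.lt_of_ne ?_
          rintro rfl
          exact hu' (hw'' _ hy).2
        exact lt_irrefl _ ((ha a).1 this)
      · exact h2 (Or.inr ⟨a, (ha a).2 le_rfl, fun y hy => (ha y).1 hy⟩)

end
end OM

namespace OM
universe u
set_option synthInstance.maxSize 5000
set_option synthInstance.maxHeartbeats 400000
set_option maxHeartbeats 1000000
set_option linter.unusedSectionVars false

section
variable {M : Type u} [DS M] [LinearOrder M] [OMin M]

theorem hendIio {M : Type u} [LinearOrder M] [NoMinOrder M] [DenselyOrdered M] (d : M) :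
    Hend {x | x < d} := ⟨fun x y hy h => h.trans hy, exists_lt d, fun x hx => by
    obtain ⟨y, h⟩ := exists_between (show x < d from hx); exact ⟨y, h.2, h.1⟩⟩

theorem near_left (A : Set M) [DSet A] (d : M) :
    ∃ p, p < d ∧ ((∀ y, p < y → y < d → y ∈ A) ∨ (∀ y, p < y → y < d → y ∉ A)) := by
  have h : IsL (tailF {x | x < d}) := ⟨_, inferInstance, hendIio d, rfl⟩
  rcases h.dec A with h | h
  · obtain ⟨p, hp, h⟩ := (mem_tailF (hendIio d).ne).1 h
    exact ⟨p, hp, Or.inl fun y h1 h2 => h y h2 h1⟩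
  · obtain ⟨p, hp, h⟩ := (mem_tailF (hendIio d).ne).1 h
    exact ⟨p, hp, Or.inr fun y h1 h2 => h y h2 h1⟩

theorem near_right (A : Set M) [DSet A] (d : M) :
    ∃ p, d < p ∧ ((∀ y, d < y → y < p → y ∈ A) ∨ (∀ y, d < y → y < p → y ∉ A)) := by
  obtain ⟨p, hp, h⟩ := @near_left M _ (swapLO M) (swapOMin M) A _ d
  exact ⟨p, hp, h.imp (fun h y h1 h2 => h y h2 h1) (fun h y h1 h2 => h y h2 h1)⟩

theorem exists_greatest_of {C : Set M} [DSet C] (hne : C.Nonempty) (hb : ∃ z, ∀ c ∈ C, c < z)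
    (hcl : ∀ a, (∀ c ∈ C, c ≤ a) → (∀ e, e < a → ∃ c ∈ C, e < c) → a ∈ C) :
    ∃ a ∈ C, ∀ c ∈ C, c ≤ a :=
  @exists_least_of M _ (swapLO M) (swapOMin M) C _ hne hb hcl

/-- strict linear order on an interval -/
structure SLO {M : Type u} [LinearOrder M] (R : Set (M × M)) (a b : M) : Prop where
  asymm : ∀ x y, a < x → x < b → a < y → y < b → (x, y) ∈ R → (y, x) ∉ R
  trans : ∀ x y z, a < x → x < b → a < y → y < b → a < z → z < b →
    (x, y) ∈ R → (y, z) ∈ R → (x, z) ∈ R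
  total : ∀ x y, a < x → x < b → a < y → y < b → x ≠ y → (x, y) ∈ R ∨ (y, x) ∈ R

/-- minimum from the left -/
def LMin {M : Type u} [LinearOrder M] (R : Set (M × M)) (s : M) : Prop :=
  ∃ p, p < s ∧ ∀ y, p < y → y < s → (s, y) ∈ R
/-- minimum from the right -/
def RMin {M : Type u} [LinearOrder M] (R : Set (M × M)) (s : M) : Prop :=
  ∃ q, s < q ∧ ∀ y, s < y → y < q → (s, y) ∈ R

theorem SLO.inc {R : Set (M × M)} [DSet R] {a b : M} (h : SLO R a b)
    (h1 : ∀ s, a < s → s < b → LMin {p | (p.2, p.1) ∈ R} s)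
    (h2 : ∀ s, a < s → s < b → RMin R s) :
    ∀ s z, a < s → s < z → z < b → (s, z) ∈ R := by
  intro s z has hsz hzb
  by_contra hcon
  let H : Set M := {w | w ≤ s ∨ ∀ v, s < v → v ≤ w → (s, v) ∈ R}
  have dH : DSet H := by
    have : DSet {w : M | w ≤ s ∨ ∀ v, s < v → v ≤ w → (s, v) ∈ R} := inferInstance
    exact this
  have hsH : s ∈ H := Or.inl le_rfl
  have hzH : z ∉ H := by
    rintro (h | h)
    · exact absurd h (not_le.2 hsz)
    · exact hcon (h z hsz le_rfl)
  have low : ∀ x y, y ∈ H → x < y → x ∈ H := by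
    rintro x y (h | h) hxy
    · exact Or.inl (hxy.le.trans h)
    · exact Or.inr fun v h3 h4 => h v h3 (h4.trans hxy.le)
  obtain ⟨c, hc⟩ := cut low ⟨s, hsH⟩ ⟨z, hzH⟩
  rcases hc with hc | hc
  · have hsc : s < c := (hc s).1 hsH
    have hcz : c ≤ z := not_lt.1 fun h => hzH ((hc z).2 h)
    have hac := has.trans hsc
    have hcb := hcz.trans_lt hzb
    obtain ⟨p, hp, hp'⟩ := h1 c hac hcb
    obtain ⟨v, hv1, hv2⟩ := exists_between (max_lt hp hsc)
    have hv := max_lt_iff.1 hv1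
    have hvc : (v, c) ∈ R := hp' v hv.1 hv2
    have key : ∀ v, s < v → v < c → (s, v) ∈ R := by
      intro v h3 h4
      rcases (hc v).2 h4 with h5 | h5
      · exact absurd h5 (not_le.2 h3)
      · exact h5 v h3 le_rfl
    have : c ∈ H := by
      refine Or.inr fun w h3 h4 => ?_
      rcases h4.eq_or_lt with rfl | h4
      · exact h.trans s v w has (hsc.trans hcb) (has.trans hv.2) (hv2.trans hcb) hac hcb (key v hv.2 hv2) hvc
      · exact key w h3 h4
    exact lt_irrefl _ ((hc c).1 this)
  · have hsc : s ≤ c := (hc s).1 hsH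
    have hcz : c < z := not_le.1 fun h => hzH ((hc z).2 h)
    have hac := has.trans_le hsc
    have hcb := hcz.trans hzb
    obtain ⟨q, hq, hq'⟩ := h2 c hac hcb
    obtain ⟨v, hv1, hv2⟩ := exists_between (lt_min hq hcz)
    have hv := lt_min_iff.1 hv2
    have key : ∀ v, s < v → v ≤ c → (s, v) ∈ R := by
      intro v h3 h4
      rcases (hc v).2 h4 with h5 | h5
      · exact absurd h5 (not_le.2 h3)
      · exact h5 v h3 le_rfl
    have : v ∈ H := by
      refine Or.inr fun w h3 h4 => ?_
      rcases le_or_gt w c with h5 | h5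
      · exact key w h3 h5
      · have hcw := hq' w h5 (h4.trans_lt hv.1)
        rcases hsc.eq_or_lt with rfl | hsc
        · exact hcw
        · exact h.trans s c w has (hsc.trans hcb) hac hcb (hac.trans h5) (h4.trans_lt (hv.2.trans hzb)) (key c hsc le_rfl) hcw
    exact absurd ((hc v).1 this) (not_le.2 hv1)

theorem phi_exists {R : Set (M × M)} [DSet R] {a b : M} (hab : a < b) (h : SLO R a b)
    (h1 : ∀ s, a < s → s < b → LMin R s)
    (h2 : ∀ s, a < s → s < b → RMin R s) :
    ∃ z, a < z ∧ z < b ∧ ∃ x, a < x ∧ x < b ∧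
      (∃ p, p < z ∧ ∀ y, p < y → y < z → (y, x) ∉ R) ∧
      (∃ q, z < q ∧ ∀ y, z < y → y < q → (y, x) ∈ R) := by
  let B : Set M := {x | (a < x ∧ x < b) ∧ ∀ y, x < y → y < b → (x, y) ∈ R}
  have dB : DSet B := by
    have : DSet {x : M | (a < x ∧ x < b) ∧ ∀ y, x < y → y < b → (x, y) ∈ R} := inferInstance
    exact this
  have hB : B.Finite := by
    by_contra hinf
    obtain ⟨c, d, hcd, hsub⟩ := inf_interval hinf
    obtain ⟨y, hy1, hy2⟩ := exists_between hcd
    have hyB := hsub ⟨hy1, hy2⟩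
    obtain ⟨p, hp, hp'⟩ := h1 y hyB.1.1 hyB.1.2
    obtain ⟨x, hx1, hx2⟩ := exists_between (max_lt hp hy1)
    have hx := max_lt_iff.1 hx1
    have hxB := hsub ⟨hx.2, hx2.trans hy2⟩
    exact h.asymm x y hxB.1.1 hxB.1.2 hyB.1.1 hyB.1.2 (hxB.2 y hx2 hyB.1.2) (hp' x hx.1 hx2)
  obtain ⟨a0, ha0, ha0'⟩ := (hendIio b).fin hB.toFinset
  have ha0 : a0 < b := ha0
  have hnB : ∀ x, max a a0 < x → x < b → ∃ y, x < y ∧ y < b ∧ (y, x) ∈ R := by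
    intro x hx hxb
    have hx' := max_lt_iff.1 hx
    by_contra hh
    push Not at hh
    have : x ∈ B := by
      refine ⟨⟨hx'.1, hxb⟩, fun y h3 h4 => ?_⟩
      rcases h.total x y hx'.1 hxb (hx'.1.trans h3) h4 h3.ne with h5 | h5
      · exact h5
      · exact absurd h5 (hh y h3 h4)
    exact lt_asymm hx'.2 (ha0' x (by simpa using this) hxb)
  obtain ⟨x, hx, hxb⟩ := exists_between (max_lt hab ha0)
  have hax : a < x := (le_max_left _ _).trans_lt hx
  -- eventually below x near b
  have hend : ∃ z, x ≤ z ∧ z < b ∧ ∀ y, z < y → y < b → (y, x) ∈ R := by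
    obtain ⟨p, hp, hp'⟩ := near_left {y : M | (y, x) ∈ R} b
    rcases hp' with hp' | hp'
    · exact ⟨max p x, le_max_right _ _, max_lt hp hxb, fun y h3 h4 => hp' y ((le_max_left _ _).trans_lt h3) h4⟩
    exfalso
    let C : Set M := {y | x < y ∧ y < b ∧ (y, x) ∈ R}
    have dC : DSet C := by
      have : DSet {y : M | x < y ∧ y < b ∧ (y, x) ∈ R} := inferInstance
      exact this
    have hne : C.Nonempty := hnB x hx hxb
    have hCp : ∀ c ∈ C, c ≤ p := fun c hc => not_lt.1 fun h => hp' c h hc.2.1 hc.2.2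
    obtain ⟨m, hm, hm'⟩ := exists_greatest_of (C := C) hne ⟨b, fun c hc => hc.2.1⟩ (by
      intro m hm hm'
      have hxm : x < m := by obtain ⟨y, hy⟩ := hne; exact hy.1.trans_le (hm y hy)
      have hmb : m < b := by
        refine lt_of_le_of_lt ?_ hp
        by_contra hpm
        obtain ⟨c, hc, hpc⟩ := hm' p (not_le.1 hpm)
        exact absurd (hCp c hc) (not_le.2 hpc)
      refine ⟨hxm, hmb, ?_⟩
      by_contra hmx
      obtain ⟨l, hl, hl'⟩ := h1 m (hax.trans hxm) hmb
      obtain ⟨c, hc, hlc⟩ := hm' l hl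
      rcases (hm c hc).eq_or_lt with rfl | hcm
      · exact hmx hc.2.2
      · exact hmx (h.trans m c x (hax.trans hxm) hmb (hax.trans hc.1) hc.2.1 hax hxb (hl' c hlc hcm) hc.2.2))
    obtain ⟨y, hy1, hy2, hy3⟩ := hnB m (hx.trans hm.1) hm.2.1
    have := hm' y ⟨hm.1.trans hy1, hy2, h.trans y m x (hax.trans (hm.1.trans hy1)) hy2 (hax.trans hm.1) hm.2.1 hax hxb hy3 hm.2.2⟩
    exact absurd this (not_le.2 hy1)
  let C : Set M := {z | x ≤ z ∧ z < b ∧ ∀ y, z < y → y < b → (y, x) ∈ R}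
  have dC : DSet C := by
    have : DSet {z : M | x ≤ z ∧ z < b ∧ ∀ y, z < y → y < b → (y, x) ∈ R} := inferInstance
    exact this
  obtain ⟨z, hz, hz'⟩ := exists_least_of (C := C) hend ⟨a, fun c hc => hax.trans_le hc.1⟩ (by
    intro m hm hm'
    have hxm : x ≤ m := by
      by_contra hh
      obtain ⟨c, hc, hc'⟩ := hm' x (not_le.1 hh)
      exact absurd hc.1 (not_le.2 hc')
    have hmb : m < b := by
      obtain ⟨y, hy⟩ := hend
      exact (hm y hy).trans_lt hy.2.1
    refine ⟨hxm, hmb, fun y h3 h4 => ?_⟩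
    obtain ⟨c, hc, hcy⟩ := hm' y h3
    exact hc.2.2 y hcy h4)
  have hxz : x < z := by
    refine hz.1.lt_of_ne ?_
    rintro rfl
    obtain ⟨q, hq, hq'⟩ := h2 x hax hxb
    obtain ⟨y, hy1, hy2⟩ := exists_between (lt_min hq hxb)
    have hy := lt_min_iff.1 hy2
    exact h.asymm x y hax hxb (hax.trans hy1) hy.2 (hq' y hy1 hy.1) (hz.2.2 y hy1 hy.2)
  have haz := hax.trans hxz
  refine ⟨z, haz, hz.2.1, x, hax, hxb, ?_, b, hz.2.1, hz.2.2⟩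
  obtain ⟨p, hp, hp'⟩ := near_left {y : M | (y, x) ∈ R} z
  rcases hp' with hp' | hp'
  · exfalso
    obtain ⟨l, hl, hl'⟩ := h1 z haz hz.2.1
    obtain ⟨y, hy1, hy2⟩ := exists_between (max_lt hl (max_lt hp hxz))
    have hy := max_lt_iff.1 hy1
    have hy' := max_lt_iff.1 hy.2
    have hyx : (y, x) ∈ R := hp' y hy'.1 hy2
    have hzx : (z, x) ∈ R := h.trans z y x haz hz.2.1 (hax.trans hy'.2) (hy2.trans hz.2.1) hax hxb (hl' y hy.1 hy2) hyx
    have : y ∈ C := by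
      refine ⟨hy'.2.le, hy2.trans hz.2.1, fun w h3 h4 => ?_⟩
      rcases lt_trichotomy w z with h5 | rfl | h5
      · exact hp' w (hy'.1.trans h3) h5
      · exact hzx
      · exact hz.2.2 w h5 h4
    exact absurd (hz' y this) (not_le.2 hy2)
  · exact ⟨p, hp, hp'⟩

theorem kill {R : Set (M × M)} [DSet R] {a b : M} (hab : a < b) (h : SLO R a b)
    (h1 : ∀ s, a < s → s < b → LMin R s)
    (h2 : ∀ s, a < s → s < b → RMin R s) : False := by
  have hS : ∀ c d, a ≤ c → d ≤ b → SLO R c d := fun c d hc hd =>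
    ⟨fun x y p1 p2 p3 p4 => h.asymm x y (hc.trans_lt p1) (p2.trans_le hd) (hc.trans_lt p3) (p4.trans_le hd),
     fun x y z p1 p2 p3 p4 p5 p6 => h.trans x y z (hc.trans_lt p1) (p2.trans_le hd) (hc.trans_lt p3) (p4.trans_le hd) (hc.trans_lt p5) (p6.trans_le hd),
     fun x y p1 p2 p3 p4 => h.total x y (hc.trans_lt p1) (p2.trans_le hd) (hc.trans_lt p3) (p4.trans_le hd)⟩
  let Φ : Set M := {z | ∃ x, a < x ∧ x < b ∧
      (∃ p, p < z ∧ ∀ y, p < y → y < z → (y, x) ∉ R) ∧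
      (∃ q, z < q ∧ ∀ y, z < y → y < q → (y, x) ∈ R)}
  have dΦ : DSet Φ := by
    have : DSet {z : M | ∃ x, a < x ∧ x < b ∧
      (∃ p, p < z ∧ ∀ y, p < y → y < z → (y, x) ∉ R) ∧
      (∃ q, z < q ∧ ∀ y, z < y → y < q → (y, x) ∈ R)} := inferInstance
    exact this
  obtain ⟨c, d, hcd, hsub, hor⟩ := sub_or hab Φ
  have hac : a ≤ c := by
    by_contra hh
    obtain ⟨y, hy1, hy2⟩ := exists_between (lt_min (not_le.1 hh) hcd)
    have := lt_min_iff.1 hy2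
    exact lt_asymm this.1 (hsub ⟨hy1, this.2⟩).1
  have hdb : d ≤ b := by
    by_contra hh
    obtain ⟨y, hy1, hy2⟩ := exists_between (max_lt (not_le.1 hh) hcd)
    have := max_lt_iff.1 hy1
    exact lt_asymm this.1 (hsub ⟨this.2, hy2⟩).2
  rcases hor with hor | hor
  swap
  · obtain ⟨z, hz1, hz2, x, hx1, hx2, h3⟩ := phi_exists hcd (hS c d hac hdb)
      (fun s hs hs' => h1 s (hac.trans_lt hs) (hs'.trans_le hdb))
      (fun s hs hs' => h2 s (hac.trans_lt hs) (hs'.trans_le hdb))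
    exact hor ⟨hz1, hz2⟩ ⟨x, hac.trans_lt hx1, hx2.trans_le hdb, h3⟩
  have hS' := hS c d hac hdb
  have hS'' : @SLO M (swapLO M) R d c := @SLO.mk M (swapLO M) R d c
    (fun x y p1 p2 p3 p4 => hS'.asymm x y p2 p1 p4 p3)
    (fun x y z p1 p2 p3 p4 p5 p6 => hS'.trans x y z p2 p1 p4 p3 p6 p5)
    (fun x y p1 p2 p3 p4 => hS'.total x y p2 p1 p4 p3)
  obtain ⟨z, hz1, hz2, x, hx1, hx2, ⟨p, hp, hp'⟩, ⟨q, hq, hq'⟩⟩ :=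
    @phi_exists M _ (swapLO M) (swapOMin M) R _ d c hcd hS''
      (fun s hs hs' => by
        obtain ⟨p, hp, hp'⟩ := h2 s (hac.trans_lt hs') (lt_of_lt_of_le hs hdb)
        exact ⟨p, hp, fun y h3 h4 => hp' y h4 h3⟩)
      (fun s hs hs' => by
        obtain ⟨p, hp, hp'⟩ := h1 s (hac.trans_lt hs') (lt_of_lt_of_le hs hdb)
        exact ⟨p, hp, fun y h3 h4 => hp' y h4 h3⟩)
  have hz1 : z < d := hz1
  have hz2 : c < z := hz2
  have hx1 : x < d := hx1
  have hx2 : c < x := hx2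
  have hp : z < p := hp
  have hq : q < z := hq
  have hp' : ∀ y, y < p → z < y → (y, x) ∉ R := hp'
  have hq' : ∀ y, y < z → q < y → (y, x) ∈ R := hq'
  obtain ⟨x', hx1', hx2', ⟨p2, hp2, hp2'⟩, ⟨q2, hq2, hq2'⟩⟩ := hor ⟨hz2, hz1⟩
  have hax : a < x := hac.trans_lt hx2
  have hxb : x < b := hx1.trans_le hdb
  obtain ⟨y, hy1, hy2⟩ := exists_between (lt_min (lt_min hp hq2) hz1)
  have e1 := lt_min_iff.1 hy2
  have e2 := lt_min_iff.1 e1.1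
  have f1 : (y, x') ∈ R := hq2' y hy1 e2.2
  have f2 : (y, x) ∉ R := hp' y e2.1 hy1
  obtain ⟨w, hw1, hw2⟩ := exists_between (max_lt (max_lt hp2 hq) hz2)
  have e3 := max_lt_iff.1 hw1
  have e4 := max_lt_iff.1 e3.1
  have f3 : (w, x') ∉ R := hp2' w e4.1 hw2
  have f4 : (w, x) ∈ R := hq' w hw2 e4.2
  have hay : a < y := (hac.trans_lt hz2).trans hy1
  have hyb : y < b := e1.2.trans_le hdb
  have haw : a < w := hac.trans_lt e3.2
  have hwb : w < b := (hw2.trans hz1).trans_le hdb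
  have g1 : (x, x') ∈ R := by
    rcases eq_or_ne y x with rfl | hne
    · exact f1
    · have := (h.total y x hay hyb hax hxb hne).resolve_left f2
      exact h.trans x y x' hax hxb hay hyb hx1' hx2' this f1
  have g2 : (x', x) ∈ R := by
    rcases eq_or_ne w x' with rfl | hne
    · exact f4
    · have := (h.total w x' haw hwb hx1' hx2' hne).resolve_left f3
      exact h.trans x' w x hx1' hx2' haw hwb hax hxb this f4
  exact h.asymm x x' hax hxb hx1' hx2' g1 g2

theorem sub_bounds {a b c d : M} (hcd : c < d) (hsub : Ioo c d ⊆ Ioo a b) : a ≤ c ∧ d ≤ b := by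
  constructor
  · by_contra hh
    obtain ⟨y, hy1, hy2⟩ := exists_between (lt_min (not_le.1 hh) hcd)
    have := lt_min_iff.1 hy2
    exact lt_asymm this.1 (hsub ⟨hy1, this.2⟩).1
  · by_contra hh
    obtain ⟨y, hy1, hy2⟩ := exists_between (max_lt (not_le.1 hh) hcd)
    have := max_lt_iff.1 hy1
    exact lt_asymm this.1 (hsub ⟨this.2, hy2⟩).2

theorem SLO.sub {R : Set (M × M)} {a b c d : M} (h : SLO R a b) (hc : a ≤ c) (hd : d ≤ b) : SLO R c d :=
    ⟨fun x y p1 p2 p3 p4 => h.asymm x y (hc.trans_lt p1) (p2.trans_le hd) (hc.trans_lt p3) (p4.trans_le hd),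
     fun x y z p1 p2 p3 p4 p5 p6 => h.trans x y z (hc.trans_lt p1) (p2.trans_le hd) (hc.trans_lt p3) (p4.trans_le hd) (hc.trans_lt p5) (p6.trans_le hd),
     fun x y p1 p2 p3 p4 => h.total x y (hc.trans_lt p1) (p2.trans_le hd) (hc.trans_lt p3) (p4.trans_le hd)⟩

theorem SLO.swap {R : Set (M × M)} {a b : M} (h : SLO R a b) : SLO {p | (p.2, p.1) ∈ R} a b :=
    ⟨fun x y p1 p2 p3 p4 => h.asymm y x p3 p4 p1 p2,
     fun x y z p1 p2 p3 p4 p5 p6 e f => h.trans z y x p5 p6 p3 p4 p1 p2 f e,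
     fun x y p1 p2 p3 p4 hne => (h.total x y p1 p2 p3 p4 hne).symm⟩

theorem SLO.mono {R : Set (M × M)} [DSet R] {a b : M} (hab : a < b) (h : SLO R a b) :
    ∃ c d, c < d ∧ Ioo c d ⊆ Ioo a b ∧
      ((∀ s z, c < s → s < z → z < d → (s, z) ∈ R) ∨ (∀ s z, c < s → s < z → z < d → (z, s) ∈ R)) := by
  have dL : DSet {s : M | LMin R s} := by
    have : DSet {s : M | ∃ p, p < s ∧ ∀ y, p < y → y < s → (s, y) ∈ R} := inferInstance
    exact this
  have dR : DSet {s : M | RMin R s} := by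
    have : DSet {s : M | ∃ q, s < q ∧ ∀ y, s < y → y < q → (s, y) ∈ R} := inferInstance
    exact this
  obtain ⟨c', d', hcd', hsub', hor'⟩ := sub_or hab {s | LMin R s}
  obtain ⟨c, d, hcd, hsub, hor⟩ := sub_or hcd' {s | RMin R s}
  have hor' := hor'.imp (fun h => hsub.trans h) (fun h => hsub.trans h)
  have hsub2 := hsub.trans hsub'
  have hb := sub_bounds hcd hsub2
  have hS := h.sub hb.1 hb.2
  refine ⟨c, d, hcd, hsub2, ?_⟩
  have nl : ∀ s, c < s → s < d → ¬ LMin R s → LMin {p | (p.2, p.1) ∈ R} s := by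
    intro s hs hs' hn
    obtain ⟨p, hp, hp'⟩ := near_left {y : M | (s, y) ∈ R} s
    rcases hp' with hp' | hp'
    · exact absurd ⟨p, hp, hp'⟩ hn
    · refine ⟨max p c, max_lt hp hs, fun y h1 h2 => ?_⟩
      have h1 := max_lt_iff.1 h1
      exact (hS.total s y hs hs' h1.2 (h2.trans hs') h2.ne').resolve_left (hp' y h1.1 h2)
  have nr : ∀ s, c < s → s < d → ¬ RMin R s → RMin {p | (p.2, p.1) ∈ R} s := by
    intro s hs hs' hn
    obtain ⟨p, hp, hp'⟩ := near_right {y : M | (s, y) ∈ R} s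
    rcases hp' with hp' | hp'
    · exact absurd ⟨p, hp, hp'⟩ hn
    · refine ⟨min p d, lt_min hp hs', fun y h1 h2 => ?_⟩
      have h2 := lt_min_iff.1 h2
      exact (hS.total s y hs hs' (hs.trans h1) h2.2 h1.ne).resolve_left (hp' y h1 h2.1)
  have dR' : DSet {p : M × M | (p.2, p.1) ∈ R} := inferInstance
  rcases hor' with hL | hL <;> rcases hor with hR | hR
  · exact (kill hcd hS (fun s h1 h2 => hL ⟨h1, h2⟩) (fun s h1 h2 => hR ⟨h1, h2⟩)).elim
  · right
    exact hS.swap.inc (fun s h1 h2 => hL ⟨h1, h2⟩) (fun s h1 h2 => nr s h1 h2 (hR ⟨h1, h2⟩))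
  · left
    exact hS.inc (fun s h1 h2 => nl s h1 h2 (hL ⟨h1, h2⟩)) (fun s h1 h2 => hR ⟨h1, h2⟩)
  · exact (kill hcd hS.swap (fun s h1 h2 => nl s h1 h2 (hL ⟨h1, h2⟩))
      (fun s h1 h2 => nr s h1 h2 (hR ⟨h1, h2⟩))).elim

end
end OM

namespace OM
universe u
set_option synthInstance.maxSize 5000
set_option synthInstance.maxHeartbeats 400000
set_option maxHeartbeats 1000000
set_option linter.unusedSectionVars false
section
variable {M : Type u} [DS M] [LinearOrder M] [OMin M]

theorem fn_of_graph {T S : Type u} [DTy T M] [DTy S M] (G : Set (T × S)) [DSet G]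
    (hG : ∀ x y z, (x, y) ∈ G → (x, z) ∈ G → y = z) (s0 : S) :
    ∃ f : T → S, DFn f ∧ ∀ x y, (x, y) ∈ G → f x = y := by
  classical
  let f : T → S := fun x => if h : ∃ y, (x, y) ∈ G then h.choose else s0
  have hf : ∀ x y, (x, y) ∈ G → f x = y := by
    intro x y hy
    have h : ∃ y, (x, y) ∈ G := ⟨y, hy⟩
    simp only [f, dif_pos h]
    exact hG x _ _ h.choose_spec hy
  refine ⟨f, ?_, hf⟩
  constructor
  have : DSet {p : T × S | (p.1, p.2) ∈ G ∨ ((∀ y, (p.1, y) ∉ G) ∧ s0 = p.2)} := inferInstance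
  convert this using 1
  ext ⟨x, y⟩
  constructor
  · intro h
    change f x = y at h
    by_cases h' : ∃ y, (x, y) ∈ G
    · obtain ⟨z, hz⟩ := h'
      left
      have := hf x z hz
      change (x, y) ∈ G
      rwa [← h, this]
    · right
      refine ⟨fun y hy => h' ⟨y, hy⟩, ?_⟩
      simp only [f, dif_neg h'] at h
      exact h
  · rintro (h | ⟨h, h'⟩)
    · exact hf x y h
    · change f x = y
      have h'' : ¬ ∃ y, (x, y) ∈ G := fun ⟨y, hy⟩ => h y hy
      simp only [f, dif_neg h'']
      exact h'

theorem trich (f : M → M) [DFn f] {a b : M} (hab : a < b) :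
    ∃ c d, c < d ∧ Ioo c d ⊆ Ioo a b ∧
      (∀ s t z, c < s → s < t → t < z → z < d → min (f s) (f z) ≤ f t ∧ f t ≤ max (f s) (f z)) ∧
      ((∀ s ∈ Ioo c d, ∀ z ∈ Ioo c d, f s = f z) ∨
        (∀ s ∈ Ioo c d, ∀ z ∈ Ioo c d, s ≠ z → f s ≠ f z)) := by
  have : ∀ {T : Type u} [DTy T M] (g : T → M) [DFn g], DFn (fun x => f (g x)) :=
    fun g => DFn.comp ‹DFn f› ‹_›
  by_cases h1 : ∃ y, (Ioo a b ∩ {s | f s = y}).Infinite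
  · obtain ⟨y, hy⟩ := h1
    obtain ⟨c, d, hcd, hs⟩ := inf_interval hy
    have hc : ∀ s, c < s → s < d → f s = y := fun s h1 h2 => (hs ⟨h1, h2⟩).2
    refine ⟨c, d, hcd, fun s hs' => (hs hs').1, ?_, Or.inl fun s hs z hz => ?_⟩
    · intro s t z h1 h2 h3 h4
      rw [hc s h1 (h2.trans (h3.trans h4)), hc t (h1.trans h2) (h3.trans h4), hc z (h1.trans (h2.trans h3)) h4]
      simp
    · rw [hc s hs.1 hs.2, hc z hz.1 hz.2]
  · push Not at h1
    have hA : DSet {s : M | (a < s ∧ s < b) ∧ ∀ s', a < s' → s' < s → f s' ≠ f s} := inferInstance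
    have hinf : {s : M | (a < s ∧ s < b) ∧ ∀ s', a < s' → s' < s → f s' ≠ f s}.Infinite := by
      intro hfin
      refine Set.Ioo_infinite hab ?_
      have : Ioo a b ⊆ ⋃ s ∈ {s : M | (a < s ∧ s < b) ∧ ∀ s', a < s' → s' < s → f s' ≠ f s},
          (Ioo a b ∩ {z | f z = f s}) := by
        intro z hz
        obtain ⟨m, hm, hm'⟩ := (h1 (f z)).exists_minimal ⟨z, hz, rfl⟩
        have hfm : f m = f z := hm.2
        refine Set.mem_biUnion (x := m) ⟨hm.1, fun s' h3 h4 h5 => ?_⟩ ⟨hz, hfm.symm⟩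
        exact absurd (hm' (y := s') ⟨⟨h3, h4.trans hm.1.2⟩, h5.trans hfm⟩ h4.le) (not_le.2 h4)
      exact (hfin.biUnion fun s _ => h1 (f s)).subset this
    obtain ⟨c, d, hcd, hs⟩ := inf_interval hinf
    have hinj : ∀ s z, c < s → s < d → c < z → z < d → s ≠ z → f s ≠ f z := by
      intro s z h1 h2 h3 h4 hne
      rcases lt_or_gt_of_ne hne with h | h
      · exact (hs ⟨h3, h4⟩).2 s (hs ⟨h1, h2⟩).1.1 h
      · exact ((hs ⟨h1, h2⟩).2 z (hs ⟨h3, h4⟩).1.1 h).symm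
    have hR : DSet {p : M × M | f p.1 < f p.2} := inferInstance
    have hS : SLO {p : M × M | f p.1 < f p.2} c d := by
      refine ⟨fun x y _ _ _ _ h => ?_, fun x y z _ _ _ _ _ _ h h' => ?_, fun x y h1 h2 h3 h4 h5 => ?_⟩
      · exact not_lt_of_gt (show f x < f y from h)
      · exact lt_trans (show f x < f y from h) h'
      · exact lt_or_gt_of_ne (hinj x y h1 h2 h3 h4 h5)
    obtain ⟨c', d', hcd', hsub, h⟩ := hS.mono hcd
    refine ⟨c', d', hcd', fun x hx => (hs (hsub hx)).1, ?_, Or.inr fun s hs z hz hne => ?_⟩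
    · intro s t z e1 e2 e3 e4
      rcases h with h | h
      · exact ⟨(min_le_left _ _).trans (h s t e1 e2 (e3.trans e4)).le, (h t z (e1.trans e2) e3 e4).le.trans (le_max_right _ _)⟩
      · exact ⟨(min_le_right _ _).trans (h t z (e1.trans e2) e3 e4).le, (h s t e1 e2 (e3.trans e4)).le.trans (le_max_left _ _)⟩
    · exact hinj s z (hsub hs).1 (hsub hs).2 (hsub hz).1 (hsub hz).2 hne

theorem Wlem (α β : M → M) [DFn α] [DFn β] {a b : M} (hab : a < b)
    (h : ∀ s, a < s → s < b → α s < β s) :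
    ∃ t c d, c < d ∧ Ioo c d ⊆ Ioo a b ∧ ∀ s, c < s → s < d → α s < t ∧ t < β s := by
  have : ∀ {T : Type u} [DTy T M] (g : T → M) [DFn g], DFn (fun x => α (g x)) :=
    fun g => DFn.comp ‹DFn α› ‹_›
  obtain ⟨c, d, hcd, hs, h1, h2⟩ := trich β hab
  obtain ⟨c', d', hcd', hs', h1', h2'⟩ := trich α hcd
  have key : ∃ s ∈ Ioo c' d', ∃ z ∈ Ioo c' d', s ≠ z ∧ α s < β z ∧ α z < β s := by
    rcases h2' with h2' | h2'
    · obtain ⟨s, e1, e2⟩ := exists_between hcd'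
      obtain ⟨z, e3, e4⟩ := exists_between e2
      have hs1 : s ∈ Ioo c' d' := ⟨e1, e2⟩
      have hz1 : z ∈ Ioo c' d' := ⟨e1.trans e3, e4⟩
      have q1 := h s (hs (hs' hs1)).1 (hs (hs' hs1)).2
      have q2 := h z (hs (hs' hz1)).1 (hs (hs' hz1)).2
      have q3 := h2' s hs1 z hz1
      exact ⟨s, hs1, z, hz1, e3.ne, q3 ▸ q2, q3 ▸ q1⟩
    · have hD : DSet {y : M | ∃ s, (c' < s ∧ s < d') ∧ α s = y} := inferInstance
      have hinf : {y : M | ∃ s, (c' < s ∧ s < d') ∧ α s = y}.Infinite := by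
        have := (Set.Ioo_infinite hcd').image (f := α) (fun s hs z hz e => by
          by_contra hne; exact h2' s hs z hz hne e)
        exact this
      obtain ⟨u, v, huv, hI⟩ := inf_interval hinf
      obtain ⟨y, hy1, hy2⟩ := exists_between huv
      obtain ⟨s, hs1, rfl⟩ := hI ⟨hy1, hy2⟩
      have q1 := h s (hs (hs' hs1)).1 (hs (hs' hs1)).2
      obtain ⟨w, hw1, hw2⟩ := exists_between (lt_min hy2 q1)
      obtain ⟨z, hz1, rfl⟩ := hI ⟨hy1.trans hw1, (lt_min_iff.1 hw2).1⟩
      have q2 := h z (hs (hs' hz1)).1 (hs (hs' hz1)).2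
      exact ⟨s, hs1, z, hz1, fun e => by subst e; exact lt_irrefl _ hw1, hw1.trans q2, (lt_min_iff.1 hw2).2⟩
  have fin : ∀ s z, c' < s → s < z → z < d' → α s < β z → α z < β s →
      ∃ t c d, c < d ∧ Ioo c d ⊆ Ioo a b ∧ ∀ s, c < s → s < d → α s < t ∧ t < β s := by
    intro s z e1 e2 e3 e4 e5
    have hs1 : s ∈ Ioo c' d' := ⟨e1, e2.trans e3⟩
    have hz1 : z ∈ Ioo c' d' := ⟨e1.trans e2, e3⟩
    have q1 := h s (hs (hs' hs1)).1 (hs (hs' hs1)).2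
    have q2 := h z (hs (hs' hz1)).1 (hs (hs' hz1)).2
    have : max (α s) (α z) < min (β s) (β z) := by simp [*]
    obtain ⟨t, ht1, ht2⟩ := exists_between this
    refine ⟨t, s, z, e2, fun x hx => hs (hs' ⟨e1.trans hx.1, hx.2.trans e3⟩), fun x hx1 hx2 => ?_⟩
    exact ⟨(h1' s x z e1 hx1 hx2 e3).2.trans_lt ht1,
      ht2.trans_le (h1 s x z (hs' hs1).1 hx1 hx2 (hs' hz1).2).1⟩
  obtain ⟨s, hs1, z, hz1, hne, e1, e2⟩ := key
  rcases lt_or_gt_of_ne hne with hh | hh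
  · exact fin s z hs1.1 hh hz1.2 e1 e2
  · exact fin z s hz1.1 hh hs1.2 e2 e1

theorem Wot {F : Filter M} (hF : IsOT F) (W : Set (M × M)) [DSet W] {a b : M} (hab : a < b)
    (h : ∀ s ∈ Ioo a b, {y | (s, y) ∈ W} ∈ F) :
    ∃ t c d, c < d ∧ Ioo c d ⊆ Ioo a b ∧ ∀ s, c < s → s < d → (s, t) ∈ W := by
  obtain ⟨V, hV, hVd, hinf⟩ := hF.unif (Ioo a b) (Set.Ioo_infinite hab) W h
  have := hF.neBot
  obtain ⟨t, ht⟩ := F.nonempty_of_mem hV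
  have hD : DSet {s : M | (a < s ∧ s < b) ∧ (s, t) ∈ W} := inferInstance
  have hinf' : {s : M | (a < s ∧ s < b) ∧ (s, t) ∈ W}.Infinite :=
    hinf.mono fun s hs => ⟨hs.1, hs.2 t ht⟩
  obtain ⟨c, d, hcd, hs⟩ := inf_interval hinf'
  exact ⟨t, c, d, hcd, fun x hx => (hs hx).1, fun s h1 h2 => (hs ⟨h1, h2⟩).2⟩

theorem hendUniv {M : Type u} [LinearOrder M] [Nonempty M] [NoMaxOrder M] : Hend (Set.univ : Set M) :=
  ⟨fun _ _ _ _ => trivial, Set.univ_nonempty, fun x _ => (exists_gt x).imp fun _ h => ⟨trivial, h⟩⟩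

theorem Wp (W : Set (M × M)) [DSet W] {a b : M} (hab : a < b)
    (h : ∀ s, a < s → s < b → ∃ p q, p < q ∧ ∀ y, p < y → y < q → (s, y) ∈ W) :
    ∃ t c d, c < d ∧ Ioo c d ⊆ Ioo a b ∧ ∀ s, c < s → s < d → (s, t) ∈ W := by
  have hT : IsL (tailF (Set.univ : Set M)) := ⟨_, inferInstance, hendUniv, rfl⟩
  have hB : @IsL M _ (swapLO M) (@tailF M (swapLO M) Set.univ) :=
    ⟨_, inferInstance, @hendUniv M (swapLO M) _ (@OMin.nomax M _ (swapLO M) (swapOMin M)), rfl⟩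
  have step : ∀ F : Filter M, IsOT F → ∀ a b : M, a < b →
      (∃ t c d, c < d ∧ Ioo c d ⊆ Ioo a b ∧ ∀ s, c < s → s < d → (s, t) ∈ W) ∨
      ∃ c d, c < d ∧ Ioo c d ⊆ Ioo a b ∧ ∀ s ∈ Ioo c d, {y | (s, y) ∉ W} ∈ F := by
    intro F hF a b hab
    have := hF.dk W
    obtain ⟨c, d, hcd, hs, h | h⟩ := sub_or hab {s | {y | (s, y) ∈ W} ∈ F}
    · left
      obtain ⟨t, c', d', h1, h2, h3⟩ := Wot hF W hcd h
      exact ⟨t, c', d', h1, h2.trans hs, h3⟩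
    · right
      refine ⟨c, d, hcd, hs, fun s hs' => ?_⟩
      have hD : DSet {y | (s, y) ∈ W} := inferInstance
      exact (hF.dec {y | (s, y) ∈ W}).resolve_left (h hs')
  rcases step _ (Or.inr (Or.inl hT)) a b hab with h1 | ⟨c, d, hcd, hs, h1⟩
  · exact h1
  rcases step _ (Or.inr (Or.inr hB)) c d hcd with h2 | ⟨c', d', hcd', hs', h2⟩
  · obtain ⟨t, c', d', q1, q2, q3⟩ := h2
    exact ⟨t, c', d', q1, q2.trans hs, q3⟩
  have htop : ∀ s, c' < s → s < d' → ∃ z, ∀ y, z < y → (s, y) ∉ W := by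
    intro s e1 e2
    obtain ⟨z, _, hz⟩ := (mem_tailF hendUniv.ne).1 (h1 s (hs' ⟨e1, e2⟩))
    exact ⟨z, fun y hy => hz y trivial hy⟩
  have hbot : ∀ s, c' < s → s < d' → ∃ z, ∀ y, y < z → (s, y) ∉ W := by
    intro s e1 e2
    obtain ⟨z, _, hz⟩ := (@mem_tailF M (swapLO M) _ Set.univ_nonempty _).1 (h2 s ⟨e1, e2⟩)
    exact ⟨z, fun y hy => hz y trivial hy⟩
  let Cs : Set (M × M) := {p | ∃ b, p.2 < b ∧ ∀ y, p.2 < y → y < b → (p.1, y) ∈ W}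
  have hCs : DSet Cs := by
    have : DSet {p : M × M | ∃ b, p.2 < b ∧ ∀ y, p.2 < y → y < b → (p.1, y) ∈ W} := inferInstance
    exact this
  let G1 : Set (M × M) := {p | (p.1, p.2) ∈ Cs ∧ ∀ c, (p.1, c) ∈ Cs → p.2 ≤ c}
  have hG1 : DSet G1 := by
    have : DSet {p : M × M | (p.1, p.2) ∈ Cs ∧ ∀ c, (p.1, c) ∈ Cs → p.2 ≤ c} := inferInstance
    exact this
  let Bs : Set ((M × M) × M) := {p | p.1.2 < p.2 ∧ ∀ y, p.1.2 < y → y < p.2 → (p.1.1, y) ∈ W}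
  have hBs : DSet Bs := by
    have : DSet {p : (M × M) × M | p.1.2 < p.2 ∧ ∀ y, p.1.2 < y → y < p.2 → (p.1.1, y) ∈ W} := inferInstance
    exact this
  let G2 : Set (M × M) := {p | ∃ a, (p.1, a) ∈ G1 ∧ ((p.1, a), p.2) ∈ Bs ∧ ∀ c, ((p.1, a), c) ∈ Bs → c ≤ p.2}
  have hG2 : DSet G2 := by
    have : DSet {p : M × M | ∃ a, (p.1, a) ∈ G1 ∧ ((p.1, a), p.2) ∈ Bs ∧ ∀ c, ((p.1, a), c) ∈ Bs → c ≤ p.2} := inferInstance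
    exact this
  have u1 : ∀ x y z, (x, y) ∈ G1 → (x, z) ∈ G1 → y = z := fun x y z hy hz =>
    le_antisymm (hy.2 z hz.1) (hz.2 y hy.1)
  have u2 : ∀ x y z, (x, y) ∈ G2 → (x, z) ∈ G2 → y = z := by
    rintro x y z ⟨a, ha, hy, hy'⟩ ⟨a', ha', hz, hz'⟩
    obtain rfl := u1 x a a' ha ha'
    exact le_antisymm (hz' y hy) (hy' z hz)
  obtain ⟨m⟩ : Nonempty M := OMin.ne
  obtain ⟨α, hα, hα'⟩ := fn_of_graph G1 u1 m
  obtain ⟨β, hβ, hβ'⟩ := fn_of_graph G2 u2 m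
  have e1 : ∀ s, c' < s → s < d' → ∃ a, (s, a) ∈ G1 := by
    intro s k1 k2
    have hD : DSet {y | (s, y) ∈ W} := inferInstance
    have hD' : DSet {y | (s, y) ∈ Cs} := inferInstance
    obtain ⟨z, hz⟩ := hbot s k1 k2
    obtain ⟨a0, ha0, ha0'⟩ := exists_least_of (C := {y | (s, y) ∈ Cs})
      (by obtain ⟨p, q, h3, h4⟩ := h s (hs (hs' ⟨k1, k2⟩)).1 (hs (hs' ⟨k1, k2⟩)).2
          exact ⟨p, q, h3, h4⟩)
      (by obtain ⟨z', hz'⟩ := exists_lt z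
          refine ⟨z', ?_⟩
          rintro c ⟨b, hb, hb'⟩
          by_contra hcz
          obtain ⟨y, y1, y2⟩ := exists_between (lt_min hb ((not_lt.1 hcz).trans_lt hz'))
          exact hz y (lt_min_iff.1 y2).2 (hb' y y1 (lt_min_iff.1 y2).1))
      (by intro a l1 l2
          obtain ⟨p, hp, h3 | h3⟩ := near_right {y | (s, y) ∈ W} a
          · exact ⟨p, hp, h3⟩
          · obtain ⟨c, ⟨b, hb, hb'⟩, hcp⟩ := l2 p hp
            have hac := l1 c ⟨b, hb, hb'⟩
            obtain ⟨y, y1, y2⟩ := exists_between (lt_min hb hcp)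
            exact absurd (hb' y y1 (lt_min_iff.1 y2).1) (h3 y (hac.trans_lt y1) (lt_min_iff.1 y2).2))
    exact ⟨a0, ha0, ha0'⟩
  have e2 : ∀ s, c' < s → s < d' → ∃ a, (s, a) ∈ G2 := by
    intro s k1 k2
    obtain ⟨a0, ha0⟩ := e1 s k1 k2
    have hD' : DSet {y | ((s, a0), y) ∈ Bs} := inferInstance
    obtain ⟨z, hz⟩ := htop s k1 k2
    obtain ⟨b0, hb0, hb0'⟩ := exists_greatest_of (C := {y | ((s, a0), y) ∈ Bs})
      ha0.1
      (by obtain ⟨z', hz'⟩ := exists_gt z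
          refine ⟨z', ?_⟩
          rintro c ⟨hb, hb'⟩
          by_contra hcz
          obtain ⟨y, y1, y2⟩ := exists_between (max_lt hb (hz'.trans_le (not_lt.1 hcz)))
          exact hz y (max_lt_iff.1 y1).2 (hb' y (max_lt_iff.1 y1).1 y2))
      (by intro a l1 l2
          obtain ⟨c0, hc0⟩ := ha0.1
          refine ⟨lt_of_lt_of_le hc0.1 (l1 c0 hc0), fun y y1 y2 => ?_⟩
          obtain ⟨c, hc, hc'⟩ := l2 y y2
          exact hc.2 y y1 hc')
    exact ⟨b0, a0, ha0, hb0, hb0'⟩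
  have key : ∀ s, c' < s → s < d' → α s < β s ∧ ∀ y, α s < y → y < β s → (s, y) ∈ W := by
    intro s k1 k2
    obtain ⟨b0, a0, ha0, hb0, hb0'⟩ := e2 s k1 k2
    rw [hα' s a0 ha0, hβ' s b0 ⟨a0, ha0, hb0, hb0'⟩]
    exact hb0
  obtain ⟨t, c2, d2, h3, h4, h5⟩ := Wlem α β hcd' fun s k1 k2 => (key s k1 k2).1
  refine ⟨t, c2, d2, h3, fun x hx => hs (hs' (h4 hx)), fun s k1 k2 => ?_⟩
  exact (key s (h4 ⟨k1, k2⟩).1 (h4 ⟨k1, k2⟩).2).2 t (h5 s k1 k2).1 (h5 s k1 k2).2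

end

/-- the one point power -/
@[reducible] def punitDTy {M : Type u} [DS M] : DTy PUnit.{u+1} M where
  ι := Empty
  fin := inferInstance
  e := ⟨fun _ i => i.elim, fun _ => PUnit.unit, fun _ => rfl, fun _ => by funext i; exact i.elim⟩

/-- explicit powers -/
inductive Pow (M : Type u) [DS M] : (T : Type u) → DTy T M → Prop
  | zero : Pow M PUnit.{u+1} punitDTy
  | succ {T : Type u} (d : DTy T M) : Pow M T d → Pow M (M × T) (@prodDTy M M T baseDTy d)

theorem Pow.ne {M : Type u} [DS M] [Nonempty M] {T : Type u} {d : DTy T M} (h : Pow M T d) : Nonempty T := by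
  induction h with
  | zero => exact ⟨PUnit.unit⟩
  | succ d h ih => infer_instance

section
variable {M : Type u} [DS M] [LinearOrder M] [OMin M]

/-- local definable selection -/
theorem Sel {T : Type u} {dT : DTy T M} (hT : Pow M T dT) : ∀ (E : Set (M × T)) [DSet E] {a b : M},
    a < b → (∀ s, a < s → s < b → ∃ y, (s, y) ∈ E) →
    ∃ c d, c < d ∧ Ioo c d ⊆ Ioo a b ∧ ∃ f : M → T, DFn f ∧ ∀ s, c < s → s < d → (s, f s) ∈ E := by
  induction hT with
  | zero =>
    intro E hE a b hab h
    letI : DTy PUnit.{u+1} M := punitDTy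
    refine ⟨a, b, hab, subset_rfl, fun _ => PUnit.unit, DFn.const' _, fun s h1 h2 => ?_⟩
    obtain ⟨y, hy⟩ := h s h1 h2
    exact hy
  | @succ T dT hT ih =>
    intro E hE a b hab h
    have : Nonempty T := hT.ne
    have hI : DSet {s : M | ∃ p q, p < q ∧ ∀ y, p < y → y < q → ∃ w, (s, (y, w)) ∈ E} := inferInstance
    obtain ⟨c, d, hcd, hs, h1 | h1⟩ := sub_or hab {s : M | ∃ p q, p < q ∧ ∀ y, p < y → y < q → ∃ w, (s, (y, w)) ∈ E}
    · have hW : DSet {p : M × M | ∃ w, (p.1, (p.2, w)) ∈ E} := inferInstance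
      obtain ⟨t, c', d', h2, h3, h4⟩ := Wp {p : M × M | ∃ w, (p.1, (p.2, w)) ∈ E} hcd
        fun s k1 k2 => h1 ⟨k1, k2⟩
      have hE' : DSet {p : M × T | (p.1, (t, p.2)) ∈ E} := inferInstance
      obtain ⟨c2, d2, h5, h6, f, hf, h7⟩ := ih {p : M × T | (p.1, (t, p.2)) ∈ E} h2 h4
      have : DFn (fun s => (t, f s)) := inferInstance
      exact ⟨c2, d2, h5, fun x hx => hs (h3 (h6 hx)), fun s => (t, f s), this, h7⟩
    · let G : Set (M × M) := {p | (∃ w, (p.1, (p.2, w)) ∈ E) ∧ ∀ z, (∃ w, (p.1, (z, w)) ∈ E) → p.2 ≤ z}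
      have hG : DSet G := by
        have : DSet {p : M × M | (∃ w, (p.1, (p.2, w)) ∈ E) ∧ ∀ z, (∃ w, (p.1, (z, w)) ∈ E) → p.2 ≤ z} := inferInstance
        exact this
      obtain ⟨m⟩ : Nonempty M := OMin.ne
      obtain ⟨g, hg, hg'⟩ := fn_of_graph G (fun x y z hy hz => le_antisymm (hy.2 z hz.1) (hz.2 y hy.1)) m
      have hg2 : ∀ {T : Type u} [DTy T M] (f : T → M) [DFn f], DFn (fun x => g (f x)) :=
        fun f => DFn.comp ‹DFn g› ‹_›
      have hex : ∀ s, c < s → s < d → ∃ w, (s, (g s, w)) ∈ E := by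
        intro s k1 k2
        have hA : DSet {y : M | ∃ w, (s, (y, w)) ∈ E} := inferInstance
        have hfin : {y : M | ∃ w, (s, (y, w)) ∈ E}.Finite := by
          by_contra hinf
          obtain ⟨p, q, hpq, hh⟩ := inf_interval hinf
          exact h1 ⟨k1, k2⟩ ⟨p, q, hpq, fun y y1 y2 => hh ⟨y1, y2⟩⟩
        obtain ⟨⟨y, w⟩, hyw⟩ := h s (hs ⟨k1, k2⟩).1 (hs ⟨k1, k2⟩).2
        obtain ⟨m, hm, hm'⟩ := hfin.exists_minimal ⟨y, w, hyw⟩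
        have : (s, m) ∈ G := ⟨hm, fun z hz => by
          by_contra hlt; exact hlt (hm' hz (not_le.1 hlt).le)⟩
        rw [hg' s m this]
        exact hm
      have hE' : DSet {p : M × T | (p.1, (g p.1, p.2)) ∈ E} := inferInstance
      obtain ⟨c2, d2, h5, h6, f, hf, h7⟩ := ih {p : M × T | (p.1, (g p.1, p.2)) ∈ E} hcd hex
      have : DFn (fun s => (g s, f s)) := inferInstance
      exact ⟨c2, d2, h5, fun x hx => hs (h6 hx), fun s => (g s, f s), this, h7⟩

end
end OM

namespace OM
universe u
set_option synthInstance.maxSize 5000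
set_option synthInstance.maxHeartbeats 400000
set_option maxHeartbeats 1000000
set_option linter.unusedSectionVars false
section
variable {M : Type u} [DS M] [LinearOrder M] [OMin M]

theorem locconst (ρ : Set (M × M)) [DSet ρ] {a b : M} (hab : a < b)
    (hrefl : ∀ s, (s, s) ∈ ρ)
    (hmax : ∀ c d, c < d → Ioo c d ⊆ Ioo a b → ∃ m ∈ Ioo c d, ∀ z ∈ Ioo c d, (z, m) ∈ ρ)
    (hmin : ∀ c d, c < d → Ioo c d ⊆ Ioo a b → ∃ m ∈ Ioo c d, ∀ z ∈ Ioo c d, (m, z) ∈ ρ) :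
    ∃ s ∈ Ioo a b, ∃ p, p < s ∧ ∃ q, s < q ∧ ∀ z, p < z → z < q → (s, z) ∈ ρ ∧ (z, s) ∈ ρ := by
  have d1 : DSet {s : M | ∃ q, s < q ∧ ∀ z, s < z → z < q → (z, s) ∉ ρ} := inferInstance
  have d2 : DSet {s : M | ∃ q, s < q ∧ ∀ z, s < z → z < q → (s, z) ∉ ρ} := inferInstance
  have d3 : DSet {s : M | ∃ q, q < s ∧ ∀ z, q < z → z < s → (z, s) ∉ ρ} := inferInstance
  have d4 : DSet {s : M | ∃ q, q < s ∧ ∀ z, q < z → z < s → (s, z) ∉ ρ} := inferInstance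
  obtain ⟨c1, e1, h1, s1, g1⟩ := sub_or hab {s : M | ∃ q, s < q ∧ ∀ z, s < z → z < q → (z, s) ∉ ρ}
  obtain ⟨c2, e2, h2, s2, g2⟩ := sub_or h1 {s : M | ∃ q, s < q ∧ ∀ z, s < z → z < q → (s, z) ∉ ρ}
  obtain ⟨c3, e3, h3, s3, g3⟩ := sub_or h2 {s : M | ∃ q, q < s ∧ ∀ z, q < z → z < s → (z, s) ∉ ρ}
  obtain ⟨c4, e4, h4, s4, g4⟩ := sub_or h3 {s : M | ∃ q, q < s ∧ ∀ z, q < z → z < s → (s, z) ∉ ρ}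
  have g1 := g1.resolve_left fun g => by
    obtain ⟨m, hm, hm'⟩ := hmax c1 e1 h1 s1
    obtain ⟨q, hq, hq'⟩ := g hm
    obtain ⟨z, z1, z2⟩ := exists_between (lt_min hq hm.2)
    exact hq' z z1 (lt_min_iff.1 z2).1 (hm' z ⟨hm.1.trans z1, (lt_min_iff.1 z2).2⟩)
  have g2 := g2.resolve_left fun g => by
    obtain ⟨m, hm, hm'⟩ := hmin c2 e2 h2 (s2.trans s1)
    obtain ⟨q, hq, hq'⟩ := g hm
    obtain ⟨z, z1, z2⟩ := exists_between (lt_min hq hm.2)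
    exact hq' z z1 (lt_min_iff.1 z2).1 (hm' z ⟨hm.1.trans z1, (lt_min_iff.1 z2).2⟩)
  have g3 := g3.resolve_left fun g => by
    obtain ⟨m, hm, hm'⟩ := hmax c3 e3 h3 (s3.trans (s2.trans s1))
    obtain ⟨q, hq, hq'⟩ := g hm
    obtain ⟨z, z1, z2⟩ := exists_between (max_lt hq hm.1)
    exact hq' z (max_lt_iff.1 z1).1 z2 (hm' z ⟨(max_lt_iff.1 z1).2, z2.trans hm.2⟩)
  have g4 := g4.resolve_left fun g => by
    obtain ⟨m, hm, hm'⟩ := hmin c4 e4 h4 (s4.trans (s3.trans (s2.trans s1)))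
    obtain ⟨q, hq, hq'⟩ := g hm
    obtain ⟨z, z1, z2⟩ := exists_between (max_lt hq hm.1)
    exact hq' z (max_lt_iff.1 z1).1 z2 (hm' z ⟨(max_lt_iff.1 z1).2, z2.trans hm.2⟩)
  obtain ⟨s, hs1, hs2⟩ := exists_between h4
  have hs : s ∈ Ioo c4 e4 := ⟨hs1, hs2⟩
  have k1 : DSet {z : M | (z, s) ∈ ρ} := inferInstance
  have k2 : DSet {z : M | (s, z) ∈ ρ} := inferInstance
  obtain ⟨q1, l1, m1⟩ := near_right {z : M | (z, s) ∈ ρ} s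
  obtain ⟨q2, l2, m2⟩ := near_right {z : M | (s, z) ∈ ρ} s
  obtain ⟨p1, l3, m3⟩ := near_left {z : M | (z, s) ∈ ρ} s
  obtain ⟨p2, l4, m4⟩ := near_left {z : M | (s, z) ∈ ρ} s
  have m1 := m1.resolve_right fun h => g1 (s2 (s3 (s4 hs))) ⟨q1, l1, h⟩
  have m2 := m2.resolve_right fun h => g2 (s3 (s4 hs)) ⟨q2, l2, h⟩
  have m3 := m3.resolve_right fun h => g3 (s4 hs) ⟨p1, l3, h⟩
  have m4 := m4.resolve_right fun h => g4 hs ⟨p2, l4, h⟩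
  refine ⟨s, s1 (s2 (s3 (s4 hs))), max p1 p2, max_lt l3 l4, min q1 q2, lt_min l1 l2, fun z z1 z2 => ?_⟩
  rcases lt_trichotomy z s with h | h | h
  · exact ⟨m4 z (max_lt_iff.1 z1).2 h, m3 z (max_lt_iff.1 z1).1 h⟩
  · subst h; exact ⟨hrefl _, hrefl _⟩
  · exact ⟨m2 z h (lt_min_iff.1 z2).2, m1 z h (lt_min_iff.1 z2).1⟩

theorem const_tail_L {F : Filter M} (hF : IsL F) (Q : Set (M × M)) [DSet Q]
    (hfin : {d : M | ¬ ∃ a, a < d ∧ ∃ b, d < b ∧ ∀ y, a < y → y < b → ∀ u, (u, y) ∈ Q ↔ (u, d) ∈ Q}.Finite) :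
    ∀ᶠ u in F, ∀ᶠ s in F, (u, s) ∈ Q ↔ (u, u) ∈ Q := by
  obtain ⟨H, hH, hH', rfl⟩ := hF
  obtain ⟨c, hc, hc'⟩ := hH'.fin hfin.toFinset
  refine (mem_tailF hH'.ne).2 ⟨c, hc, fun u hu hcu => ?_⟩
  refine (mem_tailF hH'.ne).2 ⟨u, hu, fun s hs hus => ?_⟩
  have hD : DSet {s | (u, s) ∈ Q} := inferInstance
  refine (conn (B := {s | (u, s) ∈ Q}) hus.le fun d hd1 hd2 => ?_).symm
  have hdH : d ∈ H := by
    rcases hd2.lt_or_eq with h | h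
    · exact hH'.low d s hs h
    · exact h ▸ hs
  have : ¬ (d ∈ hfin.toFinset) := fun h => absurd (hc' d h hdH) (not_lt.2 (hcu.le.trans hd1))
  rw [Set.Finite.mem_toFinset] at this
  have := not_not.1 this
  obtain ⟨a, ha, b, hb, h⟩ := this
  exact ⟨a, ha, b, hb, fun y h1 h2 => h y h1 h2 u⟩

theorem const_tail {F : Filter M} (hF : IsOT F) (Q : Set (M × M)) [DSet Q]
    (hfin : {d : M | ¬ ∃ a, a < d ∧ ∃ b, d < b ∧ ∀ y, a < y → y < b → ∀ u, (u, y) ∈ Q ↔ (u, d) ∈ Q}.Finite) :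
    ∀ᶠ u in F, ∀ᶠ s in F, (u, s) ∈ Q ↔ (u, u) ∈ Q := by
  rcases hF with ⟨a, rfl⟩ | hF | hF
  · simp
  · exact const_tail_L hF Q hfin
  · refine @const_tail_L M _ (swapLO M) (swapOMin M) F hF Q _ (hfin.subset ?_)
    intro d hd h
    obtain ⟨a, ha, b, hb, h⟩ := h
    exact hd ⟨b, hb, a, ha, fun y h1 h2 => h y h2 h1⟩

/-- limits of well founded preorders have maxima -/
theorem lim_max {F : Filter M} (hF : IsOT F) {T : Type u} {dT : DTy T M} (hT : Pow M T dT) :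
    ∀ (R : Set (M × (T × T))) [DSet R],
    (∀ y s z, (y, (s, z)) ∈ R ∨ (y, (z, s)) ∈ R) →
    (∀ y s z w, (y, (s, z)) ∈ R → (y, (z, w)) ∈ R → (y, (s, w)) ∈ R) →
    (∀ y (E : Set T), DSet E → E.Nonempty → ∃ m ∈ E, ∀ z ∈ E, (y, (z, m)) ∈ R) →
    (∀ y (E : Set T), DSet E → E.Nonempty → ∃ m ∈ E, ∀ z ∈ E, (y, (m, z)) ∈ R) →
    ∀ E : Set T, DSet E → E.Nonempty → ∃ m ∈ E, ∀ z ∈ E, ∀ᶠ y in F, (y, (z, m)) ∈ R := by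
  induction hT with
  | zero =>
    intro R hR h1 h2 h3 h4 E hE hne
    obtain ⟨m, hm⟩ := hne
    refine ⟨m, hm, fun z hz => Filter.Eventually.of_forall fun y => ?_⟩
    exact (h1 y m m).elim id id
  | @succ T dT hT ih =>
    intro R hR hto htr hmx hmn E hE hne
    have hTne : Nonempty T := hT.ne
    have hNB := hF.neBot
    -- the limit preorder
    let R0 : Set ((M × T) × (M × T)) := {p | {y | (p, y) ∈ {q : ((M × T) × (M × T)) × M | (q.2, (q.1.1, q.1.2)) ∈ R}} ∈ F}
    have hR0 : DSet R0 := hF.dk {q : ((M × T) × (M × T)) × M | (q.2, (q.1.1, q.1.2)) ∈ R}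
    have hR0' : ∀ s z, (s, z) ∈ R0 ↔ ∀ᶠ y in F, (y, (s, z)) ∈ R := fun s z => Iff.rfl
    have t0 : ∀ s z, (s, z) ∈ R0 ∨ (z, s) ∈ R0 := by
      intro s z
      have hD : DSet {y | (y, (s, z)) ∈ R} := inferInstance
      rcases hF.dec {y | (y, (s, z)) ∈ R} with h | h
      · exact Or.inl h
      · right
        refine Filter.mem_of_superset h fun y hy => (hto y z s).resolve_right hy
    have tr0 : ∀ s z w, (s, z) ∈ R0 → (z, w) ∈ R0 → (s, w) ∈ R0 := by
      intro s z w h1 h2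
      exact Filter.mem_of_superset (Filter.inter_mem h1 h2) fun y hy => htr y s z w hy.1 hy.2
    have re0 : ∀ s, (s, s) ∈ R0 := fun s => (t0 s s).elim id id
    -- maxima in the fibres
    have fib : ∀ s, (∃ t, (s, t) ∈ E) → ∃ t, (s, t) ∈ E ∧ ∀ t', (s, t') ∈ E → ((s, t'), (s, t)) ∈ R0 := by
      intro s hs
      have dR : DSet {p : M × (T × T) | (p.1, ((s, p.2.1), (s, p.2.2))) ∈ R} := inferInstance
      have dE : DSet {t : T | (s, t) ∈ E} := inferInstance
      have dE2 : ∀ E : Set T, DSet E → DSet {p : M × T | p.1 = s ∧ p.2 ∈ E} := fun E hE => inferInstance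
      obtain ⟨m, hm, hm'⟩ := ih {p : M × (T × T) | (p.1, ((s, p.2.1), (s, p.2.2))) ∈ R}
        (fun y a b => hto y _ _) (fun y a b c => htr y _ _ _)
        (fun y E' hE' hne' => by
          obtain ⟨t, ht⟩ := hne'
          obtain ⟨⟨s', m⟩, hm, hm'⟩ := hmx y _ (dE2 E' hE') ⟨(s, t), rfl, ht⟩
          obtain rfl : s' = s := hm.1
          exact ⟨m, hm.2, fun z hz => hm' (s', z) ⟨rfl, hz⟩⟩)
        (fun y E' hE' hne' => by
          obtain ⟨t, ht⟩ := hne'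
          obtain ⟨⟨s', m⟩, hm, hm'⟩ := hmn y _ (dE2 E' hE') ⟨(s, t), rfl, ht⟩
          obtain rfl : s' = s := hm.1
          exact ⟨m, hm.2, fun z hz => hm' (s', z) ⟨rfl, hz⟩⟩)
        {t : T | (s, t) ∈ E} dE hs
      exact ⟨m, hm, fun t' ht' => hm' t' ht'⟩
    let T1 : Set M := {s | ∃ t, (s, t) ∈ E}
    have dT1 : DSet T1 := by
      have : DSet {s : M | ∃ t, (s, t) ∈ E} := inferInstance
      exact this
    let Le : Set (M × M) := {p | ∀ t, (p.1, t) ∈ E → ∃ t', (p.2, t') ∈ E ∧ ((p.1, t), (p.2, t')) ∈ R0}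
    have dLe : DSet Le := by
      have : DSet {p : M × M | ∀ t, (p.1, t) ∈ E → ∃ t', (p.2, t') ∈ E ∧ ((p.1, t), (p.2, t')) ∈ R0} := inferInstance
      exact this
    have tL : ∀ s z, s ∈ T1 → (s, z) ∈ Le ∨ (z, s) ∈ Le := by
      intro s z ⟨t0', ht0⟩
      by_cases h : (s, z) ∈ Le
      · exact Or.inl h
      · right
        have h : ¬ ∀ t, (s, t) ∈ E → ∃ t', (z, t') ∈ E ∧ ((s, t), (z, t')) ∈ R0 := h
        push Not at h
        obtain ⟨t, ht, h⟩ := h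
        exact fun t' ht' => ⟨t, ht, (t0 _ _).resolve_left (h t' ht')⟩
    have trL : ∀ s z w, (s, z) ∈ Le → (z, w) ∈ Le → (s, w) ∈ Le := by
      intro s z w h1 h2 t ht
      obtain ⟨t', ht', h3⟩ := h1 t ht
      obtain ⟨t2, ht2, h4⟩ := h2 t' ht'
      exact ⟨t2, ht2, tr0 _ _ _ h3 h4⟩
    by_cases hm : ∃ m ∈ T1, ∀ s ∈ T1, (s, m) ∈ Le
    · obtain ⟨m, hm, hm'⟩ := hm
      obtain ⟨t, ht, ht'⟩ := fib m hm
      refine ⟨(m, t), ht, ?_⟩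
      rintro ⟨s, t2⟩ hst
      obtain ⟨t3, ht3, h⟩ := hm' s ⟨t2, hst⟩ t2 hst
      exact (hR0' _ _).1 (tr0 _ _ _ h (ht' t3 ht3))
    exfalso
    push Not at hm
    obtain ⟨⟨s0, t00⟩, hst0⟩ := hne
    have hs0 : s0 ∈ T1 := ⟨t00, hst0⟩
    obtain ⟨K, hK, -, hK'⟩ : ∃ K : M → Filter M, (∀ x, IsOT (K x)) ∧ DK K ∧
        ∀ x u, {y | ((x, u), y) ∈ {p : (M × M) × M | p.2 ∈ T1 ∧ (p.1.2 ∈ T1 → (p.1.2, p.2) ∈ Le)}} ∈ K x := by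
      have : DSet {p : (M × M) × M | p.2 ∈ T1 ∧ (p.1.2 ∈ T1 → (p.1.2, p.2) ∈ Le)} := inferInstance
      refine select {p : (M × M) × M | p.2 ∈ T1 ∧ (p.1.2 ∈ T1 → (p.1.2, p.2) ∈ Le)} ?_ ?_
      · intro x u
        by_cases hu : u ∈ T1
        · exact ⟨u, hu, fun _ => (tL u u hu).elim id id⟩
        · exact ⟨s0, hs0, fun h => absurd h hu⟩
      · intro x u v
        by_cases hu : u ∈ T1
        · by_cases hv : v ∈ T1
          · rcases tL u v hu with h | h
            · exact ⟨v, fun y hy => ⟨⟨hy.1, fun _ => trL _ _ _ h (hy.2 hv)⟩, hy⟩⟩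
            · exact ⟨u, fun y hy => ⟨hy, ⟨hy.1, fun _ => trL _ _ _ h (hy.2 hu)⟩⟩⟩
          · exact ⟨u, fun y hy => ⟨hy, ⟨hy.1, fun h => absurd h hv⟩⟩⟩
        · exact ⟨v, fun y hy => ⟨⟨hy.1, fun h => absurd h hu⟩, hy⟩⟩
    have hκ := hK s0
    have hNB' := hκ.neBot
    have κ1 : T1 ∈ K s0 := Filter.mem_of_superset (hK' s0 s0) fun y hy => hy.1
    have κ2 : ∀ u ∈ T1, ∀ᶠ s in K s0, (s, u) ∉ Le := by
      intro u hu
      obtain ⟨s, hs, hsu⟩ := hm u hu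
      exact Filter.mem_of_superset (hK' s0 s) fun y hy hyu => hsu (trL _ _ _ (hy.2 hs) hyu)
    let Q : Set (M × M) := {p | p.1 ∈ T1 ∧ p.2 ∈ T1 ∧ (p.2, p.1) ∈ Le}
    have dQ : DSet Q := by
      have : DSet {p : M × M | p.1 ∈ T1 ∧ p.2 ∈ T1 ∧ (p.2, p.1) ∈ Le} := inferInstance
      exact this
    let Loc : Set M := {d | ∃ a, a < d ∧ ∃ b, d < b ∧ ∀ y, a < y → y < b → ∀ u, (u, y) ∈ Q ↔ (u, d) ∈ Q}
    have dLoc : DSet Loc := by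
      have : DSet {d : M | ∃ a, a < d ∧ ∃ b, d < b ∧ ∀ y, a < y → y < b → ∀ u, (u, y) ∈ Q ↔ (u, d) ∈ Q} := inferInstance
      exact this
    have hinf : (T1 ∩ Locᶜ).Infinite := by
      intro hfin
      have : {d | ¬ d ∈ Loc}.Finite := by
        refine (hfin.union (bdry_finite T1)).subset fun d hd => ?_
        by_cases hd1 : d ∈ T1
        · exact Or.inl ⟨hd1, hd⟩
        · right
          intro hLC
          obtain ⟨a, ha, b, hb, h⟩ := hLC
          refine hd ⟨a, ha, b, hb, fun y h1 h2 u => ?_⟩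
          constructor
          · intro hq; exact absurd ((h y h1 h2).1 hq.2.1) hd1
          · intro hq; exact absurd hq.2.1 hd1
      have ev := const_tail hκ Q this
      obtain ⟨u, hu, hu'⟩ := (ev.and κ1).exists
      obtain ⟨s, hs, hs'⟩ := (hu.and (κ2 u hu')).exists
      exact hs' (hs.2 ⟨hu', hu', (tL u u hu').elim id id⟩).2.2
    obtain ⟨a, b, hab, hsub⟩ := inf_interval hinf
    have dEm : DSet {p : M × T | (p.1, p.2) ∈ E ∧ ∀ t', (p.1, t') ∈ E → ((p.1, t'), (p.1, p.2)) ∈ R0} := inferInstance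
    obtain ⟨c, d, hcd, hsub', e, he, he'⟩ := Sel hT
      {p : M × T | (p.1, p.2) ∈ E ∧ ∀ t', (p.1, t') ∈ E → ((p.1, t'), (p.1, p.2)) ∈ R0} hab
      fun s h1 h2 => fib s (hsub ⟨h1, h2⟩).1
    have hee : ∀ {T' : Type u} [DTy T' M] (g : T' → M) [DFn g], DFn (fun x => e (g x)) :=
      fun g => DFn.comp he ‹_›
    -- pulled back preorders
    let ρ : Set (M × (M × M)) := {p | (p.1, ((p.2.1, e p.2.1), (p.2.2, e p.2.2))) ∈ R}
    have dρ : DSet ρ := by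
      have : DSet {p : M × (M × M) | (p.1, ((p.2.1, e p.2.1), (p.2.2, e p.2.2))) ∈ R} := inferInstance
      exact this
    let P : Set (M × M) := {p | (c < p.2 ∧ p.2 < d) ∧ ¬ ∃ a, a < p.2 ∧ ∃ b, p.2 < b ∧ ∀ z, a < z → z < b →
      (p.1, (p.2, z)) ∈ ρ ∧ (p.1, (z, p.2)) ∈ ρ}
    have dP : DSet P := by
      have : DSet {p : M × M | (c < p.2 ∧ p.2 < d) ∧ ¬ ∃ a, a < p.2 ∧ ∃ b, p.2 < b ∧ ∀ z, a < z → z < b →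
        (p.1, (p.2, z)) ∈ ρ ∧ (p.1, (z, p.2)) ∈ ρ} := inferInstance
      exact this
    have hPfin : ∀ y, {s | (y, s) ∈ P}.Finite := by
      intro y
      by_contra hin
      have dPy : DSet {s | (y, s) ∈ P} := inferInstance
      obtain ⟨a', b', hab', hs'⟩ := inf_interval hin
      have dρy : DSet {p : M × M | (y, (p.1, p.2)) ∈ ρ} := inferInstance
      have dI : ∀ c' d' : M, DSet {p : M × T | (c' < p.1 ∧ p.1 < d') ∧ p.2 = e p.1} := fun c' d' => inferInstance
      have nI : ∀ c' d' : M, c' < d' → {p : M × T | (c' < p.1 ∧ p.1 < d') ∧ p.2 = e p.1}.Nonempty := by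
        intro c' d' h
        obtain ⟨x, h1, h2⟩ := exists_between h
        exact ⟨(x, e x), ⟨h1, h2⟩, rfl⟩
      obtain ⟨s, hs, h⟩ := locconst {p : M × M | (y, (p.1, p.2)) ∈ ρ} hab'
        (fun s => (hto y _ _).elim id id)
        (fun c' d' h1 h2 => by
          obtain ⟨⟨m, _⟩, ⟨hm1, hm2⟩, hm'⟩ := hmx y _ (dI c' d') (nI c' d' h1)
          refine ⟨m, hm1, fun z hz => ?_⟩
          have := hm' (z, e z) ⟨hz, rfl⟩
          simp only at hm2
          subst hm2
          exact this)
        (fun c' d' h1 h2 => by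
          obtain ⟨⟨m, _⟩, ⟨hm1, hm2⟩, hm'⟩ := hmn y _ (dI c' d') (nI c' d' h1)
          refine ⟨m, hm1, fun z hz => ?_⟩
          have := hm' (z, e z) ⟨hz, rfl⟩
          simp only at hm2
          subst hm2
          exact this)
      exact (hs' hs).2 h
    obtain ⟨c2, d2, hcd2, hsub2, hav⟩ := hF.avoid P hPfin hcd
    have hJ : ∀ s z, c2 < s → s < d2 → c2 < z → z < d2 → ((s, e s), (z, e z)) ∈ R0 := by
      intro s z k1 k2 k3 k4
      rw [hR0']
      filter_upwards [hav] with y hy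
      have hy' : ∀ x ∈ Ioo c2 d2, ∃ a, a < x ∧ ∃ b, x < b ∧ ∀ z, a < z → z < b →
          (y, (x, z)) ∈ ρ ∧ (y, (z, x)) ∈ ρ := by
        intro x hx
        by_contra hcon
        exact hy x hx ⟨hsub2 hx, hcon⟩
      have dB : DSet {x | (y, (s, x)) ∈ ρ} := inferInstance
      have hLC : ∀ x ∈ Ioo c2 d2, LC {x | (y, (s, x)) ∈ ρ} x := by
        intro x hx
        obtain ⟨a, ha, b, hb, h⟩ := hy' x hx
        refine ⟨a, ha, b, hb, fun w w1 w2 => ?_⟩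
        constructor
        · intro h'; exact htr y _ _ _ h' (h w w1 w2).2
        · intro h'; exact htr y _ _ _ h' (h w w1 w2).1
      have hss : s ∈ {x | (y, (s, x)) ∈ ρ} := (hto y _ _).elim id id
      rcases le_total s z with h | h
      · exact (conn h fun d h1 h2 => hLC d ⟨k1.trans_le h1, h2.trans_lt k4⟩).1 hss
      · exact (conn h fun d h1 h2 => hLC d ⟨k3.trans_le h1, h2.trans_lt k2⟩).2 hss
    have hJL : ∀ s z, c2 < s → s < d2 → c2 < z → z < d2 → (s, z) ∈ Le := by
      intro s z k1 k2 k3 k4 t ht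
      have q1 := he' s (hsub2 ⟨k1, k2⟩).1 (hsub2 ⟨k1, k2⟩).2
      have q2 := he' z (hsub2 ⟨k3, k4⟩).1 (hsub2 ⟨k3, k4⟩).2
      exact ⟨e z, q2.1, tr0 _ _ _ (q1.2 t ht) (hJ s z k1 k2 k3 k4)⟩
    obtain ⟨s, k1, k2⟩ := exists_between hcd2
    refine (hsub (hsub' (hsub2 ⟨k1, k2⟩))).2 ⟨c2, k1, d2, k2, fun z k3 k4 u => ?_⟩
    have hs1 : s ∈ T1 := (hsub (hsub' (hsub2 ⟨k1, k2⟩))).1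
    have hz1 : z ∈ T1 := (hsub (hsub' (hsub2 ⟨k3, k4⟩))).1
    constructor
    · intro h
      exact ⟨h.1, hs1, trL _ _ _ (hJL s z k1 k2 k3 k4) h.2.2⟩
    · intro h
      exact ⟨h.1, hz1, trL _ _ _ (hJL z s k3 k4 k1 k2) h.2.2⟩

end
end OM

namespace OM
universe u
set_option synthInstance.maxSize 5000
set_option synthInstance.maxHeartbeats 400000
set_option maxHeartbeats 1000000
set_option linter.unusedSectionVars false
section
variable {M : Type u} [DS M] [LinearOrder M] [OMin M]

/-- well founded total preorders -/
structure WFR {T : Type u} [DTy T M] (r : Set (T × T)) : Prop where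
  total : ∀ s z, (s, z) ∈ r ∨ (z, s) ∈ r
  trans : ∀ s z w, (s, z) ∈ r → (z, w) ∈ r → (s, w) ∈ r
  max : ∀ E : Set T, DSet E → E.Nonempty → ∃ m ∈ E, ∀ z ∈ E, (z, m) ∈ r
  min : ∀ E : Set T, DSet E → E.Nonempty → ∃ m ∈ E, ∀ z ∈ E, (m, z) ∈ r

theorem lim_wf {F : Filter M} (hF : IsOT F) {T : Type u} {dT : DTy T M} (hT : Pow M T dT)
    (R : Set (M × (T × T))) (hR : DSet R) (h : ∀ y, WFR {p | (y, p) ∈ R}) :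
    WFR {p | ∀ᶠ y in F, (y, p) ∈ R} := by
  refine ⟨fun s z => ?_, fun s z w h1 h2 => ?_, ?_, ?_⟩
  · have hD : DSet {y | (y, (s, z)) ∈ R} := inferInstance
    rcases hF.dec {y | (y, (s, z)) ∈ R} with h' | h'
    · exact Or.inl h'
    · right
      exact Filter.mem_of_superset h' fun y hy => ((h y).total z s).resolve_right hy
  · exact Filter.mem_of_superset (Filter.inter_mem h1 h2) fun y hy => (h y).trans s z w hy.1 hy.2
  · exact lim_max hF hT R (fun y => (h y).total) (fun y => (h y).trans) (fun y => (h y).max) (fun y => (h y).min)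
  · have hD : DSet {p : M × (T × T) | (p.1, (p.2.2, p.2.1)) ∈ R} := inferInstance
    exact lim_max hF hT {p : M × (T × T) | (p.1, (p.2.2, p.2.1)) ∈ R} (fun y s z => (h y).total z s)
      (fun y s z w h1 h2 => (h y).trans w z s h2 h1) (fun y => (h y).min) (fun y => (h y).max)

/-- limits exist along the kernel -/
def LimP {T S Z : Type u} [DTy T M] [DTy S M] [DTy Z M] (X : Set Z) (Cl : Set (Set Z)) (K : T → Filter S) : Prop :=
  ∀ {U : Type u} [DTy U M] (g : (U × T) × S → Z), DFn g → (∀ p, g p ∈ X) →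
    ∃ g' : U × T → Z, DFn g' ∧ (∀ p, g' p ∈ X) ∧
      ∀ p, ∀ C ∈ Cl, (∀ᶠ y in K p.2, g (p, y) ∈ C) → g' p ∈ C

/-- good definable kernels -/
structure Good {Z : Type u} [DTy Z M] (X : Set Z) (Cl : Set (Set Z)) {T S : Type u} [DTy T M] [DTy S M]
    (K : T → Filter S) : Prop where
  nb : ∀ x, (K x).NeBot
  dec : ∀ x, ∀ A : Set S, DSet A → A ∈ K x ∨ Aᶜ ∈ K x
  dk : DK K
  wf : ∀ x, ∀ {T' : Type u} {dT' : DTy T' M}, Pow M T' dT' → ∀ R : Set (S × (T' × T')), DSet R →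
    (∀ y, WFR {p | (y, p) ∈ R}) → WFR {p | ∀ᶠ y in K x, (y, p) ∈ R}
  lim : LimP X Cl K

variable {Z : Type u} [DTy Z M] {X : Set Z} {Cl : Set (Set Z)}
  {T S S' U : Type u} [DTy T M] [DTy S M] [DTy S' M] [DTy U M]

theorem Good.one {K : T → Filter M} (h1 : ∀ x, IsOT (K x)) (h2 : DK K) (h3 : LimP X Cl K) :
    Good X Cl K :=
  ⟨fun x => (h1 x).neBot, fun x A _ => (h1 x).dec A, h2, fun x => fun hT' R hR h => lim_wf (h1 x) hT' R hR h, h3⟩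

theorem Good.pure {f : T → S} (hf : DFn f) : Good X Cl (fun x => (Pure.pure (f x) : Filter S)) := by
  have hf' : ∀ {T' : Type u} [DTy T' M] (g : T' → T) [DFn g], DFn (fun x => f (g x)) :=
      fun g => DFn.comp hf ‹_›
  refine ⟨fun x => inferInstance, fun x A _ => ?_, ?_, fun x T' dT' hT' R hR h => ?_, ?_⟩
  · simp only [Filter.mem_pure]; exact em _
  · intro U _ R hR
    have : DSet {p : U × T | (p, f p.2) ∈ R} := inferInstance
    simpa using this
  · simpa using h (f x)
  · intro U _ g hg hgX
    refine ⟨fun p => g (p, f p.2), DFn.comp hg inferInstance, fun p => hgX _, fun p C hC h => ?_⟩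
    simpa using h

theorem Good.map {K : T → Filter S} (hK : Good X Cl K) {f : T × S → S'} (hf : DFn f) :
    Good X Cl (fun x => (K x).map fun y => f (x, y)) := by
  have hf' : ∀ {T' : Type u} [DTy T' M] (g : T' → T × S) [DFn g], DFn (fun x => f (g x)) :=
      fun g => DFn.comp hf ‹_›
  refine ⟨fun x => (hK.nb x).map _, fun x A hA => ?_, ?_, fun x T' dT' hT' R hR h => ?_, ?_⟩
  · have : DSet {y : S | f (x, y) ∈ A} := inferInstance
    exact hK.dec x _ this
  · intro U _ R hR
    have : DSet {p : (U × T) × S | (p.1, f (p.1.2, p.2)) ∈ R} := inferInstance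
    exact hK.dk _ this
  · have : DSet {p : S × (T' × T') | (f (x, p.1), p.2) ∈ R} := inferInstance
    exact hK.wf x hT' _ this fun y => h (f (x, y))
  · intro U _ g hg hgX
    obtain ⟨g', h1, h2, h3⟩ := hK.lim (fun p : (U × T) × S => g (p.1, f (p.1.2, p.2)))
      (DFn.comp hg inferInstance) fun p => hgX _
    exact ⟨g', h1, h2, fun p C hC h => h3 p C hC h⟩

theorem Good.bind {K : T → Filter S} (hK : Good X Cl K) {K' : T × S → Filter S'} (hK' : Good X Cl K') :
    Good X Cl (fun x => (K x).bind fun y => K' (x, y)) := by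
  refine ⟨fun x => ?_, fun x A hA => ?_, ?_, fun x T' dT' hT' R hR h => ?_, ?_⟩
  · have := hK.nb x
    constructor
    intro h
    have h' : ∅ ∈ (K x).bind fun y => K' (x, y) := by rw [h]; trivial
    rw [Filter.mem_bind'] at h'
    obtain ⟨y, hy⟩ := (K x).nonempty_of_mem h'
    exact (hK'.nb (x, y)).ne (Filter.empty_mem_iff_bot.1 hy)
  · have hD : DSet {p : (T × (T × S)) × S' | p.2 ∈ A} := inferInstance
    have h1 : DSet {p : T × (T × S) | ∀ᶠ y in K' p.2, y ∈ A} := hK'.dk _ hD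
    have h2 : DSet {y : S | (x, (x, y)) ∈ {p : T × (T × S) | ∀ᶠ y in K' p.2, y ∈ A}} := inferInstance
    rcases hK.dec x _ h2 with h | h
    · exact Or.inl h
    · right
      rw [Filter.mem_bind']
      exact Filter.mem_of_superset h fun y hy => (hK'.dec (x, y) A hA).resolve_left hy
  · intro U _ R hR
    have hD : DSet {p : (U × (T × S)) × S' | ((p.1.1, p.1.2.1), p.2) ∈ R} := inferInstance
    have h1 : DSet {p : U × (T × S) | ∀ᶠ y in K' p.2, ((p.1, p.2.1), y) ∈ R} := hK'.dk _ hD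
    have h2 : DSet {p : (U × T) × S | (p.1.1, (p.1.2, p.2)) ∈ {p : U × (T × S) | ∀ᶠ y in K' p.2, ((p.1, p.2.1), y) ∈ R}} := inferInstance
    exact hK.dk _ h2
  · have hD : DSet {p : ((T' × T') × (T × S)) × S' | (p.2, p.1.1) ∈ R} := inferInstance
    have h1 : DSet {p : (T' × T') × (T × S) | ∀ᶠ y in K' p.2, (y, p.1) ∈ R} := hK'.dk _ hD
    have h2 : DSet {p : S × (T' × T') | (p.2, (x, p.1)) ∈ {p : (T' × T') × (T × S) | ∀ᶠ y in K' p.2, (y, p.1) ∈ R}} := inferInstance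
    exact hK.wf x hT' _ h2 fun y => hK'.wf (x, y) hT' R hR h
  · intro U _ g hg hgX
    obtain ⟨g1, h1, h2, h3⟩ := hK'.lim (fun p : (U × (T × S)) × S' => g ((p.1.1, p.1.2.1), p.2))
      (DFn.comp hg inferInstance) fun p => hgX _
    obtain ⟨g', h4, h5, h6⟩ := hK.lim (fun p : (U × T) × S => g1 (p.1.1, (p.1.2, p.2)))
      (DFn.comp h1 inferInstance) fun p => h2 _
    refine ⟨g', h4, h5, fun p C hC h => h6 p C hC ?_⟩
    exact Filter.mem_of_superset h fun y hy => h3 (p.1, (p.2, y)) C hC hy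

theorem Good.comp {K : T → Filter S} (hK : Good X Cl K) {h : U → T} (hh : DFn h) :
    Good X Cl (fun x => K (h x)) := by
  have hf' : ∀ {T' : Type u} [DTy T' M] (g : T' → U) [DFn g], DFn (fun x => h (g x)) :=
      fun g => DFn.comp hh ‹_›
  refine ⟨fun x => hK.nb _, fun x A hA => hK.dec _ A hA, ?_, fun x T' dT' hT' => hK.wf _ hT', ?_⟩
  · intro V _ R hR
    have hD : DSet {p : ((V × U) × T) × S | (p.1.1, p.2) ∈ R} := inferInstance
    have h1 : DSet {p : (V × U) × T | ∀ᶠ y in K p.2, (p.1, y) ∈ R} := hK.dk _ hD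
    have h2 : DSet {p : V × U | (p, h p.2) ∈ {p : (V × U) × T | ∀ᶠ y in K p.2, (p.1, y) ∈ R}} := inferInstance
    exact h2
  · intro V _ g hg hgX
    obtain ⟨g', h4, h5, h6⟩ := hK.lim (fun p : ((V × U) × T) × S => g (p.1.1, p.2))
      (DFn.comp hg inferInstance) fun p => hgX _
    exact ⟨fun p => g' (p, h p.2), DFn.comp h4 inferInstance, fun p => h5 _, fun p C hC h' => h6 (p, h p.2) C hC h'⟩

theorem TP (hLim : ∀ {T : Type u} [DTy T M] (K : T → Filter M), (∀ x, IsOT (K x)) → DK K → LimP X Cl K)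
    {W : Type u} {dW : DTy W M} (hW : Pow M W dW) : ∀ {T : Type u} [DTy T M]
    (R : Set (T × (W × W))) [DSet R], (∀ x s z, (x, (s, z)) ∈ R ∨ (x, (z, s)) ∈ R) →
    (∀ x s z w, (x, (s, z)) ∈ R → (x, (z, w)) ∈ R → (x, (s, w)) ∈ R) →
    ∃ G : T → Filter W, Good X Cl G ∧ ∀ x u, ∀ᶠ w in G x, (x, (u, w)) ∈ R := by
  induction hW with
  | zero =>
    intro T _ R hR hto htr
    let _ : DTy PUnit.{u+1} M := punitDTy
    refine ⟨fun _ => Pure.pure PUnit.unit, Good.pure (DFn.const' _), fun x u => ?_⟩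
    exact (hto x u u).elim id id
  | @succ W dW hW ih =>
    intro T _ R hR hto htr
    have hWne : Nonempty W := hW.ne
    have dE : DSet {p : (T × (M × W)) × M | ∃ w', (p.1.1, (p.1.2, (p.2, w'))) ∈ R} := inferInstance
    obtain ⟨K, hK, hK1, hK2⟩ := select {p : (T × (M × W)) × M | ∃ w', (p.1.1, (p.1.2, (p.2, w'))) ∈ R}
      (fun x u => ⟨u.1, u.2, (hto x u u).elim id id⟩)
      (fun x u v => by
        rcases hto x u v with h | h
        · exact ⟨v, fun y ⟨w, hw⟩ => ⟨⟨w, htr _ _ _ _ h hw⟩, ⟨w, hw⟩⟩⟩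
        · exact ⟨u, fun y ⟨w, hw⟩ => ⟨⟨w, hw⟩, ⟨w, htr _ _ _ _ h hw⟩⟩⟩)
    have dR2 : DSet {p : (T × M) × (W × W) | (p.1.1, ((p.1.2, p.2.1), (p.1.2, p.2.2))) ∈ R} := inferInstance
    obtain ⟨G, hG, hG'⟩ := ih {p : (T × M) × (W × W) | (p.1.1, ((p.1.2, p.2.1), (p.1.2, p.2.2))) ∈ R}
      (fun x s z => hto _ _ _) (fun x s z w => htr _ _ _ _)
    have hK3 : Good X Cl K := Good.one hK hK1 (hLim K hK hK1)
    have df : DFn (fun p : (T × M) × W => (p.1.2, p.2)) := inferInstance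
    refine ⟨_, hK3.bind (hG.map df), fun x u => ?_⟩
    refine Filter.mem_bind'.2 (Filter.mem_of_superset (hK2 x u) fun t ht => ?_)
    obtain ⟨w0, hw0⟩ := ht
    exact Filter.mem_of_superset (hG' (x, t) w0) fun w hw => htr _ _ _ _ hw0 hw

theorem small {E D : Set M} (hD : D.Finite) {e1 : M} (he : e1 ∈ E) :
    ∃ e ∈ E, e ≤ e1 ∧ ∀ d ∈ D, d ≤ e → ∀ y ∈ E, d ≤ y := by
  induction D, hD using Set.Finite.induction_on with
  | empty => exact ⟨e1, he, le_rfl, by simp⟩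
  | @insert a s _ _ ih =>
    obtain ⟨e, he, h0, h⟩ := ih
    by_cases h1 : a ≤ e ∧ ∃ y ∈ E, y < a
    · obtain ⟨h1, y, hy, hya⟩ := h1
      refine ⟨y, hy, (hya.le.trans h1).trans h0, ?_⟩
      rintro d (rfl | hd) hdy
      · exact absurd hdy (not_le.2 hya)
      · exact h d hd (hdy.trans (hya.le.trans h1))
    · push Not at h1
      refine ⟨e, he, h0, ?_⟩
      rintro d (rfl | hd) hde
      · exact h1 hde
      · exact h d hd hde

theorem bdpt {B : Set M} [DSet B] {y z : M} (hyz : y ≤ z) (h : ¬ (y ∈ B ↔ z ∈ B)) :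
    ∃ d, y ≤ d ∧ d ≤ z ∧ ¬ LC B d := by
  by_contra hcon
  push Not at hcon
  exact h (conn hyz hcon)

theorem fin_contra {B E1 E2 : Set M} [DSet B] (h21 : E2 ⊆ E1) (h2B : E2 ⊆ B) (hne : E2.Nonempty)
    (low : ∀ e ∈ E1, ∃ y ∈ E1, y ≤ e ∧ y ∉ B)
    (hl1 : ∀ d, ¬ LC B d → (∀ y ∈ E2, d < y) → ∀ y ∈ E1, d < y)
    (hl2 : ∀ d, ¬ LC B d → (∀ y ∈ E2, d ≤ y) → ∀ y ∈ E1, d ≤ y) : False := by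
  obtain ⟨e1, he1⟩ := hne
  obtain ⟨e, he, -, hsm⟩ := small (bdry_finite B) he1
  by_cases h : ∃ e0 ∈ E1, ∀ y ∈ E2, e0 < y
  · obtain ⟨e0, he0, h⟩ := h
    obtain ⟨y0, hy0, hy0e, hy0B⟩ := low e0 he0
    obtain ⟨d, d1, d2, d3⟩ := bdpt (B := B) (y := y0) (z := e) (hy0e.trans (h e he).le)
      fun hh => hy0B (hh.2 (h2B he))
    have q1 := hl2 d d3 (hsm d d3 d2) y0 hy0
    obtain rfl : d = y0 := le_antisymm q1 d1
    exact lt_irrefl _ (hl1 d d3 (fun y hy => hy0e.trans_lt (h y hy)) d hy0)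
  · push Not at h
    obtain ⟨y, hy, hye, hyB⟩ := low e (h21 he)
    obtain ⟨e2, he2, he2y⟩ := h y hy
    obtain ⟨d, d1, d2, d3⟩ := bdpt (B := B) he2y fun hh => hyB (hh.1 (h2B he2))
    have q := hsm d d3 (d2.trans hye)
    have q1 := hl2 d d3 q
    obtain rfl : d = e2 := le_antisymm (q e2 he2) d1
    obtain ⟨y', hy', hy'e, hy'B⟩ := low d (h21 he2)
    have := le_antisymm hy'e (q1 y' hy')
    exact hy'B (this ▸ h2B he2)

theorem tau {E : Set (T × M)} [DSet E] (hne : ∀ x, ∃ y, (x, y) ∈ E) :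
    ∃ K : T → Filter M, (∀ x, IsOT (K x)) ∧ DK K ∧ (∀ x, {y | (x, y) ∈ E} ∈ K x) ∧
      ∀ x e, (x, e) ∈ E → {y | y ≤ e} ∈ K x := by
  have dE : DSet {p : (T × M) × M | (p.1.1, p.2) ∈ E ∧ ((p.1.1, p.1.2) ∈ E → p.2 ≤ p.1.2)} := inferInstance
  obtain ⟨K, hK, hK1, hK2⟩ := select {p : (T × M) × M | (p.1.1, p.2) ∈ E ∧ ((p.1.1, p.1.2) ∈ E → p.2 ≤ p.1.2)}
    (fun x u => by
      by_cases h : (x, u) ∈ E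
      · exact ⟨u, h, fun _ => le_rfl⟩
      · obtain ⟨y, hy⟩ := hne x
        exact ⟨y, hy, fun h' => absurd h' h⟩)
    (fun x u v => by
      by_cases hu : (x, u) ∈ E
      · by_cases hv : (x, v) ∈ E
        · rcases le_total u v with h | h
          · exact ⟨u, fun y hy => ⟨hy, ⟨hy.1, fun _ => (hy.2 hu).trans h⟩⟩⟩
          · exact ⟨v, fun y hy => ⟨⟨hy.1, fun _ => (hy.2 hv).trans h⟩, hy⟩⟩
        · exact ⟨u, fun y hy => ⟨hy, ⟨hy.1, fun h => absurd h hv⟩⟩⟩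
      · exact ⟨v, fun y hy => ⟨⟨hy.1, fun h => absurd h hu⟩, hy⟩⟩)
  obtain ⟨m⟩ : Nonempty M := OMin.ne
  exact ⟨K, hK, hK1, fun x => Filter.mem_of_superset (hK2 x m) fun y hy => hy.1,
    fun x e he => Filter.mem_of_superset (hK2 x e) fun y hy => hy.2 he⟩

end
end OM

namespace OM
universe u
set_option synthInstance.maxSize 5000
set_option synthInstance.maxHeartbeats 400000
set_option maxHeartbeats 1000000
set_option linter.unusedSectionVars false
section
variable {M : Type u} [DS M] [LinearOrder M] [OMin M]
variable {Z : Type u} [DTy Z M] {X : Set Z} {Cl : Set (Set Z)}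

theorem wf_aux {W : Type u} {dW : DTy W M} (E : W → Set M) (D : Set M) (hD : D.Finite) :
    WFR {p : W × W | ∀ d, d ∈ D → ((∀ y, y ∈ E p.1 → d < y) → (∀ y, y ∈ E p.2 → d < y)) ∧
      ((∀ y, y ∈ E p.1 → d ≤ y) → (∀ y, y ∈ E p.2 → d ≤ y))} := by
  set r : Set (W × W) := {p : W × W | ∀ d, d ∈ D → ((∀ y, y ∈ E p.1 → d < y) → (∀ y, y ∈ E p.2 → d < y)) ∧
      ((∀ y, y ∈ E p.1 → d ≤ y) → (∀ y, y ∈ E p.2 → d ≤ y))} with hr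
  have tot : ∀ s z, (s, z) ∈ r ∨ (z, s) ∈ r := by
    intro s z
    by_contra hcon
    push Not at hcon
    obtain ⟨h1, h2⟩ := hcon
    have key : ∀ s z : W, (s, z) ∉ r → ∀ z' : W, z' = z → (z', s) ∈ r := by
      intro s z h z' hz'
      subst hz'
      have h : ¬ ∀ d, d ∈ D → ((∀ y, y ∈ E s → d < y) → (∀ y, y ∈ E z' → d < y)) ∧
        ((∀ y, y ∈ E s → d ≤ y) → (∀ y, y ∈ E z' → d ≤ y)) := h
      have : ∃ d, (∃ y ∈ E z', y ≤ d) ∧ (∀ y, y ∈ E s → d ≤ y) ∧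
          ((∀ y ∈ E s, d < y) ∨ ∃ y ∈ E z', y < d) := by
        push Not at h
        obtain ⟨d, hd, h⟩ := h
        by_cases hc : (∀ y, y ∈ E s → d < y) → (∀ y, y ∈ E z' → d < y)
        · obtain ⟨h1, y, hy, h2⟩ := h hc
          exact ⟨d, ⟨y, hy, h2.le⟩, h1, Or.inr ⟨y, hy, h2⟩⟩
        · push Not at hc
          obtain ⟨h1, y, hy, h2⟩ := hc
          exact ⟨d, ⟨y, hy, h2⟩, fun y hy => (h1 y hy).le, Or.inl h1⟩
      obtain ⟨d, ⟨y0, hy0, hy0d⟩, h2, h3⟩ := this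
      intro d' hd'
      refine ⟨fun h4 y hy => ((h4 y0 hy0).trans_le hy0d).trans_le (h2 y hy),
        fun h4 y hy => ((h4 y0 hy0).trans hy0d).trans (h2 y hy)⟩
    exact h2 (key s z h1 z rfl)
  let f : W → Set M × Set M := fun w => ({d | d ∈ D ∧ ∀ y, y ∈ E w → d < y}, {d | d ∈ D ∧ ∀ y, y ∈ E w → d ≤ y})
  have hfin : ∀ A : Set W, (f '' A).Finite := by
    intro A
    refine (hD.powerset.prod hD.powerset).subset ?_
    rintro _ ⟨w, -, rfl⟩
    exact ⟨fun d hd => hd.1, fun d hd => hd.1⟩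
  have hf : ∀ s z, f s ≤ f z ↔ (s, z) ∈ r := by
    intro s z
    constructor
    · intro h d hd
      exact ⟨fun h' => (h.1 (show d ∈ (f s).1 from ⟨hd, h'⟩)).2, fun h' => (h.2 (show d ∈ (f s).2 from ⟨hd, h'⟩)).2⟩
    · intro h
      exact ⟨fun d hd => ⟨hd.1, (h d hd.1).1 hd.2⟩, fun d hd => ⟨hd.1, (h d hd.1).2 hd.2⟩⟩
  refine ⟨tot, fun s z w h1 h2 => ?_, fun A _ hne => ?_, fun A _ hne => ?_⟩
  · exact (hf s w).1 (((hf s z).2 h1).trans ((hf z w).2 h2))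
  · obtain ⟨_, ⟨m, hm, rfl⟩, h⟩ := (hfin A).exists_maximal (hne.image f)
    refine ⟨m, hm, fun z hz => ?_⟩
    rcases tot z m with h' | h'
    · exact h'
    · exact (hf z m).1 (h ⟨z, hz, rfl⟩ ((hf m z).2 h'))
  · obtain ⟨_, ⟨m, hm, rfl⟩, h⟩ := (hfin A).exists_minimal (hne.image f)
    refine ⟨m, hm, fun z hz => ?_⟩
    rcases tot m z with h' | h'
    · exact h'
    · exact (hf m z).1 (h ⟨z, hz, rfl⟩ ((hf z m).2 h'))

theorem main_ext (hLim : ∀ {T : Type u} [DTy T M] (K : T → Filter M), (∀ x, IsOT (K x)) → DK K → LimP X Cl K)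
    {W : Type u} {dW : DTy W M} (hW : Pow M W dW)
    {T : Type u} {dT : DTy T M} (hT : Pow M T dT) :
    ∀ (A : Set (W × T)) [DSet A], (∀ w, ∃ t, (w, t) ∈ A) →
    (∀ u v, ∃ w, ∀ t, (w, t) ∈ A → (u, t) ∈ A ∧ (v, t) ∈ A) →
    ∃ F : Filter T, Good X Cl (fun _ : M => F) ∧ ∀ u, {t | (u, t) ∈ A} ∈ F := by
  obtain ⟨m⟩ : Nonempty M := OMin.ne
  induction hT with
  | zero =>
    intro A hA hne hdir
    let _ : DTy PUnit.{u+1} M := punitDTy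
    refine ⟨Pure.pure PUnit.unit, Good.pure (DFn.const' _), fun u => ?_⟩
    obtain ⟨t, ht⟩ := hne u
    exact ht
  | @succ T dT hT ih =>
    intro A hA hne hdir
    have hTne : Nonempty T := hT.ne
    have hWne : Nonempty W := hW.ne
    have dA' : DSet {p : W × T | ∃ y, (p.1, (y, p.2)) ∈ A} := inferInstance
    obtain ⟨F, hF, hFA⟩ := ih {p : W × T | ∃ y, (p.1, (y, p.2)) ∈ A}
      (fun w => by obtain ⟨⟨y, t⟩, h⟩ := hne w; exact ⟨t, y, h⟩)
      (fun u v => by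
        obtain ⟨w, hw⟩ := hdir u v
        exact ⟨w, fun t ⟨y, hy⟩ => ⟨⟨y, (hw _ hy).1⟩, ⟨y, (hw _ hy).2⟩⟩⟩)
    have hNB : F.NeBot := hF.nb m
    -- the fibre kernel
    have dE : DSet {p : (W × T) × M | (p.1.1, (p.2, p.1.2)) ∈ A ∨ ¬ ∃ y, (p.1.1, (y, p.1.2)) ∈ A} := inferInstance
    obtain ⟨τ, hτ, hτ1, hτ2, hτ3⟩ := tau (E := {p : (W × T) × M | (p.1.1, (p.2, p.1.2)) ∈ A ∨ ¬ ∃ y, (p.1.1, (y, p.1.2)) ∈ A})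
      (fun x => by
        by_cases h : ∃ y, (x.1, (y, x.2)) ∈ A
        · obtain ⟨y, hy⟩ := h
          exact ⟨y, Or.inl hy⟩
        · exact ⟨m, Or.inr h⟩)
    have gτ : Good X Cl τ := Good.one hτ hτ1 (hLim τ hτ hτ1)
    -- the preorder on parameters
    have dR1 : DSet {p : ((W × W) × M) × T | ∀ y, (p.1.1.2, (y, p.2)) ∈ A → ∃ e, (p.1.1.1, (e, p.2)) ∈ A ∧ e ≤ y} := inferInstance
    have dR2 : DSet {p : (W × W) × M | ∀ᶠ t in F, ∀ y, (p.1.2, (y, t)) ∈ A → ∃ e, (p.1.1, (e, t)) ∈ A ∧ e ≤ y} := hF.dk _ dR1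
    have dR : DSet {p : M × (W × W) | (p.2, p.1) ∈ {p : (W × W) × M | ∀ᶠ t in F, ∀ y, (p.1.2, (y, t)) ∈ A → ∃ e, (p.1.1, (e, t)) ∈ A ∧ e ≤ y}} := inferInstance
    obtain ⟨G, hG, hG'⟩ := TP hLim hW (T := M) (R := {p : M × (W × W) | (p.2, p.1) ∈ {p : (W × W) × M | ∀ᶠ t in F, ∀ y, (p.1.2, (y, t)) ∈ A → ∃ e, (p.1.1, (e, t)) ∈ A ∧ e ≤ y}})
      (by
        intro x s z
        have hD : DSet {t : T | ∀ y, (z, (y, t)) ∈ A → ∃ e, (s, (e, t)) ∈ A ∧ e ≤ y} := inferInstance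
        rcases hF.dec m _ hD with h | h
        · exact Or.inl h
        · right
          refine Filter.mem_of_superset h fun t ht y hy => ?_
          have ht : ¬ ∀ y, (z, (y, t)) ∈ A → ∃ e, (s, (e, t)) ∈ A ∧ e ≤ y := ht
          push Not at ht
          obtain ⟨e, he, h'⟩ := ht
          exact ⟨e, he, (h' y hy).le⟩)
      (by
        intro x s z w h1 h2
        refine Filter.mem_of_superset (Filter.inter_mem h1 h2) fun t ht y hy => ?_
        obtain ⟨e, he, h3⟩ := ht.2 y hy
        obtain ⟨e', he', h4⟩ := ht.1 e he
        exact ⟨e', he', h4.trans h3⟩)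
    have gF : Good X Cl (fun _ : W => F) := hF.comp (h := fun _ : W => m) inferInstance
    have df : DFn (fun p : (W × T) × M => (p.2, p.1.2)) := inferInstance
    have gZ1 := gF.bind (gτ.map df)
    have gZ2 := hG.bind (gZ1.comp (h := fun p : M × W => p.2) inferInstance)
    have gZ := gZ2.comp (h := fun _ : M => m) inferInstance
    refine ⟨_, gZ, fun v => ?_⟩
    have dAv : DSet {t : M × T | (v, t) ∈ A} := inferInstance
    rcases gZ.dec m _ dAv with h | h
    · exact h
    exfalso
    have h : ∀ᶠ w in G m, ∀ᶠ t in F, ∀ᶠ y in τ (w, t), (v, (y, t)) ∉ A := h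
    -- the limit of the finite preorders
    have dR3 : DSet {p : T × (W × W) | ∀ d, (¬ ∃ a, a < d ∧ ∃ b, d < b ∧ ∀ y, a < y → y < b → ((v, (y, p.1)) ∈ A ↔ (v, (d, p.1)) ∈ A)) →
        ((∀ y, (p.2.1, (y, p.1)) ∈ A → d < y) → (∀ y, (p.2.2, (y, p.1)) ∈ A → d < y)) ∧
        ((∀ y, (p.2.1, (y, p.1)) ∈ A → d ≤ y) → (∀ y, (p.2.2, (y, p.1)) ∈ A → d ≤ y))} := inferInstance
    have wf := hF.wf m hW _ dR3 (fun t => by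
      have dB : DSet {y : M | (v, (y, t)) ∈ A} := inferInstance
      exact wf_aux (fun w => {y : M | (w, (y, t)) ∈ A}) {d | ¬ LC {y : M | (v, (y, t)) ∈ A} d} (bdry_finite _))
    obtain ⟨w0, -, hw0⟩ := wf.max Set.univ inferInstance Set.univ_nonempty
    have hNG : (G m).NeBot := hG.nb m
    obtain ⟨w1, hw1, hw01⟩ := (h.and (hG' m w0)).exists
    obtain ⟨w2, hw2⟩ := hdir v w1
    have hw20 := hw0 w2 trivial
    have hw01 : ∀ᶠ t in F, ∀ y, (w1, (y, t)) ∈ A → ∃ e, (w0, (e, t)) ∈ A ∧ e ≤ y := hw01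
    obtain ⟨t, ⟨⟨q1, q2⟩, q3⟩, q4⟩ := (((hw1.and hw01).and hw20).and (hFA w2)).exists
    have dB : DSet {y : M | (v, (y, t)) ∈ A} := inferInstance
    refine fin_contra (B := {y : M | (v, (y, t)) ∈ A}) (E1 := {y : M | (w1, (y, t)) ∈ A})
      (E2 := {y : M | (w2, (y, t)) ∈ A}) (fun y hy => (hw2 _ hy).2) (fun y hy => (hw2 _ hy).1) q4 ?_ ?_ ?_
    · intro e he
      have := (hτ (w1, t)).neBot
      obtain ⟨y, ⟨y1, y2⟩, y3⟩ := ((q1.and (hτ2 (w1, t))).and (hτ3 (w1, t) e (Or.inl he))).exists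
      refine ⟨y, ?_, y3, y1⟩
      rcases y2 with y2 | y2
      · exact y2
      · exact absurd ⟨e, he⟩ y2
    · intro d hd h' y hy
      obtain ⟨e, he, hey⟩ := q2 y hy
      exact ((q3 d hd).1 h' e he).trans_le hey
    · intro d hd h' y hy
      obtain ⟨e, he, hey⟩ := q2 y hy
      exact ((q3 d hd).2 h' e he).trans hey

end
end OM

namespace OM
universe u
set_option synthInstance.maxSize 5000
set_option synthInstance.maxHeartbeats 400000
set_option maxHeartbeats 1000000
set_option linter.unusedSectionVars false

section
variable {M : Type u} [DS M] [LinearOrder M] [OMin M]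
variable {Z P : Type u} [DTy Z M] [DTy P M] {X : Set Z} {Cl : Set (Set Z)} {Ω : Set P} {Dp : Set (P × Z)}

/-- definable limits along kernels of one-types -/
theorem limP_of (dX : DSet X) (dΩ : DSet Ω) (dDp : DSet Dp)
    (conv : ∀ F : Filter M, IsOT F → ∀ g : M → Z, DFn g → (∀ y, g y ∈ X) →
      ∃ z ∈ X, ∀ u ∈ Ω, (u, z) ∈ Dp → ∀ᶠ y in F, (u, g y) ∈ Dp)
    (clo : ∀ C ∈ Cl, ∀ z ∈ X, z ∉ C → ∃ u ∈ Ω, (u, z) ∈ Dp ∧ ∀ w, (u, w) ∈ Dp → w ∉ C)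
    (sel : (∀ z ∈ X, ∀ z' ∈ X, z ≠ z' → ∃ u ∈ Ω, ∃ v ∈ Ω, (u, z) ∈ Dp ∧ (v, z') ∈ Dp ∧
        ∀ w, (u, w) ∈ Dp → (v, w) ∈ Dp → False) ∨
      (∀ {T : Type u} [DTy T M] (G : Set (T × Z)), DSet G → (∀ x, ∃ y, (x, y) ∈ G) →
        ∃ f : T → Z, DFn f ∧ ∀ x, (x, f x) ∈ G))
    {T : Type u} [DTy T M] (K : T → Filter M) (hK : ∀ x, IsOT (K x)) (dK : DK K) : LimP X Cl K := by
  intro U _ g hg hgX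
  have hg' : ∀ {T' : Type u} [DTy T' M] (h : T' → (U × T) × M) [DFn h], DFn (fun x => g (h x)) :=
    fun h => DFn.comp hg ‹_›
  have d1 : DSet {p : (((U × P) × T) × M) | (p.1.1.2, g ((p.1.1.1, p.1.2), p.2)) ∈ Dp} := inferInstance
  have d2 : DSet {p : (U × P) × T | ∀ᶠ y in K p.2, (p.1.2, g ((p.1.1, p.2), y)) ∈ Dp} := dK _ d1
  have dG : DSet {p : (U × T) × Z | p.2 ∈ X ∧ ∀ u, u ∈ Ω → (u, p.2) ∈ Dp → ((p.1.1, u), p.1.2) ∈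
    {p : (U × P) × T | ∀ᶠ y in K p.2, (p.1.2, g ((p.1.1, p.2), y)) ∈ Dp}} := inferInstance
  set G : Set ((U × T) × Z) := {p : (U × T) × Z | p.2 ∈ X ∧ ∀ u, u ∈ Ω → (u, p.2) ∈ Dp → ((p.1.1, u), p.1.2) ∈
    {p : (U × P) × T | ∀ᶠ y in K p.2, (p.1.2, g ((p.1.1, p.2), y)) ∈ Dp}} with hGdef
  have hGm : ∀ p z, (p, z) ∈ G ↔ z ∈ X ∧ ∀ u, u ∈ Ω → (u, z) ∈ Dp → ∀ᶠ y in K p.2, (u, g (p, y)) ∈ Dp :=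
    fun p z => Iff.rfl
  have hGne : ∀ p, ∃ z, (p, z) ∈ G := by
    intro p
    have : DFn (fun y : M => g (p, y)) := inferInstance
    obtain ⟨z, hz, h⟩ := conv (K p.2) (hK p.2) _ this fun y => hgX _
    exact ⟨z, (hGm _ _).2 ⟨hz, h⟩⟩
  have hsel : ∃ f : U × T → Z, DFn f ∧ ∀ p, (p, f p) ∈ G := by
    rcases sel with sel | sel
    · by_cases hne : Nonempty (U × T)
      · obtain ⟨p0⟩ := hne
        obtain ⟨z0, -⟩ := hGne p0
        obtain ⟨f, hf, hf'⟩ := fn_of_graph G (fun p z z' hz hz' => by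
          by_contra hzz
          obtain ⟨u, hu, v, hv, h1, h2, h3⟩ := sel z hz.1 z' hz'.1 hzz
          have := (hK p.2).neBot
          obtain ⟨y, y1, y2⟩ := ((((hGm _ _).1 hz).2 u hu h1).and (((hGm _ _).1 hz').2 v hv h2)).exists
          exact h3 _ y1 y2) z0
        refine ⟨f, hf, fun p => ?_⟩
        obtain ⟨z, hz⟩ := hGne p
        rw [hf' p z hz]
        exact hz
      · obtain ⟨m⟩ : Nonempty M := OMin.ne
        exact absurd ⟨DTy.e.symm fun _ => m⟩ hne
    · exact sel G dG hGne
  obtain ⟨f, hf, hf'⟩ := hsel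
  refine ⟨f, hf, fun p => (hf' p).1, fun p C hC h => ?_⟩
  by_contra hcon
  obtain ⟨u, hu, h1, h2⟩ := clo C hC _ (hf' p).1 hcon
  have := (hK p.2).neBot
  obtain ⟨y, y1, y2⟩ := ((((hGm _ _).1 (hf' p)).2 u hu h1).and h).exists
  exact h2 _ y1 y2

theorem right_lim (dX : DSet X) (dΩ : DSet Ω) (dDp : DSet Dp) (I : Set M) (dI : DSet I) (hne : I.Nonempty)
    (hnm : ∀ x ∈ I, ∃ y ∈ I, x < y) (g : M → Z) (dg : DFn g) (hgX : ∀ s ∈ I, g s ∈ X)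
    (hcomp : ∀ E : Set (M × Z), DSet E → (∀ t ∈ I, ∃ z, (t, z) ∈ E) →
      (∀ s ∈ I, ∀ t ∈ I, ∃ r ∈ I, ∀ z, (r, z) ∈ E → (s, z) ∈ E ∧ (t, z) ∈ E) →
      (∀ t z, (t, z) ∈ E → z ∈ X) →
      (∀ t, ∀ z ∈ X, (t, z) ∉ E → ∃ u ∈ Ω, (u, z) ∈ Dp ∧ ∀ w ∈ X, (u, w) ∈ Dp → (t, w) ∉ E) →
      ∃ x, ∀ t ∈ I, (t, x) ∈ E) :
    ∃ x ∈ X, ∀ u ∈ Ω, (u, x) ∈ Dp → ∃ t ∈ I, ∀ s ∈ I, t ≤ s → (u, g s) ∈ Dp := by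
  have hg' : ∀ {T' : Type u} [DTy T' M] (h : T' → M) [DFn h], DFn (fun x => g (h x)) :=
    fun h => DFn.comp dg ‹_›
  have dE : DSet {p : M × Z | p.2 ∈ X ∧ ∀ u, u ∈ Ω → (u, p.2) ∈ Dp → ∃ s, s ∈ I ∧ p.1 ≤ s ∧ (u, g s) ∈ Dp} :=
    inferInstance
  obtain ⟨x, hx⟩ := hcomp _ dE
    (fun t ht => ⟨g t, hgX t ht, fun u hu h => ⟨t, ht, le_rfl, h⟩⟩)
    (fun s hs t ht => by
      have key : ∀ s t : M, s ≤ t → ∀ z, (t, z) ∈ {p : M × Z | p.2 ∈ X ∧ ∀ u, u ∈ Ω → (u, p.2) ∈ Dp → ∃ s, s ∈ I ∧ p.1 ≤ s ∧ (u, g s) ∈ Dp} →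
          (s, z) ∈ {p : M × Z | p.2 ∈ X ∧ ∀ u, u ∈ Ω → (u, p.2) ∈ Dp → ∃ s, s ∈ I ∧ p.1 ≤ s ∧ (u, g s) ∈ Dp} := by
        intro s t hst z hz
        refine ⟨hz.1, fun u hu h => ?_⟩
        obtain ⟨r, h1, h2, h3⟩ := hz.2 u hu h
        exact ⟨r, h1, hst.trans h2, h3⟩
      rcases le_total s t with h | h
      · exact ⟨t, ht, fun z hz => ⟨key s t h z hz, hz⟩⟩
      · exact ⟨s, hs, fun z hz => ⟨hz, key t s h z hz⟩⟩)
    (fun t z h => h.1)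
    (fun t z hz h => by
      have h : ¬ (z ∈ X ∧ ∀ u, u ∈ Ω → (u, z) ∈ Dp → ∃ s, s ∈ I ∧ t ≤ s ∧ (u, g s) ∈ Dp) := h
      push Not at h
      obtain ⟨u, hu, h1, h2⟩ := h hz
      refine ⟨u, hu, h1, fun w hw hw1 hw2 => ?_⟩
      obtain ⟨s, s1, s2, s3⟩ := hw2.2 u hu hw1
      exact h2 s s1 s2 s3)
  obtain ⟨i0, hi0⟩ := hne
  refine ⟨x, (hx i0 hi0).1, fun u hu hux => ?_⟩
  have dH : DSet {s : M | ∃ i, i ∈ I ∧ s ≤ i} := inferInstance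
  have hH : Hend {s : M | ∃ i, i ∈ I ∧ s ≤ i} := by
    refine ⟨fun x y ⟨i, hi, h⟩ hxy => ⟨i, hi, hxy.le.trans h⟩, ⟨i0, i0, hi0, le_rfl⟩, fun y ⟨i, hi, h⟩ => ?_⟩
    obtain ⟨j, hj, hij⟩ := hnm i hi
    exact ⟨j, ⟨j, hj, le_rfl⟩, h.trans_lt hij⟩
  have hL : IsL (tailF {s : M | ∃ i, i ∈ I ∧ s ≤ i}) := ⟨_, dH, hH, rfl⟩
  have dA : DSet {s : M | (u, g s) ∈ Dp} := inferInstance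
  rcases hL.dec {s : M | (u, g s) ∈ Dp} with h | h
  · obtain ⟨c, ⟨i, hi, hci⟩, h⟩ := (mem_tailF hH.ne).1 h
    obtain ⟨j, hj, hij⟩ := hnm i hi
    exact ⟨j, hj, fun s hs hjs => h s ⟨s, hs, le_rfl⟩ ((hci.trans_lt hij).trans_le hjs)⟩
  · exfalso
    obtain ⟨c, ⟨i, hi, hci⟩, h⟩ := (mem_tailF hH.ne).1 h
    obtain ⟨j, hj, hij⟩ := hnm i hi
    obtain ⟨s, s1, s2, s3⟩ := (hx j hj).2 u hu hux
    exact h s ⟨s, s1, le_rfl⟩ ((hci.trans_lt hij).trans_le s2) s3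

/-- the retraction to `X` -/
theorem retr (dX : DSet X) {x0 : Z} (hx0 : x0 ∈ X) : ∃ r : Z → Z, DFn r ∧ (∀ z, r z ∈ X) ∧ ∀ z ∈ X, r z = z := by
  have dG : DSet {p : Z × Z | (p.1 ∈ X ∧ p.1 = p.2) ∨ (p.1 ∉ X ∧ p.2 = x0)} := inferInstance
  obtain ⟨f, hf, h⟩ := fn_of_graph {p : Z × Z | (p.1 ∈ X ∧ p.1 = p.2) ∨ (p.1 ∉ X ∧ p.2 = x0)} (by
    rintro x y z (⟨h1, h2⟩ | ⟨h1, h2⟩) (⟨h3, h4⟩ | ⟨h3, h4⟩)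
    · exact h2.symm.trans h4
    · exact absurd h1 h3
    · exact absurd h3 h1
    · exact h2.trans h4.symm) x0
  have h1 : ∀ z ∈ X, f z = z := fun z hz => h z z (Or.inl ⟨hz, rfl⟩)
  refine ⟨f, hf, fun z => ?_, h1⟩
  by_cases hz : z ∈ X
  · rw [h1 z hz]; exact hz
  · rw [h z x0 (Or.inr ⟨hz, rfl⟩)]; exact hx0

/-- coordinate powers -/
@[reducible] instance finDTy {n : ℕ} : DTy (Fin n → M) M where
  ι := Fin n
  fin := inferInstance
  e := Equiv.refl _

theorem pow_fin : ∀ n : ℕ, ∃ (T : Type u) (d : DTy T M), Pow M T d ∧ ∃ f : T → (Fin n → M), DFn f ∧ Function.Surjective f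
  | 0 => by
    let _ : DTy PUnit.{u+1} M := punitDTy
    exact ⟨PUnit, punitDTy, Pow.zero, fun _ => Fin.elim0, DFn.const' _, fun v => ⟨PUnit.unit, Subsingleton.elim _ _⟩⟩
  | n + 1 => by
    obtain ⟨T, d, hT, f, hf, hs⟩ := pow_fin n
    refine ⟨M × T, inferInstance, Pow.succ d hT, fun p => Fin.cons p.1 (f p.2), ?_, ?_⟩
    · have h1 : DFn (fun p : M × (Fin n → M) => (Fin.cons p.1 p.2 : Fin (n+1) → M)) :=
        DFn.ofCoord (Fin.cons (Sum.inl ()) Sum.inr) (by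
          rintro ⟨x, v⟩
          funext i
          refine Fin.cases ?_ (fun j => ?_) i
          · rfl
          · rfl)
      have h2 : DFn (fun p : M × T => (p.1, f p.2)) := by
        have hg' : ∀ {T' : Type u} [DTy T' M] (h : T' → T) [DFn h], DFn (fun x => f (h x)) :=
          fun h => DFn.comp hf ‹_›
        infer_instance
      exact DFn.comp h1 h2
    · intro v
      obtain ⟨t, ht⟩ := hs (Fin.tail v)
      exact ⟨(v 0, t), by simp [ht]⟩

/-- directed families of closed sets have common points -/
theorem common (dX : DSet X) (hLim : ∀ {T : Type u} [DTy T M] (K : T → Filter M), (∀ x, IsOT (K x)) → DK K → LimP X Cl K)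
    {m k : ℕ} (A : Set ((Fin m → M) × (Fin k → M))) (dA : DSet A) (hne : ∀ w, ∃ t, (w, t) ∈ A)
    (hdir : ∀ u v, ∃ w, ∀ t, (w, t) ∈ A → (u, t) ∈ A ∧ (v, t) ∈ A)
    (r : (Fin k → M) → Z) (dr : DFn r) (hr : ∀ z, r z ∈ X)
    (C : (Fin m → M) → Set Z) (hC : ∀ u, C u ∈ Cl) (hrC : ∀ u t, (u, t) ∈ A → r t ∈ C u) :
    ∃ x, ∀ u, x ∈ C u := by
  obtain ⟨W, dW, hW, f, hf, hfs⟩ := pow_fin (M := M) m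
  obtain ⟨T, dT, hT, h, hh, hhs⟩ := pow_fin (M := M) k
  have hf' : ∀ {T' : Type u} [DTy T' M] (g : T' → W) [DFn g], DFn (fun x => f (g x)) :=
    fun g => DFn.comp hf ‹_›
  have hh' : ∀ {T' : Type u} [DTy T' M] (g : T' → T) [DFn g], DFn (fun x => h (g x)) :=
    fun g => DFn.comp hh ‹_›
  have dB : DSet {p : W × T | (f p.1, h p.2) ∈ A} := inferInstance
  obtain ⟨F, gF, hF⟩ := main_ext hLim hW hT {p : W × T | (f p.1, h p.2) ∈ A}
    (fun w => by
      obtain ⟨t, ht⟩ := hne (f w)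
      obtain ⟨t', rfl⟩ := hhs t
      exact ⟨t', ht⟩)
    (fun u v => by
      obtain ⟨w, hw⟩ := hdir (f u) (f v)
      obtain ⟨w', rfl⟩ := hfs w
      exact ⟨w', fun t ht => hw _ ht⟩)
  obtain ⟨m0⟩ : Nonempty M := OMin.ne
  obtain ⟨g', -, -, h3⟩ := gF.lim (U := M) (fun p => r (h p.2)) (DFn.comp dr inferInstance) fun p => hr _
  refine ⟨g' (m0, m0), fun u => h3 (m0, m0) (C u) (hC u) ?_⟩
  obtain ⟨w, rfl⟩ := hfs u
  exact Filter.mem_of_superset (hF w) fun t ht => hrC _ _ ht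

end
end OM


namespace OM
universe u
set_option synthInstance.maxSize 5000
set_option synthInstance.maxHeartbeats 400000
set_option maxHeartbeats 1000000
set_option linter.unusedSectionVars false

/-- definable sets of a first order structure -/
@[reducible] def dsOf (L : FirstOrder.Language) (M : Type u) [L.Structure M] : DS M where
  D := fun s => (Set.univ : Set M).Definable L s
  compl := fun h => h.compl
  inter := fun h1 h2 => h1.inter h2
  iInter := fun h => Set.definable_iInter_of_finite h
  reidx := fun f _ h => h.preimage_comp f
  proj := fun h => h.exists_of_finite
  eq := fun i j => by
    have := (Set.Definable.diagonal L (Set.univ : Set M)).preimage_comp ![i, j]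
    exact this
  const := fun i a => by
    have := (Set.Definable.singleton_of_mem (L := L) (Set.mem_univ a)).preimage_comp ![i]
    exact this

theorem ominOf (L : FirstOrder.Language) (M : Type u) [L.Structure M] [LinearOrder M] (hM : IsOMinimal L M) :
    @OMin M (dsOf L M) _ := by
  let _ : DS M := dsOf L M
  obtain ⟨h1, h2, h3, h4, h5, h6⟩ := hM
  refine ⟨h1, h2, h3, h4, ⟨?_⟩, ?_⟩
  · have := (h5.mono (Set.empty_subset (Set.univ : Set M))).preimage_comp
      (![Sum.inl (), Sum.inr ()] : Fin 2 → Unit ⊕ Unit)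
    exact this
  · classical
    intro A hA
    have hA1 : Set.Definable₁ (Set.univ : Set M) L A := by
      have : (Set.univ : Set M).Definable L {v : Unit → M | v () ∈ A} := hA.out
      exact this.preimage_comp (fun _ : Unit => (0 : Fin 1))
    obtain ⟨F, rfl, hF⟩ := h6 A hA1
    have key : ∀ F : Finset (Set M), (∀ t ∈ F, (∃ a : M, t = {a}) ∨ (∃ a b : M, t = Set.Ioo a b) ∨
        (∃ a : M, t = Set.Ioi a) ∨ (∃ a : M, t = Set.Iio a) ∨ t = Set.univ) →
        ∃ B : Finset M, ∀ x y, (∀ b ∈ B, (b < x ↔ b < y) ∧ (b ≤ x ↔ b ≤ y)) → ∀ t ∈ F, (x ∈ t ↔ y ∈ t) := by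
      intro F
      induction F using Finset.induction_on with
      | empty => intro _; exact ⟨∅, by simp⟩
      | @insert s F _ ih =>
        intro h
        obtain ⟨B, hB⟩ := ih fun t ht => h t (Finset.mem_insert_of_mem ht)
        have : ∃ B' : Finset M, ∀ x y, (∀ b ∈ B', (b < x ↔ b < y) ∧ (b ≤ x ↔ b ≤ y)) → (x ∈ s ↔ y ∈ s) := by
          rcases h s (Finset.mem_insert_self _ _) with ⟨a, rfl⟩ | ⟨a, b, rfl⟩ | ⟨a, rfl⟩ | ⟨a, rfl⟩ | rfl
          · refine ⟨{a}, fun x y hxy => ?_⟩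
            obtain ⟨q1, q2⟩ := hxy a (by simp)
            simp only [Set.mem_singleton_iff]
            constructor
            · rintro rfl
              exact le_antisymm (not_lt.1 fun h => lt_irrefl _ (q1.2 h)) (q2.1 le_rfl)
            · rintro rfl
              exact le_antisymm (not_lt.1 fun h => lt_irrefl _ (q1.1 h)) (q2.2 le_rfl)
          · refine ⟨{a, b}, fun x y hxy => ?_⟩
            obtain ⟨q1, q2⟩ := hxy a (by simp)
            obtain ⟨q3, q4⟩ := hxy b (by simp)
            simp only [Set.mem_Ioo, ← not_le, q4]
            simp only [not_le, q1]
          · refine ⟨{a}, fun x y hxy => ?_⟩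
            obtain ⟨q1, q2⟩ := hxy a (by simp)
            exact q1
          · refine ⟨{a}, fun x y hxy => ?_⟩
            obtain ⟨q1, q2⟩ := hxy a (by simp)
            simp only [Set.mem_Iio, ← not_le, q2]
          · exact ⟨∅, by simp⟩
        obtain ⟨B', hB'⟩ := this
        refine ⟨B ∪ B', fun x y hxy t ht => ?_⟩
        rcases Finset.mem_insert.1 ht with rfl | ht
        · exact hB' x y fun b hb => hxy b (Finset.mem_union_right _ hb)
        · exact hB x y (fun b hb => hxy b (Finset.mem_union_left _ hb)) t ht
    obtain ⟨B, hB⟩ := key F hF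
    refine ⟨B, fun x y hxy => ?_⟩
    simp only [Set.mem_sUnion, Finset.mem_coe]
    exact exists_congr fun t => and_congr_right fun ht => hB x y hxy t ht

theorem noMax_int {M : Type u} [LinearOrder M] [DenselyOrdered M] [NoMaxOrder M] {I : Set M}
    (h : IsOpenIntervalSet I) : ∀ x ∈ I, ∃ y ∈ I, x < y := by
  rcases h with ⟨a, b, rfl⟩ | ⟨a, rfl⟩ | ⟨a, rfl⟩ | rfl <;> intro x hx
  · obtain ⟨y, h1, h2⟩ := exists_between hx.2
    exact ⟨y, ⟨hx.1.trans h1, h2⟩, h1⟩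
  · obtain ⟨y, h⟩ := exists_gt x
    exact ⟨y, lt_trans hx h, h⟩
  · obtain ⟨y, h1, h2⟩ := exists_between (show x < a from hx)
    exact ⟨y, h2, h1⟩
  · obtain ⟨y, h⟩ := exists_gt x
    exact ⟨y, trivial, h⟩

theorem noMin_int {M : Type u} [LinearOrder M] [DenselyOrdered M] [NoMinOrder M] {I : Set M}
    (h : IsOpenIntervalSet I) : ∀ x ∈ I, ∃ y ∈ I, y < x := by
  rcases h with ⟨a, b, rfl⟩ | ⟨a, rfl⟩ | ⟨a, rfl⟩ | rfl <;> intro x hx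
  · obtain ⟨y, h1, h2⟩ := exists_between hx.1
    exact ⟨y, ⟨h1, h2.trans hx.2⟩, h2⟩
  · obtain ⟨y, h1, h2⟩ := exists_between (show a < x from hx)
    exact ⟨y, h1, h2⟩
  · obtain ⟨y, h⟩ := exists_lt x
    exact ⟨y, lt_trans h hx, h⟩
  · obtain ⟨y, h⟩ := exists_lt x
    exact ⟨y, trivial, h⟩

section
variable {L : FirstOrder.Language} {M : Type u} [L.Structure M]

theorem dset_iff {n : ℕ} (A : Set (Fin n → M)) :
    @DSet M (dsOf L M) _ (@finDTy M n) A ↔ (Set.univ : Set M).Definable L A := by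
  let _ : DS M := dsOf L M
  exact ⟨fun h => h.out, fun h => ⟨h⟩⟩

theorem dset_fam {m n : ℕ} (D : Set (Fin m ⊕ Fin n → M)) (h : (Set.univ : Set M).Definable L D) :
    let _ : DS M := dsOf L M
    DSet {p : (Fin m → M) × (Fin n → M) | Sum.elim p.1 p.2 ∈ D} := by
  intro _
  constructor
  have e : {v : Fin m ⊕ Fin n → M | Sum.elim (v ∘ Sum.inl) (v ∘ Sum.inr) ∈ D} = D := by
    ext v
    change Sum.elim (v ∘ Sum.inl) (v ∘ Sum.inr) ∈ D ↔ _
    rw [Sum.elim_comp_inl_inr]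
  rw [← e] at h
  exact h

theorem fam_dset {m n : ℕ} (A : Set ((Fin m → M) × (Fin n → M)))
    (h : let _ : DS M := dsOf L M; DSet A) :
    (Set.univ : Set M).Definable L {w : Fin m ⊕ Fin n → M | (w ∘ Sum.inl, w ∘ Sum.inr) ∈ A} := h.out

end
end OM

namespace OM
universe u
set_option synthInstance.maxSize 5000
set_option synthInstance.maxHeartbeats 400000
set_option maxHeartbeats 1000000
set_option linter.unusedSectionVars false

theorem choice_of (L : FirstOrder.Language) (M : Type u) [L.Structure M] (hc : HasDefinableChoice L M) {k : ℕ} :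
    let _ : DS M := dsOf L M
    ∀ {T : Type u} [DTy T M] (G : Set (T × (Fin k → M))), DSet G → (∀ x, ∃ y, (x, y) ∈ G) →
        ∃ f : T → (Fin k → M), DFn f ∧ ∀ x, (x, f x) ∈ G := by
  intro _ T dT G dG hG
  obtain ⟨n, ⟨en⟩⟩ := Finite.exists_equiv_fin (DTy.ι T)
  let f : T → (Fin n → M) := fun x => DTy.e x ∘ en.symm
  let f' : (Fin n → M) → T := fun v => DTy.e.symm (v ∘ en)
  have df : DFn f := DFn.ofCoord en.symm fun _ => rfl
  have df' : DFn f' := DFn.ofCoord en fun _ => by simp [f']; rfl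
  have hff : ∀ x, f' (f x) = x := by
    intro x
    simp [f, f', Function.comp_assoc]
  have hf' : ∀ {T' : Type u} [DTy T' M] (h : T' → (Fin n → M)) [DFn h], DFn (fun x => f' (h x)) :=
    fun h => DFn.comp df' ‹_›
  have dG' : DSet {p : (Fin n → M) × (Fin k → M) | (f' p.1, p.2) ∈ G} := inferInstance
  obtain ⟨s, hs, ds⟩ := hc n k Set.univ _ Set.definable_univ (fam_dset (L := L) _ dG') (by
    intro v _
    obtain ⟨y, hy⟩ := hG (f' v)
    exact ⟨y, hy⟩)
  have dS : DFn s := by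
    refine ⟨?_⟩
    have := dset_fam (L := L) _ ds
    convert this using 1
    ext ⟨x, y⟩
    simp
  refine ⟨fun x => s (f x), DFn.comp dS df, fun x => ?_⟩
  have := hs (f x) trivial
  change (f' (f x), s (f x)) ∈ G at this
  rwa [hff] at this

theorem main (L : FirstOrder.Language) (M : Type u) [L.Structure M] [LinearOrder M]
    (hM : IsOMinimal L M) (k : ℕ) (X : Set (Fin k → M)) [TopologicalSpace ↥X]
    (hX : IsDefTopSpace L X) :
    (DefinablyCompact L X → CurveCompact L X) ∧
    ((T2Space ↥X ∨ HasDefinableChoice L M) →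
      (DefinablyCompact L X ↔ CurveCompact L X)) := by
  let _ : DS M := dsOf L M
  have _ : OMin M := ominOf L M hM
  obtain ⟨hXd, B, ⟨m, Ω, D, hΩ, hD, rfl⟩, hBX, hB⟩ := hX
  have dX : DSet X := (dset_iff X).2 hXd
  have dΩ : DSet Ω := (dset_iff Ω).2 hΩ
  have dDp := dset_fam D hD
  set Dp : Set ((Fin m → M) × (Fin k → M)) := {p | Sum.elim p.1 p.2 ∈ D} with hDp
  have opn : ∀ u ∈ Ω, IsOpen (Subtype.val ⁻¹' famFiber D u : Set ↥X) := fun u hu =>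
    hB.isOpen ⟨_, ⟨u, hu, rfl⟩, rfl⟩
  have sub : ∀ u ∈ Ω, ∀ z, (u, z) ∈ Dp → z ∈ X := fun u hu z hz => hBX _ ⟨u, hu, rfl⟩ hz
  have nbhd : ∀ O : Set ↥X, IsOpen O → ∀ z (hz : z ∈ X), (⟨z, hz⟩ : ↥X) ∈ O →
      ∃ u ∈ Ω, (u, z) ∈ Dp ∧ ∀ w (hw : w ∈ X), (u, w) ∈ Dp → (⟨w, hw⟩ : ↥X) ∈ O := by
    intro O hO z hz hzO
    obtain ⟨_, ⟨_, ⟨u, hu, rfl⟩, rfl⟩, h1, h2⟩ := hB.exists_subset_of_mem_open hzO hO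
    exact ⟨u, hu, h1, fun w hw hw' => h2 hw'⟩
  obtain ⟨m0⟩ : Nonempty M := OMin.ne
  -- first direction
  have dir1 : DefinablyCompact L X → CurveCompact L X := by
    intro hc I γ ⟨hI, hIne, hγX, hγ⟩
    have dq : DFn (fun v : Fin 1 → M => v 0) := DFn.ofCoord (fun _ => (0 : Fin 1)) fun _ => rfl
    have dq' : DFn (fun (x : M) (_ : Fin 1) => x) := DFn.ofCoord (fun _ => ()) fun _ => rfl
    have dG1 := dset_fam _ hγ
    have dG : DSet {p : M × (Fin k → M) | p.1 ∈ I ∧ γ p.1 = p.2} := by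
      have h1 : ∀ {T' : Type u} [DTy T' M] (h : T' → M) [DFn h], DFn (fun x => (fun (x : M) (_ : Fin 1) => x) (h x)) :=
        fun h => DFn.comp dq' ‹_›
      have h2 : DFn (fun p : M × (Fin k → M) => ((fun (x : M) (_ : Fin 1) => x) p.1, p.2)) := by
        have := h1 (fun p : M × (Fin k → M) => p.1)
        infer_instance
      have := dG1.pre h2
      convert this using 1
      ext p
      exact and_congr_right fun _ => funext_iff
    have dI : DSet I := by
      have := dG.ex
      convert this using 1
      ext x
      exact ⟨fun h => ⟨γ x, h, rfl⟩, fun ⟨y, h⟩ => h.1⟩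
    obtain ⟨i0, hi0⟩ := hIne
    obtain ⟨g, dg, hg⟩ := fn_of_graph {p : M × (Fin k → M) | p.1 ∈ I ∧ γ p.1 = p.2}
      (fun x y z h1 h2 => h1.2.symm.trans h2.2) (γ i0)
    have hg : ∀ x ∈ I, g x = γ x := fun x hx => hg x _ ⟨hx, rfl⟩
    have hcomp : ∀ E : Set (M × (Fin k → M)), DSet E → (∀ t ∈ I, ∃ z, (t, z) ∈ E) →
      (∀ s ∈ I, ∀ t ∈ I, ∃ r ∈ I, ∀ z, (r, z) ∈ E → (s, z) ∈ E ∧ (t, z) ∈ E) →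
      (∀ t z, (t, z) ∈ E → z ∈ X) →
      (∀ t, ∀ z ∈ X, (t, z) ∉ E → ∃ u ∈ Ω, (u, z) ∈ Dp ∧ ∀ w ∈ X, (u, w) ∈ Dp → (t, w) ∉ E) →
      ∃ x, ∀ t ∈ I, (t, x) ∈ E := by
      intro E dE hne hdir hEX hcl
      have dq1 : ∀ {T' : Type u} [DTy T' M] (h : T' → (Fin 1 → M)) [DFn h], DFn (fun x => h x 0) :=
        fun h => DFn.comp dq ‹_›
      have dE' : DSet {p : (Fin 1 → M) × (Fin k → M) | (p.1 0, p.2) ∈ E} := by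
        have := dq1 (fun p : (Fin 1 → M) × (Fin k → M) => p.1)
        infer_instance
      have dI' : DSet {v : Fin 1 → M | v 0 ∈ I} := dI.pre dq
      have hfib : ∀ v : Fin 1 → M, famFiber {w : Fin 1 ⊕ Fin k → M | (w ∘ Sum.inl, w ∘ Sum.inr) ∈
          {p : (Fin 1 → M) × (Fin k → M) | (p.1 0, p.2) ∈ E}} v = {z | (v 0, z) ∈ E} := fun v => rfl
      obtain ⟨x, hx⟩ := hc (famFiber {w : Fin 1 ⊕ Fin k → M | (w ∘ Sum.inl, w ∘ Sum.inr) ∈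
          {p : (Fin 1 → M) × (Fin k → M) | (p.1 0, p.2) ∈ E}} '' {v : Fin 1 → M | v 0 ∈ I})
        ⟨1, _, _, (dset_iff _).1 dI', fam_dset _ dE', rfl⟩
        (by
          constructor
          · rintro ⟨v, hv, h⟩
            obtain ⟨z, hz⟩ := hne (v 0) hv
            rw [hfib] at h
            have : z ∈ ({z | (v 0, z) ∈ E} : Set (Fin k → M)) := hz
            rw [h] at this
            exact this
          · rintro _ ⟨v, hv, rfl⟩ _ ⟨w, hw, rfl⟩
            obtain ⟨r, hr, h⟩ := hdir (v 0) hv (w 0) hw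
            exact ⟨_, ⟨fun _ => r, hr, rfl⟩, fun z hz => h z hz⟩)
        (by
          rintro _ ⟨v, hv, rfl⟩
          refine ⟨hne (v 0) hv, fun z hz => hEX _ z hz, ?_⟩
          rw [← isOpen_compl_iff, isOpen_iff_forall_mem_open]
          rintro ⟨z, hzX⟩ hz
          obtain ⟨u, hu, h1, h2⟩ := hcl (v 0) z hzX hz
          exact ⟨_, fun w hw => h2 w.1 w.2 hw, opn u hu, h1⟩)
      exact ⟨x, fun t ht => hx _ ⟨fun _ => t, ht, rfl⟩⟩
    constructor
    · obtain ⟨x, hxX, hx⟩ := @right_lim M _ (swapLO M) (swapOMin M) _ _ _ _ X Ω Dp dX dΩ dDp I dI ⟨i0, hi0⟩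
        (noMin_int hI) g dg (fun s hs => by rw [hg s hs]; exact hγX s hs) hcomp
      refine ⟨x, hxX, fun A hA hAo hxA => ?_⟩
      obtain ⟨u, hu, h1, h2⟩ := nbhd _ hAo x hxX hxA
      obtain ⟨t, ht, h⟩ := hx u hu h1
      refine ⟨t, ht, fun s hs hst => ?_⟩
      have := h s hs hst
      rw [hg s hs] at this
      exact h2 _ (hγX s hs) this
    · obtain ⟨x, hxX, hx⟩ := right_lim dX dΩ dDp I dI ⟨i0, hi0⟩
        (noMax_int hI) g dg (fun s hs => by rw [hg s hs]; exact hγX s hs) hcomp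
      refine ⟨x, hxX, fun A hA hAo hxA => ?_⟩
      obtain ⟨u, hu, h1, h2⟩ := nbhd _ hAo x hxX hxA
      obtain ⟨t, ht, h⟩ := hx u hu h1
      refine ⟨t, ht, fun s hs hst => ?_⟩
      have := h s hs hst
      rw [hg s hs] at this
      exact h2 _ (hγX s hs) this
  refine ⟨dir1, fun hor => ⟨dir1, fun hcc => ?_⟩⟩
  -- second direction
  have dcurve : ∀ (I : Set M), DSet I → IsOpenIntervalSet I → I.Nonempty → ∀ g : M → (Fin k → M), DFn g →
      (∀ y, g y ∈ X) → IsDefCurve L X I g := by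
    intro I dI hI hne g dg hg
    refine ⟨hI, hne, fun s _ => hg s, ?_⟩
    have dq : DFn (fun v : Fin 1 → M => v 0) := DFn.ofCoord (fun _ => (0 : Fin 1)) fun _ => rfl
    have h0 : DFn (fun p : (Fin 1 → M) × (Fin k → M) => p.1 0) :=
      DFn.comp (f := fun p : (Fin 1 → M) × (Fin k → M) => p.1) dq inferInstance
    have h1 : DFn (fun p : (Fin 1 → M) × (Fin k → M) => g (p.1 0)) := DFn.comp dg h0
    have h2 : DSet {p : (Fin 1 → M) × (Fin k → M) | p.1 0 ∈ I ∧ g (p.1 0) = p.2} := inferInstance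
    have := fam_dset (L := L) _ h2
    convert this using 1
    ext w
    exact and_congr_right fun _ => funext_iff.symm
  have conv : ∀ F : Filter M, IsOT F → ∀ g : M → (Fin k → M), DFn g → (∀ y, g y ∈ X) →
      ∃ z ∈ X, ∀ u ∈ Ω, (u, z) ∈ Dp → ∀ᶠ y in F, (u, g y) ∈ Dp := by
    intro F hF g dg hg
    rcases hF with ⟨a, rfl⟩ | ⟨H, dH, hH, rfl⟩ | ⟨H, dH, hH, rfl⟩
    · exact ⟨g a, hg a, fun u hu h => h⟩
    · have hHI : IsOpenIntervalSet H := by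
        by_cases hall : ∃ z, z ∉ H
        · obtain ⟨a, ha | ha⟩ := cut hH.low hH.ne hall
          · exact Or.inr (Or.inr (Or.inl ⟨a, Set.ext ha⟩))
          · obtain ⟨y, hy, h⟩ := hH.nomax a ((ha a).2 le_rfl)
            exact absurd ((ha y).1 hy) (not_le.2 h)
        · push Not at hall
          exact Or.inr (Or.inr (Or.inr (Set.eq_univ_of_forall hall)))
      obtain ⟨z, hz, h⟩ := (hcc H g (dcurve H dH hHI hH.ne g dg hg)).2
      refine ⟨z, hz, fun u hu huz => ?_⟩
      obtain ⟨t, ht, h'⟩ := h (famFiber D u) (sub u hu) (opn u hu) huz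
      exact (mem_tailF hH.ne).2 ⟨t, ht, fun y hy hty => h' y hy hty.le⟩
    · have hlow := @Hend.low M (swapLO M) H hH
      have hne : H.Nonempty := @Hend.ne M (swapLO M) H hH
      have hnm : ∀ x ∈ H, ∃ y ∈ H, y < x := @Hend.nomax M (swapLO M) H hH
      have hHI : IsOpenIntervalSet H := by
        by_cases hall : ∃ z, z ∉ H
        · obtain ⟨a, ha | ha⟩ := @cut M _ (swapLO M) (swapOMin M) H dH hlow hne hall
          · exact Or.inr (Or.inl ⟨a, Set.ext ha⟩)
          · have ha : ∀ x, x ∈ H ↔ a ≤ x := ha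
            obtain ⟨y, hy, h⟩ := hnm a ((ha a).2 le_rfl)
            exact absurd ((ha y).1 hy) (not_le.2 h)
        · push Not at hall
          exact Or.inr (Or.inr (Or.inr (Set.eq_univ_of_forall hall)))
      obtain ⟨z, hz, h⟩ := (hcc H g (dcurve H dH hHI hne g dg hg)).1
      refine ⟨z, hz, fun u hu huz => ?_⟩
      obtain ⟨t, ht, h'⟩ := h (famFiber D u) (sub u hu) (opn u hu) huz
      exact (@mem_tailF M (swapLO M) H hne _).2 ⟨t, ht, fun y hy hty => h' y hy (le_of_lt (show y < t from hty))⟩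
  have clo : ∀ C ∈ {C | TauClosed X C}, ∀ z ∈ X, z ∉ C →
      ∃ u ∈ Ω, (u, z) ∈ Dp ∧ ∀ w, (u, w) ∈ Dp → w ∉ C := by
    intro C hC z hz hzC
    obtain ⟨u, hu, h1, h2⟩ := nbhd _ hC.2.isOpen_compl z hz hzC
    exact ⟨u, hu, h1, fun w hw => h2 w (sub u hu w hw) hw⟩
  have sel : (∀ z ∈ X, ∀ z' ∈ X, z ≠ z' → ∃ u ∈ Ω, ∃ v ∈ Ω, (u, z) ∈ Dp ∧ (v, z') ∈ Dp ∧
        ∀ w, (u, w) ∈ Dp → (v, w) ∈ Dp → False) ∨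
      (∀ {T : Type u} [DTy T M] (G : Set (T × (Fin k → M))), DSet G → (∀ x, ∃ y, (x, y) ∈ G) →
        ∃ f : T → (Fin k → M), DFn f ∧ ∀ x, (x, f x) ∈ G) := by
    rcases hor with h | h
    · left
      intro z hz z' hz' hne
      obtain ⟨U, V, hU, hV, h1, h2, h3⟩ := t2_separation (X := ↥X) (x := ⟨z, hz⟩) (y := ⟨z', hz'⟩)
        (fun h => hne (congrArg Subtype.val h))
      obtain ⟨u, hu, u1, u2⟩ := nbhd U hU z hz h1
      obtain ⟨v, hv, v1, v2⟩ := nbhd V hV z' hz' h2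
      exact ⟨u, hu, v, hv, u1, v1, fun w w1 w2 =>
        Set.disjoint_left.1 h3 (u2 w (sub u hu w w1) w1) (v2 w (sub u hu w w1) w2)⟩
    · exact Or.inr (choice_of L M h)
  rintro _ ⟨m', Ω', D', hΩ', hD', rfl⟩ ⟨hne, hdir⟩ hcl
  by_cases hem : Ω'.Nonempty
  swap
  · rw [Set.not_nonempty_iff_eq_empty.1 hem]
    exact ⟨fun _ => m0, by simp⟩
  obtain ⟨u0, hu0⟩ := hem
  have dΩ' : DSet Ω' := (dset_iff Ω').2 hΩ'
  have dD' := dset_fam D' hD'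
  set E : Set ((Fin m' → M) × (Fin k → M)) := {p | Sum.elim p.1 p.2 ∈ D'} with hE
  have hA : DSet {p : (Fin m' → M) × (Fin k → M) | (p.1 ∈ Ω' ∧ p ∈ E) ∨ (p.1 ∉ Ω' ∧ (u0, p.2) ∈ E)} := inferInstance
  have hex : ∀ w : Fin m' → M, ∃ w' ∈ Ω', (w ∈ Ω' → w' = w) ∧ ∀ t, (w, t) ∈ {p : (Fin m' → M) × (Fin k → M) | (p.1 ∈ Ω' ∧ p ∈ E) ∨ (p.1 ∉ Ω' ∧ (u0, p.2) ∈ E)} ↔ t ∈ famFiber D' w' := by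
    intro w
    by_cases hw : w ∈ Ω'
    · refine ⟨w, hw, fun _ => rfl, fun t => ⟨fun h => ?_, fun h => Or.inl ⟨hw, h⟩⟩⟩
      rcases h with h | h
      · exact h.2
      · exact absurd hw h.1
    · refine ⟨u0, hu0, fun h => absurd h hw, fun t => ⟨fun h => ?_, fun h => Or.inr ⟨hw, h⟩⟩⟩
      rcases h with h | h
      · exact absurd h.1 hw
      · exact h.2
  choose q hq1 hq2 hq3 using hex
  obtain ⟨⟨x0, hx0⟩, hcl0⟩ := hcl _ ⟨u0, hu0, rfl⟩
  obtain ⟨r, dr, hr, hr'⟩ := retr dX (hcl0.1 hx0)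
  obtain ⟨x, hx⟩ := common (Cl := {C | TauClosed X C}) dX
    (fun K hK dK => limP_of dX dΩ dDp conv clo sel K hK dK) _ hA
    (fun w => by
      obtain ⟨t, ht⟩ := (hcl _ ⟨q w, hq1 w, rfl⟩).1
      exact ⟨t, (hq3 w t).2 ht⟩)
    (fun u v => by
      obtain ⟨_, ⟨w, hw, rfl⟩, h⟩ := hdir _ ⟨q u, hq1 u, rfl⟩ _ ⟨q v, hq1 v, rfl⟩
      refine ⟨w, fun t ht => ?_⟩
      rw [hq3, hq2 w hw] at ht
      exact ⟨(hq3 u t).2 (h ht).1, (hq3 v t).2 (h ht).2⟩)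
    r dr hr (fun u => famFiber D' (q u)) (fun u => (hcl _ ⟨q u, hq1 u, rfl⟩).2)
    (fun u t ht => by
      have ht := (hq3 u t).1 ht
      rw [hr' t ((hcl _ ⟨q u, hq1 u, rfl⟩).2.1 ht)]
      exact ht)
  refine ⟨x, ?_⟩
  rintro _ ⟨w, hw, rfl⟩
  have := hx w
  rwa [hq2 w hw] at this

end OM

/-- a definably compact definable topological space is curve-compact; if moreover
the topology is Hausdorff or `M` has definable choice, the two notions are equivalent. -/
theorem statement16 (L : FirstOrder.Language) (M : Type*) [L.Structure M] [LinearOrder M]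
    (hM : IsOMinimal L M) (k : ℕ) (X : Set (Fin k → M)) [TopologicalSpace ↥X]
    (hX : IsDefTopSpace L X) :
    (DefinablyCompact L X → CurveCompact L X) ∧
    ((T2Space ↥X ∨ HasDefinableChoice L M) →
      (DefinablyCompact L X ↔ CurveCompact L X)) := by
  exact OM.main L M hM k X hX
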